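/- Let n = 2, so Ω ⊆ ℂ² is open with almost complex structure J, and let f : 𝔻_R → Ω be a J-holomorphic embedding: f is injective, Df_z : ℂ → ℂ² is injective as an ℝ-linear map for every z ∈ 𝔻_R, and f is a homeomorphism onto its image. Then for every ε ∈ (0, R) there exist an open set W ⊆ ℂ² with f(𝔻_{R−ε}) ⊆ W ⊆ Ω, an open neighborhood V of 0 in ℝ², and a C^∞ diffeomorphism Φ : 𝔻_{R−ε} × V → W such that Φ(z, 0) = f(z) for all z ∈ 𝔻_{R−ε} and, for each fixed x ∈ V, the map z ↦ Φ(z, x) is J-holomorphic on 𝔻_{R−ε} (a neighborhood of f(𝔻_{R−ε}) is fibered by J-holomorphic discs). -/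

import Mathlib

open Metric Set Filter
open scoped ENNReal Topology

noncomputable section

abbrev Cn (n : ℕ) := EuclideanSpace ℂ (Fin n)

def IsAlmostComplexOn (n : ℕ) (Ω : Set (Cn n)) (J : Cn n → (Cn n →L[ℝ] Cn n)) : Prop :=
  ContDiffOn ℝ (⊤ : ℕ∞) J Ω ∧
    ∀ x ∈ Ω, (J x).comp (J x) = -ContinuousLinearMap.id ℝ (Cn n)

def IsJHolomorphicOn (n : ℕ) (Ω : Set (Cn n)) (J : Cn n → (Cn n →L[ℝ] Cn n))
    (R : ℝ) (f : ℂ → Cn n) : Prop :=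
  MapsTo f (ball (0:ℂ) R) Ω ∧
    ∀ z ∈ ball (0:ℂ) R, DifferentiableAt ℝ f z ∧
      ∀ ξ : ℂ, fderiv ℝ f z (Complex.I * ξ) = J (f z) (fderiv ℝ f z ξ)

def kobayashiRoyden (n : ℕ) (Ω : Set (Cn n)) (J : Cn n → (Cn n →L[ℝ] Cn n))
    (p v : Cn n) : ℝ≥0∞ :=
  sInf {c : ℝ≥0∞ | ∃ r : ℝ, 0 < r ∧
    (∃ f : ℂ → Cn n, IsJHolomorphicOn n Ω J 1 f ∧ f 0 = p ∧ fderiv ℝ f 0 1 = r • v) ∧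
    c = ENNReal.ofReal (1 / r)}

/-- The inverse hyperbolic tangent, `arctanh x = ½ log((1 + x)/(1 - x))`. -/
def arctanh (x : ℝ) : ℝ := (1 / 2) * Real.log ((1 + x) / (1 - x))

/-- The Poincaré distance on the unit disc. -/
def poincareDist (z w : ℂ) : ℝ :=
  arctanh (‖z - w‖ / ‖1 - (starRingEnd ℂ) z * w‖)

/-- The Kobayashi pseudodistance `d_Ω(p, q)` of the almost complex manifold `(Ω, J)`. -/
def kobayashiDist (n : ℕ) (Ω : Set (Cn n)) (J : Cn n → (Cn n →L[ℝ] Cn n))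
    (p q : Cn n) : ℝ≥0∞ :=
  sInf {c : ℝ≥0∞ | ∃ m : ℕ, ∃ z w : Fin (m + 1) → ℂ, ∃ f : Fin (m + 1) → ℂ → Cn n,
    (∀ k, z k ∈ ball (0:ℂ) 1 ∧ w k ∈ ball (0:ℂ) 1 ∧ IsJHolomorphicOn n Ω J 1 (f k)) ∧
    f 0 (z 0) = p ∧
    (∀ k : Fin m, f k.castSucc (w k.castSucc) = f k.succ (z k.succ)) ∧
    f (Fin.last m) (w (Fin.last m)) = q ∧
    c = ENNReal.ofReal (∑ k, poincareDist (z k) (w k))}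

/-- `γ` is a piecewise continuously differentiable path in `Ω`, parametrized by `[0,1]`. -/
def IsPiecewiseC1PathIn (n : ℕ) (Ω : Set (Cn n)) (γ : ℝ → Cn n) : Prop :=
  ContinuousOn γ (Icc (0:ℝ) 1) ∧ MapsTo γ (Icc (0:ℝ) 1) Ω ∧
    ∃ (k : ℕ) (t : Fin (k + 1) → ℝ), StrictMono t ∧ t 0 = 0 ∧ t (Fin.last k) = 1 ∧
      ∀ i : Fin k, ContDiffOn ℝ 1 γ (Icc (t i.castSucc) (t i.succ))

/-- The Kobayashi–Royden length `∫₀¹ F_Ω(γ(t), γ′(t)) dt` of a path. -/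
def kobayashiRoydenLength (n : ℕ) (Ω : Set (Cn n)) (J : Cn n → (Cn n →L[ℝ] Cn n))
    (γ : ℝ → Cn n) : ℝ≥0∞ :=
  ∫⁻ t in Icc (0:ℝ) 1, kobayashiRoyden n Ω J (γ t) (deriv γ t)

/-- The integrated Kobayashi–Royden pseudodistance `d̄_Ω(p, q)`. -/
def integratedKRDist (n : ℕ) (Ω : Set (Cn n)) (J : Cn n → (Cn n →L[ℝ] Cn n))
    (p q : Cn n) : ℝ≥0∞ :=
  ⨅ γ : {γ : ℝ → Cn n // IsPiecewiseC1PathIn n Ω γ ∧ γ 0 = p ∧ γ 1 = q},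
    kobayashiRoydenLength n Ω J γ

namespace JH

section Holder
variable (E : Type) [NormedAddCommGroup E] [NormedSpace ℝ E]

/-- Hölder-1/2 pairs as a submodule. -/
def HolSub : Submodule ℝ (lp (fun _ : ℂ => E) ⊤ × lp (fun _ : ℂ × ℂ => E) ⊤) where
  carrier := {p | ∀ z w : ℂ, p.1 z - p.1 w = √‖z - w‖ • p.2 (z, w) ∧ p.2 (z, z) = 0}
  add_mem' := by
    intro a b ha hb z w
    refine ⟨?_, ?_⟩
    · have h1 := (ha z w).1
      have h2 := (hb z w).1
      simp only [Prod.fst_add, Prod.snd_add, lp.coeFn_add, Pi.add_apply, smul_add, ← h1, ← h2]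
      abel
    · simp [(ha z w).2, (hb z w).2]
  zero_mem' := by intro z w; simp
  smul_mem' := by
    intro c a ha z w
    refine ⟨?_, ?_⟩
    · simp only [Prod.smul_fst, Prod.smul_snd, lp.coeFn_smul, Pi.smul_apply, ← smul_sub, (ha z w).1]
      rw [smul_comm]
    · simp [(ha z w).2]

theorem HolSub_closed [CompleteSpace E] : IsClosed (HolSub E : Set (lp (fun _ : ℂ => E) ⊤ × lp (fun _ : ℂ × ℂ => E) ⊤)) := by
  have e1 : ∀ z : ℂ, Continuous fun p : lp (fun _ : ℂ => E) ⊤ × lp (fun _ : ℂ × ℂ => E) ⊤ => p.1 z := by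
    intro z
    have : LipschitzWith 1 fun p : lp (fun _ : ℂ => E) ⊤ => p z := by
      refine LipschitzWith.of_dist_le_mul fun p q => ?_
      rw [dist_eq_norm, dist_eq_norm, NNReal.coe_one, one_mul]
      exact lp.norm_apply_le_norm (by simp) (p - q) z
    exact this.continuous.comp continuous_fst
  have e2 : ∀ z : ℂ × ℂ, Continuous fun p : lp (fun _ : ℂ => E) ⊤ × lp (fun _ : ℂ × ℂ => E) ⊤ => p.2 z := by
    intro z
    have : LipschitzWith 1 fun p : lp (fun _ : ℂ × ℂ => E) ⊤ => p z := by
      refine LipschitzWith.of_dist_le_mul fun p q => ?_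
      rw [dist_eq_norm, dist_eq_norm, NNReal.coe_one, one_mul]
      exact lp.norm_apply_le_norm (by simp) (p - q) z
    exact this.continuous.comp continuous_snd
  have : (HolSub E : Set (lp (fun _ : ℂ => E) ⊤ × lp (fun _ : ℂ × ℂ => E) ⊤)) =
      ⋂ z : ℂ, ⋂ w : ℂ, {p | p.1 z - p.1 w = √‖z - w‖ • p.2 (z, w)} ∩ {p | p.2 (z, z) = 0} := by
    ext p
    simp only [mem_iInter]
    rfl
  rw [this]
  refine isClosed_iInter fun z => isClosed_iInter fun w => ?_
  exact (isClosed_eq ((e1 z).sub (e1 w)) ((e2 (z, w)).const_smul _)).inter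
    (isClosed_eq (e2 (z,z)) continuous_const)

/-- The Hölder space. -/
def X : Type := HolSub E

instance : NormedAddCommGroup (X E) := inferInstanceAs (NormedAddCommGroup (HolSub E))
instance : NormedSpace ℝ (X E) := inferInstanceAs (NormedSpace ℝ (HolSub E))
instance [CompleteSpace E] : CompleteSpace (X E) := (HolSub_closed E).completeSpace_coe

instance : CoeFun (X E) (fun _ => ℂ → E) := ⟨fun φ z => φ.1.1 z⟩

end Holder

/-- bound predicate -/
def Bd {E : Type} [NormedAddCommGroup E] (f : ℂ → E) (C : ℝ) : Prop :=
  (∀ z, ‖f z‖ ≤ C) ∧ ∀ z w, ‖z - w‖ ≤ 1 → ‖f z - f w‖ ≤ C * √‖z - w‖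

namespace X
variable {E F G E₁ E₂ E₃ : Type} [NormedAddCommGroup E] [NormedSpace ℝ E] [NormedAddCommGroup F] [NormedSpace ℝ F]
  [NormedAddCommGroup G] [NormedSpace ℝ G] [NormedAddCommGroup E₁] [NormedSpace ℝ E₁]
  [NormedAddCommGroup E₂] [NormedSpace ℝ E₂] [NormedAddCommGroup E₃] [NormedSpace ℝ E₃]

@[simp] theorem add_apply (φ ψ : X E) (z : ℂ) : (φ + ψ) z = φ z + ψ z := rfl
@[simp] theorem sub_apply (φ ψ : X E) (z : ℂ) : (φ - ψ) z = φ z - ψ z := rfl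
@[simp] theorem neg_apply (φ : X E) (z : ℂ) : (-φ) z = - φ z := rfl
@[simp] theorem zero_apply (z : ℂ) : (0 : X E) z = 0 := rfl
@[simp] theorem smul_apply (c : ℝ) (φ : X E) (z : ℂ) : (c • φ) z = c • φ z := rfl

theorem norm_apply_le (φ : X E) (z : ℂ) : ‖φ z‖ ≤ ‖φ‖ :=
  (lp.norm_apply_le_norm (by simp) φ.1.1 z).trans (norm_fst_le φ.1)

theorem norm_sub_le (φ : X E) (z w : ℂ) : ‖φ z - φ w‖ ≤ ‖φ‖ * √‖z - w‖ := by
  have h := (φ.2 z w).1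
  change φ z - φ w = _ at h
  rw [h, norm_smul, mul_comm, Real.norm_of_nonneg (Real.sqrt_nonneg _)]
  gcongr
  exact (lp.norm_apply_le_norm (by simp) φ.1.2 (z, w)).trans (norm_snd_le φ.1)

theorem sub_apply_eq (φ : X E) (z w : ℂ) (h : z ≠ w) : φ.1.2 (z, w) = (√‖z - w‖)⁻¹ • (φ z - φ w) := by
  have h1 := (φ.2 z w).1
  have h3 : √‖z - w‖ ≠ 0 := by
    have : 0 < ‖z - w‖ := norm_pos_iff.2 (sub_ne_zero.2 h)
    positivity
  change φ z - φ w = _ at h1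
  rw [h1, inv_smul_smul₀ h3]

theorem norm_le_of (φ : X E) {C : ℝ} (h1 : ∀ z, ‖φ z‖ ≤ C) (h2 : ∀ z w, ‖φ z - φ w‖ ≤ C * √‖z - w‖) : ‖φ‖ ≤ C := by
  have hC : 0 ≤ C := (norm_nonneg _).trans (h1 0)
  change ‖φ.1‖ ≤ C
  refine max_le (lp.norm_le_of_forall_le hC h1) (lp.norm_le_of_forall_le hC ?_)
  rintro ⟨z, w⟩
  by_cases h : z = w
  · subst h
    have := (φ.2 z z).2
    simp only at this
    rw [this]; simpa
  · rw [sub_apply_eq φ z w h, norm_smul]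
    have h3 : 0 < √‖z - w‖ := by
      have : 0 < ‖z - w‖ := norm_pos_iff.2 (sub_ne_zero.2 h)
      positivity
    rw [norm_inv, Real.norm_of_nonneg h3.le, inv_mul_le_iff₀ h3, mul_comm]
    exact h2 z w

theorem bd (φ : X E) : Bd φ ‖φ‖ := ⟨norm_apply_le φ, fun z w _ => norm_sub_le φ z w⟩

@[ext] theorem ext {φ ψ : X E} (h : ∀ z, φ z = ψ z) : φ = ψ := by
  have : ‖φ - ψ‖ ≤ 0 := norm_le_of _ (by simp [h]) (by simp [h])
  exact sub_eq_zero.1 (norm_le_zero_iff.1 this)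

theorem continuous (φ : X E) : Continuous φ := by
  rw [continuous_iff_continuousAt]
  intro z
  rw [ContinuousAt, tendsto_iff_norm_sub_tendsto_zero]
  refine squeeze_zero (fun _ => norm_nonneg _) (fun w => norm_sub_le φ w z) ?_
  have : Continuous fun w : ℂ => ‖φ‖ * √‖w - z‖ := by fun_prop
  simpa using this.tendsto z

theorem _root_.JH.Bd.far {f : ℂ → E} {C : ℝ} (h : Bd f C) (z w : ℂ) : ‖f z - f w‖ ≤ 2 * C * √‖z - w‖ := by
  have hC : 0 ≤ C := (norm_nonneg _).trans (h.1 0)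
  by_cases h1 : ‖z - w‖ ≤ 1
  · refine (h.2 z w h1).trans ?_
    gcongr; linarith
  · have : 1 ≤ √‖z - w‖ := Real.one_le_sqrt.2 (not_le.1 h1).le
    calc ‖f z - f w‖ ≤ ‖f z‖ + ‖f w‖ := _root_.norm_sub_le _ _
      _ ≤ 2 * C * 1 := by linarith [h.1 z, h.1 w]
      _ ≤ _ := by gcongr

/-- element from a function -/
def of (f : ℂ → E) (hf : ∃ C, Bd f C) : X E := by
  refine ⟨⟨⟨f, ?_⟩, ⟨fun p => (√‖p.1 - p.2‖)⁻¹ • (f p.1 - f p.2), ?_⟩⟩, ?_⟩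
  · obtain ⟨C, hC⟩ := hf
    exact memℓp_infty ⟨C, by rintro _ ⟨z, rfl⟩; exact hC.1 z⟩
  · obtain ⟨C, hC⟩ := hf
    refine memℓp_infty ⟨2 * C, ?_⟩
    rintro _ ⟨⟨z, w⟩, rfl⟩
    have hC0 : 0 ≤ C := (norm_nonneg _).trans (hC.1 0)
    change ‖(√‖z - w‖)⁻¹ • (f z - f w)‖ ≤ 2 * C
    rw [norm_smul, norm_inv, Real.norm_of_nonneg (Real.sqrt_nonneg _)]
    by_cases h : z = w
    · subst h; simp; positivity
    have h3 : 0 < √‖z - w‖ := by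
      have : 0 < ‖z - w‖ := norm_pos_iff.2 (sub_ne_zero.2 h)
      positivity
    rw [inv_mul_le_iff₀ h3, mul_comm]
    exact hC.far z w
  · intro z w
    refine ⟨?_, by simp⟩
    change f z - f w = √‖z - w‖ • ((√‖z - w‖)⁻¹ • (f z - f w))
    by_cases h : z = w
    · subst h; simp
    have h3 : √‖z - w‖ ≠ 0 := by
      have : 0 < ‖z - w‖ := norm_pos_iff.2 (sub_ne_zero.2 h)
      positivity
    rw [smul_inv_smul₀ h3]

@[simp] theorem of_apply (f : ℂ → E) (hf : ∃ C, Bd f C) (z : ℂ) : of f hf z = f z := rfl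

theorem norm_le_of_bd {φ : X E} {C : ℝ} (h : Bd φ C) : ‖φ‖ ≤ 2 * C := by
  have hC : 0 ≤ C := (norm_nonneg _).trans (h.1 0)
  exact norm_le_of _ (fun z => (h.1 z).trans (by linarith)) h.far

/-- linear operators from pointwise data -/
def mkOp {V : Type} [NormedAddCommGroup V] [NormedSpace ℝ V] (Op : V → ℂ → F)
    (ha : ∀ φ ψ z, Op (φ + ψ) z = Op φ z + Op ψ z)
    (hs : ∀ (c : ℝ) φ z, Op (c • φ) z = c • Op φ z) (C : ℝ) (hC : ∀ φ, Bd (Op φ) (C * ‖φ‖)) :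
    V →L[ℝ] X F :=
  LinearMap.mkContinuous
    { toFun := fun φ => of (Op φ) ⟨_, hC φ⟩
      map_add' := fun φ ψ => by ext z; simp [ha]
      map_smul' := fun c φ => by ext z; simp [hs] } (2 * C) (by
      intro φ
      refine (norm_le_of_bd (C := C * ‖φ‖) ?_).trans (by rw [mul_assoc])
      exact hC φ)

@[simp] theorem mkOp_apply {V : Type} [NormedAddCommGroup V] [NormedSpace ℝ V] (Op : V → ℂ → F) (ha hs) (C : ℝ) (hC) (φ : V) (z : ℂ) :
    mkOp Op ha hs C hC φ z = Op φ z := rfl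

/-- evaluation -/
def ev (z : ℂ) : X E →L[ℝ] E :=
  LinearMap.mkContinuous { toFun := fun φ => φ z, map_add' := fun _ _ => rfl, map_smul' := fun _ _ => rfl } 1
    (fun φ => by rw [one_mul]; exact norm_apply_le φ z)

@[simp] theorem ev_apply (z : ℂ) (φ : X E) : ev z φ = φ z := rfl

/-- constants -/
def cst : E →L[ℝ] X E :=
  mkOp (fun v _ => v) (fun _ _ _ => rfl) (fun _ _ _ => rfl) 1 (fun φ => ⟨fun _ => by simp, fun z w _ => by
    simp; positivity⟩)

@[simp] theorem cst_apply (v : E) (z : ℂ) : cst v z = v := rfl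

theorem bd_bilin (L : E₁ →L[ℝ] E₂ →L[ℝ] E₃) {u : ℂ → E₁} {v : ℂ → E₂} {A B : ℝ} (hu : Bd u A) (hv : Bd v B) :
    Bd (fun z => L (u z) (v z)) (2 * ‖L‖ * A * B) := by
  have hA : 0 ≤ A := (norm_nonneg _).trans (hu.1 0)
  have hB : 0 ≤ B := (norm_nonneg _).trans (hv.1 0)
  have hL := norm_nonneg L
  constructor
  · intro z
    calc ‖L (u z) (v z)‖ ≤ ‖L‖ * ‖u z‖ * ‖v z‖ := L.le_opNorm₂ _ _
      _ ≤ ‖L‖ * A * B := by gcongr; exacts [hu.1 z, hv.1 z]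
      _ ≤ _ := by nlinarith [mul_nonneg (mul_nonneg hL hA) hB]
  · intro z w h
    have : L (u z) (v z) - L (u w) (v w) = L (u z - u w) (v z) + L (u w) (v z - v w) := by
      simp
    simp only
    rw [this]
    calc _ ≤ ‖L (u z - u w) (v z)‖ + ‖L (u w) (v z - v w)‖ := norm_add_le _ _
      _ ≤ ‖L‖ * ‖u z - u w‖ * ‖v z‖ + ‖L‖ * ‖u w‖ * ‖v z - v w‖ := add_le_add (L.le_opNorm₂ _ _) (L.le_opNorm₂ _ _)
      _ ≤ ‖L‖ * (A * √‖z - w‖) * B + ‖L‖ * A * (B * √‖z - w‖) := by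
          gcongr; exacts [hu.2 z w h, hv.1 z, hu.1 w, hv.2 z w h]
      _ = _ := by ring

/-- pointwise bilinear products -/
def bil (L : E₁ →L[ℝ] E₂ →L[ℝ] E₃) : X E₁ →L[ℝ] X E₂ →L[ℝ] X E₃ :=
  LinearMap.mkContinuous₂
    (LinearMap.mk₂ ℝ (fun u v => of (fun z => L (u z) (v z)) ⟨_, bd_bilin L u.bd v.bd⟩)
      (fun u u' v => by ext z; simp) (fun c u v => by ext z; simp) (fun u v v' => by ext z; simp)
      (fun c u v => by ext z; simp)) (2 * (2 * ‖L‖)) (by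
      intro u v
      refine (norm_le_of_bd (bd_bilin L u.bd v.bd)).trans (le_of_eq (by ring)))

@[simp] theorem bil_apply (L : E₁ →L[ℝ] E₂ →L[ℝ] E₃) (u : X E₁) (v : X E₂) (z : ℂ) : bil L u v z = L (u z) (v z) := rfl

/-- postcomposition -/
def post (L : E →L[ℝ] F) : X E →L[ℝ] X F :=
  mkOp (fun φ z => L (φ z)) (by simp) (by simp) ‖L‖ (by
    intro φ
    constructor
    · intro z
      exact (L.le_opNorm _).trans (by gcongr; exact norm_apply_le φ z)
    · intro z w _
      rw [← map_sub, mul_assoc]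
      exact (L.le_opNorm _).trans (by gcongr; exact norm_sub_le φ z w))

@[simp] theorem post_apply (L : E →L[ℝ] F) (φ : X E) (z : ℂ) : post L φ z = L (φ z) := rfl

/-- translation -/
def tau (h : ℂ) : X E →L[ℝ] X E :=
  mkOp (fun φ z => φ (z + h)) (by simp) (by simp) 1 (by
    intro φ
    rw [one_mul]
    refine ⟨fun z => norm_apply_le φ _, fun z w _ => ?_⟩
    simpa using norm_sub_le φ (z + h) (w + h))

@[simp] theorem tau_apply (h : ℂ) (φ : X E) (z : ℂ) : tau h φ z = φ (z + h) := rfl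

theorem norm_tau_le (h : ℂ) (φ : X E) : ‖tau h φ‖ ≤ ‖φ‖ :=
  norm_le_of _ (fun z => norm_apply_le φ _) (fun z w => by simpa using norm_sub_le φ (z + h) (w + h))

theorem tau_tau (a b : ℂ) (φ : X E) : tau a (tau b φ) = tau (a + b) φ := by
  ext z; simp [add_assoc]

theorem norm_tau (h : ℂ) (φ : X E) : ‖tau h φ‖ = ‖φ‖ := by
  refine le_antisymm (norm_tau_le h φ) ?_
  have : φ = tau (-h) (tau h φ) := by ext z; simp
  calc ‖φ‖ = ‖tau (-h) (tau h φ)‖ := by rw [← this]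
    _ ≤ _ := norm_tau_le _ _

end X

/-- A bounded Lipschitz function satisfies `Bd`. -/
theorem bd_of_lip {E : Type} [NormedAddCommGroup E] {f : ℂ → E} {C L : ℝ}
    (h1 : ∀ z, ‖f z‖ ≤ C) (h2 : ∀ z w, ‖f z - f w‖ ≤ L * ‖z - w‖) : Bd f (max C L) := by
  refine ⟨fun z => (h1 z).trans (le_max_left _ _), fun z w h => (h2 z w).trans ?_⟩
  have : ‖z - w‖ ≤ √‖z - w‖ := Real.le_sqrt_of_sq_le (by nlinarith [norm_nonneg (z - w)])
  have h0 : 0 ≤ max C L := le_max_of_le_left ((norm_nonneg _).trans (h1 0))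
  calc L * ‖z - w‖ ≤ max C L * ‖z - w‖ := by gcongr; exact le_max_right _ _
    _ ≤ _ := by gcongr

/-- Interpolation: sup bound `A`, Lipschitz bound `L` give Hölder bound. -/
theorem bd_interp {E : Type} [NormedAddCommGroup E] {f : ℂ → E} {A L : ℝ}
    (h1 : ∀ z, ‖f z‖ ≤ A) (h2 : ∀ z w, ‖f z - f w‖ ≤ L * ‖z - w‖) : Bd f (A + √(2 * A * L)) := by
  have hA : 0 ≤ A := (norm_nonneg _).trans (h1 0)
  have hL : 0 ≤ L := by simpa using (norm_nonneg _).trans (h2 1 0)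
  refine ⟨fun z => (h1 z).trans (by linarith [Real.sqrt_nonneg (2 * A * L)]), fun z w h => ?_⟩
  have h3 : ‖f z - f w‖ ≤ 2 * A := by linarith [norm_sub_le (f z) (f w), h1 z, h1 w]
  have h4 := h2 z w
  have : ‖f z - f w‖ ≤ √(2 * A * L) * √‖z - w‖ := by
    rw [← Real.sqrt_mul (by positivity)]
    refine Real.le_sqrt_of_sq_le ?_
    rw [sq]
    calc _ ≤ (2 * A) * (L * ‖z - w‖) := mul_le_mul h3 h4 (norm_nonneg _) (by positivity)
      _ = _ := by ring
  refine this.trans ?_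
  gcongr
  linarith

end JH

set_option maxSynthPendingDepth 3
set_option linter.unusedSectionVars false

namespace JH
open MeasureTheory

section cvsec
variable {A E B : Type} [NormedAddCommGroup A] [NormedSpace ℝ A] [NormedAddCommGroup E] [NormedSpace ℝ E]
  [NormedAddCommGroup B] [NormedSpace ℝ B]

/-- convolution -/
def cv (L : A →L[ℝ] E →L[ℝ] B) (G : ℂ → A) (φ : ℂ → E) (z : ℂ) : B := ∫ w, L (G (z - w)) (φ w)

theorem vol_cball (z : ℂ) {r : ℝ} (hr : 0 ≤ r) : (volume : Measure ℂ).real (closedBall z r) = Real.pi * r ^ 2 := by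
  rw [Measure.real, Complex.volume_closedBall, ENNReal.toReal_mul, ENNReal.toReal_pow, ENNReal.toReal_ofReal hr]
  simp [mul_comm]

theorem norm_int_le {g : ℂ → B} {z : ℂ} {r C : ℝ} (hr : 0 ≤ r) (h0 : ∀ w, r < ‖w - z‖ → g w = 0)
    (h1 : ∀ w, ‖w - z‖ ≤ r → ‖g w‖ ≤ C) : ‖∫ w, g w‖ ≤ C * (Real.pi * r ^ 2) := by
  rw [← setIntegral_eq_integral_of_forall_compl_eq_zero (s := closedBall z r), ← vol_cball z hr]
  · refine norm_setIntegral_le_of_norm_le_const ?_ ?_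
    · exact measure_closedBall_lt_top
    · intro w hw; exact h1 w (by simpa [dist_eq_norm] using hw)
  · intro w hw; exact h0 w (by simpa [dist_eq_norm] using hw)

theorem norm_L_le (L : A →L[ℝ] E →L[ℝ] B) {a : A} {e : E} {M S : ℝ} (ha : ‖a‖ ≤ M) (he : ‖e‖ ≤ S) : ‖L a e‖ ≤ ‖L‖ * M * S := by
  have hM : 0 ≤ M := (norm_nonneg _).trans ha
  calc ‖L a e‖ ≤ ‖L‖ * ‖a‖ * ‖e‖ := L.le_opNorm₂ _ _
    _ ≤ _ := by gcongr

theorem norm_cv_le (L : A →L[ℝ] E →L[ℝ] B) {G : ℂ → A} {φ : ℂ → E} {z : ℂ} {r M S : ℝ} (hr : 0 ≤ r)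
    (hM : ∀ x, ‖G x‖ ≤ M) (h0 : ∀ x, r < ‖x‖ → G x = 0) (hS : ∀ w, ‖w - z‖ ≤ r → ‖φ w‖ ≤ S) :
    ‖cv L G φ z‖ ≤ ‖L‖ * M * S * (Real.pi * r ^ 2) := by
  refine norm_int_le (z := z) hr ?_ ?_
  · intro w hw; rw [h0 _ (by rwa [norm_sub_rev])]; simp
  · intro w hw; exact norm_L_le L (hM _) (hS w hw)

theorem norm_cv_le' (L : A →L[ℝ] E →L[ℝ] B) {G : ℂ → A} {φ : ℂ → E} {z : ℂ} {r M S : ℝ} (hr : 0 ≤ r)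
    (hM : ∀ x, ‖G x‖ ≤ M) (h0 : ∀ x, r < ‖x‖ → φ x = 0) (hS : ∀ w, ‖φ w‖ ≤ S) :
    ‖cv L G φ z‖ ≤ ‖L‖ * M * S * (Real.pi * r ^ 2) := by
  refine norm_int_le (z := 0) hr ?_ ?_
  · intro w hw; rw [h0 _ (by simpa using hw)]; simp
  · intro w hw; exact norm_L_le L (hM _) (hS w)

theorem hcs_of {φ : ℂ → E} {r : ℝ} (h0 : ∀ x, r < ‖x‖ → φ x = 0) : HasCompactSupport φ := by
  refine HasCompactSupport.intro (isCompact_closedBall (0:ℂ) r) ?_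
  intro x hx; exact h0 x (by simpa using hx)

theorem cv_int (L : A →L[ℝ] E →L[ℝ] B) {G : ℂ → A} {φ : ℂ → E} {r : ℝ} (hG : Continuous G) (hφ : Continuous φ)
    (h0 : ∀ x, r < ‖x‖ → φ x = 0) (z : ℂ) : Integrable fun w => L (G (z - w)) (φ w) := by
  refine Continuous.integrable_of_hasCompactSupport (by fun_prop) (hcs_of (r := r) ?_)
  intro x hx; simp [h0 x hx]

theorem cv_int' (L : A →L[ℝ] E →L[ℝ] B) {G : ℂ → A} {φ : ℂ → E} {r : ℝ} (hG : Continuous G) (hφ : Continuous φ)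
    (h0 : ∀ x, r < ‖x‖ → G x = 0) (z : ℂ) : Integrable fun w => L (G (z - w)) (φ w) := by
  refine Continuous.integrable_of_hasCompactSupport (by fun_prop) (hcs_of (r := r + ‖z‖) ?_)
  intro x hx; rw [h0]; · simp
  have := norm_sub_norm_le x z
  rw [norm_sub_rev]; linarith

theorem cv_diff (L : A →L[ℝ] E →L[ℝ] B) {G : ℂ → A} {φ : ℂ → E} 
    (hi : ∀ z, Integrable fun w => L (G (z - w)) (φ w)) (z z' : ℂ) :
    cv L G φ z' - cv L G φ z = cv L (fun x => G (x + (z' - z)) - G x) φ z := by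
  unfold cv
  rw [← integral_sub (hi z') (hi z)]
  congr 1
  ext w
  simp [show z - w + (z' - z) = z' - w by ring]

theorem int_reflect (G : ℂ → A) (z : ℂ) : ∫ w, G (z - w) = ∫ w, G w := integral_sub_left_eq_self G volume z

theorem cv_zero [CompleteSpace A] [CompleteSpace B] (L : A →L[ℝ] E →L[ℝ] B) {G : ℂ → A} {φ : ℂ → E} {r : ℝ}
    (hG : Continuous G) (hφ : Continuous φ)
    (h0 : ∀ x, r < ‖x‖ → G x = 0) (z : ℂ) : cv L G φ z - L (∫ w, G w) (φ z) = cv L G (fun w => φ w - φ z) z := by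
  unfold cv
  have h1 := cv_int' L hG hφ h0 z
  have h2 := cv_int' L hG (continuous_const (y := φ z)) h0 z
  simp only [map_sub]
  rw [integral_sub h1 h2]
  congr 1
  rw [← int_reflect G z]
  have h3 : Integrable fun w => G (z - w) := by
    have : Integrable G := hG.integrable_of_hasCompactSupport (hcs_of h0)
    exact this.comp_sub_left z
  exact (((L.flip (φ z)).integral_comp_comm h3).symm)

theorem cv_fderiv (L : A →L[ℝ] E →L[ℝ] B) {G : ℂ → A} {φ : ℂ → E} {r M : ℝ}
    (hG : ContDiff ℝ 1 G) (hM : ∀ x, ‖fderiv ℝ G x‖ ≤ M)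
    (hφ : Continuous φ) (h0 : ∀ x, r < ‖x‖ → φ x = 0) (z : ℂ) :
    HasFDerivAt (cv L G φ) (cv (L.precompL ℂ) (fderiv ℝ G) φ z) z := by
  have hG' : Continuous (fderiv ℝ G) := hG.continuous_fderiv (by simp)
  have hGc := hG.continuous
  refine hasFDerivAt_integral_of_dominated_of_fderiv_le (F' := fun z w => L.precompL ℂ (fderiv ℝ G (z - w)) (φ w))
    (bound := fun w => ‖L.precompL ℂ‖ * M * ‖φ w‖) univ_mem ?_ ?_ ?_ ?_ ?_ ?_
  · exact Eventually.of_forall fun x => (cv_int L hGc hφ h0 x).aestronglyMeasurable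
  · exact cv_int L hGc hφ h0 z
  · exact (cv_int _ hG' hφ h0 z).aestronglyMeasurable
  · exact Eventually.of_forall fun w x _ => norm_L_le _ (hM _) le_rfl
  · exact ((hφ.norm.integrable_of_hasCompactSupport (hcs_of (r := r) fun x hx => by simp [h0 x hx])).const_mul _)
  · refine Eventually.of_forall fun w x _ => ?_
    have h1 : HasFDerivAt (fun x => G (x - w)) (fderiv ℝ G (x - w)) x := by
      have h2 : HasFDerivAt G (fderiv ℝ G (x - w)) (x - w) := (hG.differentiable (by simp) _).hasFDerivAt
      exact h2.comp x ((hasFDerivAt_id x).sub_const w)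
    have := ((L.flip (φ w)).hasFDerivAt (x := G (x - w))).comp x h1
    exact this

end cvsec

/-- the ratio `2^{-1/2}`. -/
def qq : ℝ := (√2)⁻¹

theorem qq_pos : 0 < qq := by unfold qq; positivity
theorem qq_sq : qq ^ 2 = 1 / 2 := by unfold qq; rw [inv_pow, Real.sq_sqrt (by norm_num)]; norm_num
theorem qq_lt : qq < 0.708 := by
  have := qq_sq; have := qq_pos; nlinarith
theorem qq_gt : 0.7 < qq := by
  have := qq_sq; have := qq_pos; nlinarith
theorem qq_summable : Summable fun j : ℕ => qq ^ j := summable_geometric_of_lt_one qq_pos.le (by linarith [qq_lt])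

theorem dy_sum (n : ℕ) : ∀ s : ℝ, 0 ≤ s → s ≤ 1 → ∑ j ∈ Finset.range n, qq ^ j * min 1 (2 ^ j * s) ≤ 10 * √s - 3 * s := by
  have hA : ∀ (n : ℕ) (s : ℝ), 0 ≤ s → ∑ j ∈ Finset.range n, qq ^ j * min 1 (2 ^ j * s) ≤ 3.43 := by
    intro n s hs
    calc _ ≤ ∑ j ∈ Finset.range n, qq ^ j := by
          refine Finset.sum_le_sum fun j _ => mul_le_of_le_one_right (pow_nonneg qq_pos.le _) (min_le_left _ _)
      _ ≤ ∑' j, qq ^ j := qq_summable.sum_le_tsum _ (fun j _ => pow_nonneg qq_pos.le _)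
      _ = (1 - qq)⁻¹ := tsum_geometric_of_lt_one qq_pos.le (by linarith [qq_lt])
      _ ≤ _ := by
        rw [inv_le_comm₀ (by linarith [qq_lt]) (by norm_num)]
        have := qq_lt
        norm_num at this ⊢
        linarith
  induction n with
  | zero =>
    intro s h0 h1
    have : s ≤ √s := Real.le_sqrt_of_sq_le (by nlinarith)
    simp; linarith
  | succ n ih =>
    intro s h0 h1
    by_cases h : s ≤ 1 / 2
    · rw [Finset.sum_range_succ']
      have e : ∑ j ∈ Finset.range n, qq ^ (j + 1) * min 1 (2 ^ (j + 1) * s) = qq * ∑ j ∈ Finset.range n, qq ^ j * min 1 (2 ^ j * (2 * s)) := by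
        rw [Finset.mul_sum]; refine Finset.sum_congr rfl fun j _ => ?_
        rw [show (2:ℝ) ^ (j + 1) * s = 2 ^ j * (2 * s) by ring]; ring
      rw [e]
      have i := mul_le_mul_of_nonneg_left (ih (2 * s) (by linarith) (by linarith)) qq_pos.le
      have h2 : √(2 * s) = √2 * √s := Real.sqrt_mul (by norm_num) _
      have h3 : qq * √2 = 1 := by unfold qq; exact inv_mul_cancel₀ (by positivity)
      have h4 : qq * (10 * √(2 * s) - 3 * (2 * s)) = 10 * √s - 6 * qq * s := by
        rw [h2]; linear_combination 10 * √s * h3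
      have h5 : min 1 (2 ^ 0 * s) ≤ s := by simp
      simp only [pow_zero, one_mul] at h5 ⊢
      nlinarith [qq_gt]
    · push Not at h
      refine (hA _ s h0).trans ?_
      have : 0.7 ≤ √s := Real.le_sqrt_of_sq_le (by norm_num; linarith)
      have h2 := Real.sq_sqrt h0
      have h3 : √s ≤ 1 := Real.sqrt_le_one.2 h1
      nlinarith

theorem bd_tsum {B : Type} [NormedAddCommGroup B] [CompleteSpace B] {f : ℕ → ℂ → B} {c : ℝ}
    (h1 : ∀ j z, ‖f j z‖ ≤ c * qq ^ j)
    (h2 : ∀ j z w, ‖f j z - f j w‖ ≤ c * (qq ^ j * min 1 (2 ^ j * ‖z - w‖))) : Bd (fun z => ∑' j, f j z) (10 * c) := by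
  have hc : 0 ≤ c := by simpa using (norm_nonneg _).trans (h1 0 0)
  have hs : Summable fun j : ℕ => c * qq ^ j := qq_summable.mul_left c
  have hsf : ∀ z, Summable fun j => f j z := fun z => Summable.of_norm_bounded hs (fun j => h1 j z)
  constructor
  · intro z
    refine (tsum_of_norm_bounded (qq_summable.hasSum.mul_left c) (fun j => h1 j z)).trans ?_
    rw [tsum_geometric_of_lt_one qq_pos.le (by linarith [qq_lt]), mul_comm 10]
    gcongr
    rw [inv_le_comm₀ (by linarith [qq_lt]) (by norm_num)]
    linarith [qq_lt]
  · intro z w h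
    simp only
    rw [← (hsf z).tsum_sub (hsf w)]
    refine le_of_tendsto' (((hsf z).sub (hsf w)).hasSum.tendsto_sum_nat.norm) fun n => ?_
    calc _ ≤ ∑ j ∈ Finset.range n, ‖f j z - f j w‖ := norm_sum_le _ _
      _ ≤ ∑ j ∈ Finset.range n, c * (qq ^ j * min 1 (2 ^ j * ‖z - w‖)) := Finset.sum_le_sum fun j _ => h2 j z w
      _ = c * ∑ j ∈ Finset.range n, qq ^ j * min 1 (2 ^ j * ‖z - w‖) := by rw [Finset.mul_sum]
      _ ≤ c * (10 * √‖z - w‖ - 3 * ‖z - w‖) := by gcongr; exact dy_sum n _ (norm_nonneg _) h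
      _ ≤ _ := by nlinarith [mul_nonneg hc (norm_nonneg (z - w))]

end JH

namespace JH
open MeasureTheory

section dy
variable {A E B : Type} [NormedAddCommGroup A] [NormedSpace ℝ A] [NormedAddCommGroup E] [NormedSpace ℝ E]
  [NormedAddCommGroup B] [NormedSpace ℝ B]

/-- a nice kernel: continuous, supported in the unit ball, bounded and Lipschitz -/
structure Nice (G : ℂ → A) (M : ℝ) : Prop where
  cont : Continuous G
  supp : ∀ x, 1 < ‖x‖ → G x = 0
  bdd : ∀ x, ‖G x‖ ≤ M
  lip : ∀ x y, ‖G x - G y‖ ≤ M * ‖x - y‖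

/-- scaling -/
def sc (k : ℕ) (j : ℕ) (G : ℂ → A) (z : ℂ) : A := ((2:ℝ) ^ j) ^ k • G ((2:ℝ) ^ j • z)

theorem Nice.nonneg {G : ℂ → A} {M : ℝ} (h : Nice G M) : 0 ≤ M := (norm_nonneg _).trans (h.bdd 0)

theorem sc_cont {G : ℂ → A} {M : ℝ} (h : Nice G M) (k j : ℕ) : Continuous (sc k j G) := by
  have := h.cont
  unfold sc; fun_prop

theorem sc_supp {G : ℂ → A} {M : ℝ} (h : Nice G M) (k j : ℕ) (x : ℂ) (hx : ((2:ℝ) ^ j)⁻¹ < ‖x‖) : sc k j G x = 0 := by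
  unfold sc
  rw [h.supp, smul_zero]
  rw [norm_smul, Real.norm_of_nonneg (by positivity)]
  rwa [inv_lt_iff_one_lt_mul₀ (by positivity), mul_comm] at hx

theorem sc_bdd {G : ℂ → A} {M : ℝ} (h : Nice G M) (k j : ℕ) (x : ℂ) : ‖sc k j G x‖ ≤ ((2:ℝ) ^ j) ^ k * M := by
  unfold sc
  rw [norm_smul, Real.norm_of_nonneg (by positivity)]
  gcongr; exact h.bdd _

theorem sc_lip {G : ℂ → A} {M : ℝ} (h : Nice G M) (k j : ℕ) (x y : ℂ) : ‖sc k j G x - sc k j G y‖ ≤ ((2:ℝ) ^ j) ^ k * M * (2 ^ j * ‖x - y‖) := by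
  unfold sc
  rw [← smul_sub, norm_smul, Real.norm_of_nonneg (by positivity), mul_assoc]
  gcongr; refine (h.lip _ _).trans (le_of_eq ?_)
  rw [← smul_sub, norm_smul, Real.norm_of_nonneg (by positivity)]

theorem qq_pow (j : ℕ) : √(((2:ℝ) ^ j)⁻¹) = qq ^ j := by
  unfold qq
  rw [Real.sqrt_inv, inv_pow]
  congr 1
  rw [Real.sqrt_eq_iff_mul_self_eq (by positivity) (by positivity), ← mul_pow, Real.mul_self_sqrt (by norm_num)]

theorem int_sc [CompleteSpace A] (G : ℂ → A) (j : ℕ) : ∫ w, sc 2 j G w = ∫ w, G w := by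
  unfold sc
  rw [integral_smul, Measure.integral_comp_smul, Complex.finrank_real_complex, abs_of_nonneg (by positivity), smul_inv_smul₀ (by positivity)]

theorem est_shift (L : A →L[ℝ] E →L[ℝ] B) {G : ℂ → A} {M : ℝ} (h : Nice G M) (k j : ℕ) {φ : ℂ → E} {z d : ℂ} {S : ℝ}
    (hd : 2 ^ j * ‖d‖ ≤ 1) (hS : ∀ w, ‖w - z‖ ≤ 2 * ((2:ℝ) ^ j)⁻¹ → ‖φ w‖ ≤ S) :
    ‖cv L (fun x => sc k j G (x + d) - sc k j G x) φ z‖ ≤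
      ‖L‖ * (((2:ℝ) ^ j) ^ k * M * (2 ^ j * ‖d‖)) * S * (Real.pi * (2 * ((2:ℝ) ^ j)⁻¹) ^ 2) := by
  refine norm_cv_le L (by positivity) ?_ ?_ hS
  · intro x; simpa using sc_lip h k j (x + d) x
  · intro x hx
    have hd' : ‖d‖ ≤ ((2:ℝ) ^ j)⁻¹ := by
      rw [← one_div, le_div_iff₀' (by positivity)]; exact hd
    have : 0 < ((2:ℝ) ^ j)⁻¹ := by positivity
    rw [sc_supp h k j x (by linarith), sc_supp h k j (x + d), sub_self]
    have := norm_sub_le (x + d) d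
    rw [add_sub_cancel_right] at this
    linarith

theorem pi_lt : Real.pi < 3.15 := by linarith [Real.pi_lt_d2]

theorem dy1 [CompleteSpace A] [CompleteSpace B] (L : A →L[ℝ] E →L[ℝ] B) {G : ℂ → A} {M C : ℝ} (h : Nice G M) (hG : ∫ w, G w = 0)
    {φ : ℂ → E} (hφ : Continuous φ) (hb : Bd φ C) (j : ℕ) :
    (∀ z, ‖cv L (sc 2 j G) φ z‖ ≤ (40 * ‖L‖ * M * C) * qq ^ j) ∧
    (∀ z w, ‖cv L (sc 2 j G) φ z - cv L (sc 2 j G) φ w‖ ≤ (40 * ‖L‖ * M * C) * (qq ^ j * min 1 (2 ^ j * ‖z - w‖))) := by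
  have hC : 0 ≤ C := (norm_nonneg _).trans (hb.1 0)
  have hM := h.nonneg
  have hq := pow_pos qq_pos j
  have hp : (0:ℝ) < 2 ^ j := by positivity
  have hLMC : 0 ≤ ‖L‖ * M * C * qq ^ j := by positivity
  have e0 : ∫ w, sc 2 j G w = 0 := by rw [int_sc, hG]
  have key : ∀ z, ‖cv L (sc 2 j G) φ z‖ ≤ (2 * Real.pi * ‖L‖ * M * C) * qq ^ j := by
    intro z
    have e := cv_zero L (sc_cont h 2 j) hφ (sc_supp h 2 j) z
    rw [e0] at e
    simp only [map_zero, _root_.zero_apply, sub_zero] at e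
    rw [e]
    refine (norm_cv_le L (r := ((2:ℝ) ^ j)⁻¹) (S := 2 * C * qq ^ j) (by positivity) (sc_bdd h 2 j) (sc_supp h 2 j) ?_).trans (le_of_eq ?_)
    · intro w hw
      refine (hb.far w z).trans ?_
      rw [← qq_pow]; gcongr
    · field_simp
  have key1 : ∀ z, ‖cv L (sc 2 j G) φ z‖ ≤ (40 * ‖L‖ * M * C) * qq ^ j := by
    intro z
    refine (key z).trans ?_
    have := pi_lt
    nlinarith
  refine ⟨key1, fun w z => ?_⟩
  by_cases hd : 2 ^ j * ‖w - z‖ ≤ 1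
  · rw [min_eq_right hd]
    have hi := cv_int' L (sc_cont h 2 j) hφ (sc_supp h 2 j)
    have hs := sc_cont h 2 j
    rw [cv_diff L hi z w]
    have hc : Continuous fun x => sc 2 j G (x + (w - z)) - sc 2 j G x := by fun_prop
    have hsup : ∀ x, ((2:ℝ) ^ j)⁻¹ + ‖w - z‖ < ‖x‖ → sc 2 j G (x + (w - z)) - sc 2 j G x = 0 := by
      intro x hx
      rw [sc_supp h 2 j x (by linarith [norm_nonneg (w - z)]), sc_supp h 2 j (x + (w - z)), sub_self]
      have := norm_sub_le (x + (w - z)) (w - z)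
      rw [add_sub_cancel_right] at this
      linarith
    have e := cv_zero L hc hφ hsup z
    have hint : Integrable (sc 2 j G) := hs.integrable_of_hasCompactSupport (hcs_of (sc_supp h 2 j))
    rw [integral_sub (hint.comp_add_right _) hint, integral_add_right_eq_self (sc 2 j G)] at e
    simp only [sub_self, map_zero, _root_.zero_apply, sub_zero] at e
    rw [e]
    refine (est_shift L h 2 j (S := 2 * C * (1.42 * qq ^ j)) hd ?_).trans ?_
    · intro y hy
      refine (hb.far y z).trans ?_
      gcongr
      rw [← qq_pow]
      refine Real.sqrt_le_iff.2 ⟨by positivity, ?_⟩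
      rw [mul_pow, Real.sq_sqrt (by positivity)]
      refine hy.trans ?_
      gcongr; norm_num
    · have : ‖L‖ * (((2:ℝ) ^ j) ^ 2 * M * (2 ^ j * ‖w - z‖)) * (2 * C * (1.42 * qq ^ j)) * (Real.pi * (2 * ((2:ℝ) ^ j)⁻¹) ^ 2) =
        (Real.pi * 11.36) * (‖L‖ * M * C * qq ^ j * (2 ^ j * ‖w - z‖)) := by field_simp; ring
      rw [this]
      have h2 : Real.pi * 11.36 ≤ 40 := by linarith [pi_lt]
      calc _ ≤ 40 * (‖L‖ * M * C * qq ^ j * (2 ^ j * ‖w - z‖)) := by gcongr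
        _ = _ := by ring
  · rw [min_eq_left (not_le.1 hd).le]
    refine (norm_sub_le _ _).trans ?_
    have := pi_lt
    nlinarith [key w, key z]

theorem dy2 (L : A →L[ℝ] E →L[ℝ] B) {G : ℂ → A} {M C : ℝ} (h : Nice G M)
    {φ : ℂ → E} (hφ : Continuous φ) (hb : ∀ z, ‖φ z‖ ≤ C) (j : ℕ) :
    (∀ z, ‖cv L (sc 1 j G) φ z‖ ≤ (40 * ‖L‖ * M * C) * qq ^ j) ∧
    (∀ z w, ‖cv L (sc 1 j G) φ z - cv L (sc 1 j G) φ w‖ ≤ (40 * ‖L‖ * M * C) * (qq ^ j * min 1 (2 ^ j * ‖z - w‖))) := by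
  have hC : 0 ≤ C := (norm_nonneg _).trans (hb 0)
  have hM := h.nonneg
  have hq := pow_pos qq_pos j
  have hp : (0:ℝ) < 2 ^ j := by positivity
  have hLMC : 0 ≤ ‖L‖ * M * C * qq ^ j := by positivity
  have hle : ((2:ℝ) ^ j)⁻¹ ≤ qq ^ j := by
    rw [← qq_pow]
    refine Real.le_sqrt_of_sq_le ?_
    rw [sq]
    refine mul_le_of_le_one_right (by positivity) (inv_le_one_of_one_le₀ (one_le_pow₀ (by norm_num)))
  have key : ∀ z, ‖cv L (sc 1 j G) φ z‖ ≤ (Real.pi * ‖L‖ * M * C) * qq ^ j := by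
    intro z
    refine (norm_cv_le L (r := ((2:ℝ) ^ j)⁻¹) (S := C) (by positivity) (sc_bdd h 1 j) (sc_supp h 1 j) (fun w _ => hb w)).trans ?_
    have : ‖L‖ * (((2:ℝ) ^ j) ^ 1 * M) * C * (Real.pi * ((2:ℝ) ^ j)⁻¹ ^ 2) = (Real.pi * ‖L‖ * M * C) * ((2:ℝ) ^ j)⁻¹ := by field_simp
    rw [this]; gcongr
  refine ⟨fun z => ?_, fun w z => ?_⟩
  · refine (key z).trans ?_
    have := pi_lt
    nlinarith
  by_cases hd : 2 ^ j * ‖w - z‖ ≤ 1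
  · rw [min_eq_right hd]
    have hi := cv_int' L (sc_cont h 1 j) hφ (sc_supp h 1 j)
    rw [cv_diff L hi z w]
    refine (est_shift L h 1 j (S := C) hd (fun w _ => hb w)).trans ?_
    have : ‖L‖ * (((2:ℝ) ^ j) ^ 1 * M * (2 ^ j * ‖w - z‖)) * C * (Real.pi * (2 * ((2:ℝ) ^ j)⁻¹) ^ 2) =
        (Real.pi * 4) * (‖L‖ * M * C * ((2:ℝ) ^ j)⁻¹ * (2 ^ j * ‖w - z‖)) := by field_simp; ring
    rw [this]
    have h2 : Real.pi * 4 ≤ 40 := by linarith [pi_lt]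
    calc _ ≤ 40 * (‖L‖ * M * C * qq ^ j * (2 ^ j * ‖w - z‖)) := by gcongr
        _ = _ := by ring
  · rw [min_eq_left (not_le.1 hd).le]
    refine (norm_sub_le _ _).trans ?_
    have := pi_lt
    nlinarith [key w, key z]
end dy
end JH

namespace JH
open MeasureTheory
open scoped ContDiff

section hom
variable {V : Type} [NormedAddCommGroup V] [NormedSpace ℝ V]

/-- smooth, homogeneous of degree `-k` away from the ball of radius `4/5`. -/
def Hom (k : ℕ) (F : ℂ → V) : Prop :=
  ContDiff ℝ ∞ F ∧ ∀ t : ℝ, 1 ≤ t → ∀ z : ℂ, 4 / 5 < ‖z‖ → F (t • z) = (t ^ k)⁻¹ • F z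

theorem Hom.fderiv {k : ℕ} {F : ℂ → V} (h : Hom k F) : Hom (k + 1) (fderiv ℝ F) := by
  refine ⟨h.1.fderiv_right (by simp), fun t ht z hz => ?_⟩
  have h1 : (fun y => F (t • y)) =ᶠ[𝓝 z] fun y => (t ^ k)⁻¹ • F y := by
    have : {y : ℂ | 4 / 5 < ‖y‖} ∈ 𝓝 z := (isOpen_lt continuous_const continuous_norm).mem_nhds hz
    filter_upwards [this] with y hy using h.2 t ht y hy
  have h2 := h1.fderiv_eq (𝕜 := ℝ)
  rw [fderiv_comp_smul, fderiv_fun_const_smul (h.1.differentiable (by simp) _)] at h2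
  have ht0 : t ≠ 0 := by positivity
  rw [pow_succ, mul_inv, mul_comm, mul_smul, ← h2, inv_smul_smul₀ ht0]

theorem Hom.bdd {k : ℕ} {F : ℂ → V} (h : Hom k F) : ∃ M, ∀ z, ‖F z‖ ≤ M ∧ (1 ≤ ‖z‖ → ‖F z‖ ≤ M * (‖z‖ ^ k)⁻¹) := by
  obtain ⟨M, hM⟩ := (isCompact_closedBall (0:ℂ) 1).exists_bound_of_continuousOn h.1.continuous.continuousOn
  refine ⟨M, fun z => ?_⟩
  have hM0 : 0 ≤ M := (norm_nonneg _).trans (hM 0 (by simp))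
  have key : (1 ≤ ‖z‖ → ‖F z‖ ≤ M * (‖z‖ ^ k)⁻¹) := by
    intro hz
    have hz0 : ‖z‖ ≠ 0 := by positivity
    have e : z = ‖z‖ • (‖z‖⁻¹ • z) := by rw [smul_inv_smul₀ hz0]
    have n1 : ‖‖z‖⁻¹ • z‖ = 1 := by rw [norm_smul, norm_inv, norm_norm, inv_mul_cancel₀ hz0]
    rw [e, h.2 _ hz _ (by rw [n1]; norm_num), norm_smul, ← e, norm_inv, norm_pow, norm_norm, mul_comm]
    gcongr
    exact hM _ (by rw [mem_closedBall_zero_iff, n1])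
  refine ⟨?_, key⟩
  by_cases hz : 1 ≤ ‖z‖
  · refine (key hz).trans (mul_le_of_le_one_right hM0 (inv_le_one_of_one_le₀ (one_le_pow₀ hz)))
  · exact hM z (by simpa using (not_le.1 hz).le)

theorem lip_of_fderiv {F : ℂ → V} {M : ℝ} (h : ContDiff ℝ ∞ F) (hM : ∀ z, ‖fderiv ℝ F z‖ ≤ M) (z w : ℂ) : ‖F z - F w‖ ≤ M * ‖z - w‖ :=
  convex_univ.norm_image_sub_le_of_norm_fderiv_le (𝕜 := ℝ) (fun x _ => h.differentiable (by simp) x) (fun x _ => hM x) (mem_univ w) (mem_univ z)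

end hom

/-- radial cutoff -/
def th (z : ℂ) : ℝ := Real.smoothTransition (2 - 4 * Complex.normSq z)

/-- smoothed Cauchy kernel -/
def KK (z : ℂ) : ℂ := ((1 - th z : ℝ) : ℂ) / (2 * Real.pi * z)

theorem normSq_cd : ContDiff ℝ ∞ (fun z : ℂ => Complex.normSq z) := by
  have : (fun z : ℂ => Complex.normSq z) = fun z => Complex.reCLM z * Complex.reCLM z + Complex.imCLM z * Complex.imCLM z := by
    ext z; simp [Complex.normSq_apply]
  rw [this]
  have h1 := Complex.reCLM.contDiff (n := ∞)
  have h2 := Complex.imCLM.contDiff (n := ∞)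
  exact (h1.mul h1).add (h2.mul h2)

theorem th_cd : ContDiff ℝ ∞ th := by
  unfold th
  exact Real.smoothTransition.contDiff.comp (contDiff_const.sub (contDiff_const.mul normSq_cd))

theorem th_one {z : ℂ} (h : ‖z‖ ≤ 1 / 2) : th z = 1 := by
  refine Real.smoothTransition.one_of_one_le ?_
  rw [Complex.normSq_eq_norm_sq]; nlinarith [norm_nonneg z]

theorem th_zero {z : ℂ} (h : 3 / 4 ≤ ‖z‖) : th z = 0 := by
  refine Real.smoothTransition.zero_of_nonpos ?_
  rw [Complex.normSq_eq_norm_sq]; nlinarith [norm_nonneg z]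

theorem KK_zero {z : ℂ} (h : ‖z‖ ≤ 1 / 2) : KK z = 0 := by simp [KK, th_one h]
theorem KK_far {z : ℂ} (h : 3 / 4 ≤ ‖z‖) : KK z = 1 / (2 * Real.pi * z) := by simp [KK, th_zero h]

theorem KK_cd : ContDiff ℝ ∞ KK := by
  rw [contDiff_iff_contDiffAt]
  intro z
  by_cases h : ‖z‖ < 1 / 2
  · have : KK =ᶠ[𝓝 z] fun _ => 0 := by
      filter_upwards [(isOpen_lt continuous_norm continuous_const).mem_nhds h] with y hy
      exact KK_zero (le_of_lt hy)
    exact contDiffAt_const.congr_of_eventuallyEq this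
  · have hz : z ≠ 0 := by rintro rfl; norm_num at h
    have h1 : ContDiff ℝ ∞ (fun z : ℂ => ((1 - th z : ℝ) : ℂ)) := Complex.ofRealCLM.contDiff.comp (contDiff_const.sub th_cd)
    have h2 : ContDiff ℝ ∞ (fun z : ℂ => 2 * (Real.pi : ℂ) * z) := contDiff_const.mul contDiff_id
    exact h1.contDiffAt.mul (h2.contDiffAt.inv (by simp [hz, Real.pi_ne_zero]))

theorem KK_hom : Hom 1 KK := by
  refine ⟨KK_cd, fun t ht z hz => ?_⟩
  have ht0 : (t:ℂ) ≠ 0 := by exact_mod_cast (by positivity : t ≠ 0)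
  have hz0 : z ≠ 0 := by rintro rfl; norm_num at hz
  rw [KK_far (z := z) (by linarith), KK_far]
  · have : (Real.pi : ℂ) ≠ 0 := by exact_mod_cast Real.pi_ne_zero
    simp only [Complex.real_smul, pow_one, Complex.ofReal_inv]
    field_simp
  · rw [norm_smul, Real.norm_of_nonneg (by linarith)]; nlinarith

/-- dyadic piece -/
def ka (z : ℂ) : ℂ := (2:ℝ) • KK ((2:ℝ) • z) - KK z

theorem ka_cd : ContDiff ℝ ∞ ka := by
  unfold ka
  exact ((KK_cd.comp (contDiff_id.const_smul (2:ℝ))).const_smul _).sub KK_cd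

theorem ka_zero {z : ℂ} (h : 4 / 5 < ‖z‖) : ka z = 0 := by
  rw [ka, KK_hom.2 2 (by norm_num) z h, pow_one, smul_inv_smul₀ (by norm_num), sub_self]

theorem nice_of {V : Type} [NormedAddCommGroup V] [NormedSpace ℝ V] {F : ℂ → V} (h : ContDiff ℝ ∞ F) (h0 : ∀ z, 4 / 5 < ‖z‖ → F z = 0) : 
    (∃ M, Nice F M) ∧ (∃ M, Nice (fderiv ℝ F) M) ∧ ∫ z, fderiv ℝ F z = 0 := by
  have hd : ContDiff ℝ ∞ (fderiv ℝ F) := h.fderiv_right (by simp)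
  have hdd : ContDiff ℝ ∞ (fderiv ℝ (fderiv ℝ F)) := hd.fderiv_right (by simp)
  have e1 : ∀ z, 4 / 5 < ‖z‖ → fderiv ℝ F z = 0 := by
    intro z hz
    have : F =ᶠ[𝓝 z] fun _ => 0 := by
      filter_upwards [(isOpen_lt continuous_const continuous_norm).mem_nhds hz] with y hy using h0 y hy
    rw [this.fderiv_eq]; simp
  have e2 : ∀ z, 4 / 5 < ‖z‖ → fderiv ℝ (fderiv ℝ F) z = 0 := by
    intro z hz
    have : fderiv ℝ F =ᶠ[𝓝 z] fun _ => 0 := by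
      filter_upwards [(isOpen_lt continuous_const continuous_norm).mem_nhds hz] with y hy using e1 y hy
    rw [this.fderiv_eq]; simp
  obtain ⟨M0, hM0⟩ := h.continuous.bounded_above_of_compact_support (hcs_of h0)
  obtain ⟨M1, hM1⟩ := hd.continuous.bounded_above_of_compact_support (hcs_of e1)
  obtain ⟨M2, hM2⟩ := hdd.continuous.bounded_above_of_compact_support (hcs_of e2)
  refine ⟨⟨max M0 M1, h.continuous, fun x hx => h0 x (by linarith), fun x => (hM0 x).trans (le_max_left _ _), ?_⟩,
    ⟨max M1 M2, hd.continuous, fun x hx => e1 x (by linarith), fun x => (hM1 x).trans (le_max_left _ _), ?_⟩, ?_⟩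
  · exact lip_of_fderiv h fun z => (hM1 z).trans (le_max_right _ _)
  · exact lip_of_fderiv hd fun z => (hM2 z).trans (le_max_right _ _)
  · have hi : Integrable (fderiv ℝ F) := hd.continuous.integrable_of_hasCompactSupport (hcs_of e1)
    ext v
    rw [ContinuousLinearMap.integral_apply hi]
    have := integral_bilinear_hasFDerivAt_right_eq_neg_left_of_integrable (μ := (volume : Measure ℂ)) (f := fun _ : ℂ => (1:ℝ)) (f' := fun _ => 0) (g := F) (g' := fderiv ℝ F) (v := v)
      (B := ContinuousLinearMap.lsmul ℝ ℝ) (by simp) (by simpa using hi.apply_continuousLinearMap v) (by simpa using h.continuous.integrable_of_hasCompactSupport (hcs_of h0))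
      (fun x _ => hasFDerivAt_const _ _) (fun x _ => (h.differentiable (by simp) x).hasFDerivAt)
    simpa using this

/-- the approximate identity -/
def mu (z : ℂ) : ℂ := fderiv ℝ KK z 1 + Complex.I * fderiv ℝ KK z Complex.I

/-- real derivative of `th` profile -/
theorem mu_eq (z : ℂ) : mu z = ((-(deriv Real.smoothTransition (2 - 4 * ‖z‖ ^ 2)) * (-4) / Real.pi : ℝ) : ℂ) := by
  by_cases h : ‖z‖ < 1 / 2
  · have : KK =ᶠ[𝓝 z] fun _ => 0 := by
      filter_upwards [(isOpen_lt continuous_norm continuous_const).mem_nhds h] with y hy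
      exact KK_zero (le_of_lt hy)
    have h2 : Real.smoothTransition =ᶠ[𝓝 (2 - 4 * ‖z‖ ^ 2)] fun _ => 1 := by
      have : 1 < 2 - 4 * ‖z‖ ^ 2 := by nlinarith [norm_nonneg z]
      filter_upwards [lt_mem_nhds this] with y hy using Real.smoothTransition.one_of_one_le hy.le
    rw [mu, this.fderiv_eq, h2.deriv_eq]; simp
  · have hz : z ≠ 0 := by rintro rfl; norm_num at h
    set s' := deriv Real.smoothTransition (2 - 4 * ‖z‖ ^ 2) with hs'
    have hst : HasDerivAt Real.smoothTransition s' (2 - 4 * Complex.normSq z) := by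
      rw [hs', Complex.normSq_eq_norm_sq]
      exact ((Real.smoothTransition.contDiff (n := 1)).differentiable (by simp) _).hasDerivAt
    have hns : HasFDerivAt (fun z : ℂ => Complex.normSq z) ((2 * z.re) • Complex.reCLM + (2 * z.im) • Complex.imCLM) z := by
      have : (fun z : ℂ => Complex.normSq z) = fun z => Complex.reCLM z * Complex.reCLM z + Complex.imCLM z * Complex.imCLM z := by
        ext z; simp [Complex.normSq_apply]
      rw [this]
      have h1 := Complex.reCLM.hasFDerivAt (x := z)
      have h2 := Complex.imCLM.hasFDerivAt (x := z)
      refine ((h1.mul h1).add (h2.mul h2)).congr_fderiv ?_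
      ext <;> simp <;> ring
    have hth : HasFDerivAt th (s' • (-(4:ℝ) • ((2 * z.re) • Complex.reCLM + (2 * z.im) • Complex.imCLM))) z := by
      have := hst.comp_hasFDerivAt z ((hns.const_mul 4).const_sub 2)
      refine this.congr_fderiv ?_
      ext <;> simp <;> ring
    have hnum : HasFDerivAt (fun z : ℂ => ((1 - th z : ℝ) : ℂ)) (-(Complex.ofRealCLM.comp (s' • (-(4:ℝ) • ((2 * z.re) • Complex.reCLM + (2 * z.im) • Complex.imCLM))))) z := by
      have := Complex.ofRealCLM.hasFDerivAt.comp z (hth.const_sub 1)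
      refine this.congr_fderiv ?_
      ext <;> simp
    have hpi : (Real.pi : ℂ) ≠ 0 := by exact_mod_cast Real.pi_ne_zero
    have hinv : HasFDerivAt (fun z : ℂ => (2 * Real.pi * z)⁻¹) ((ContinuousLinearMap.toSpanSingleton ℂ (-(2 * Real.pi * z ^ 2)⁻¹ : ℂ)).restrictScalars ℝ) z := by
      have : HasDerivAt (fun z : ℂ => (2 * Real.pi * z)⁻¹) (-(2 * Real.pi * z ^ 2)⁻¹) z := by
        have := (((hasDerivAt_id z).const_mul (2 * Real.pi : ℂ))).inv (by simp [hz, hpi])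
        refine this.congr_deriv ?_
        simp; field_simp
      exact this.hasFDerivAt.restrictScalars ℝ
    have hK : HasFDerivAt KK _ z := hnum.mul hinv
    rw [mu, hK.fderiv]
    simp
    have e : (z.re : ℂ) + z.im * Complex.I = z := Complex.re_add_im z
    field_simp
    linear_combination (8 * (s' : ℂ) * z)* e + (-1) * (1 - (th z : ℂ)) * Complex.I_sq

theorem mu_zero {z : ℂ} (h : 1 < ‖z‖) : mu z = 0 := by
  have h2 : Real.smoothTransition =ᶠ[𝓝 (2 - 4 * ‖z‖ ^ 2)] fun _ => 0 := by
    have : 2 - 4 * ‖z‖ ^ 2 < 0 := by nlinarith [norm_nonneg z]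
    filter_upwards [gt_mem_nhds this] with y hy using Real.smoothTransition.zero_of_nonpos (le_of_lt hy)
  rw [mu_eq, h2.deriv_eq]; simp

theorem mu_cont : Continuous mu := by
  have := KK_hom.fderiv.1.continuous
  unfold mu; fun_prop

theorem int_mu : ∫ z, mu z = 1 := by
  let g : ℝ → ℂ := fun r : ℝ => ((-(deriv Real.smoothTransition (2 - 4 * r ^ 2)) * (-4) / Real.pi : ℝ) : ℂ)
  have h1 : ∀ z, mu z = g ‖z‖ := mu_eq
  refine ((integral_congr_ae (Eventually.of_forall h1)).trans (integral_fun_norm_addHaar (volume : Measure ℂ) g)).trans ?_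
  have hv : (volume : Measure ℂ).real (ball 0 1) = Real.pi := by
    rw [Measure.real, Complex.volume_ball]; simp
  rw [hv, Complex.finrank_real_complex]
  have hd : ∀ x ∈ Ici (0:ℝ), HasDerivAt (fun r : ℝ => -Real.smoothTransition (2 - 4 * r ^ 2)) (deriv Real.smoothTransition (2 - 4 * x ^ 2) * (8 * x)) x := by
    intro x _
    have h1 : HasDerivAt Real.smoothTransition (deriv Real.smoothTransition (2 - 4 * x ^ 2)) (2 - 4 * x ^ 2) :=
      ((Real.smoothTransition.contDiff (n := 1)).differentiable (by simp) _).hasDerivAt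
    have h2 : HasDerivAt (fun r : ℝ => 2 - 4 * r ^ 2) (-(8 * x)) x := by
      refine (((hasDerivAt_pow 2 x).const_mul 4).const_sub 2).congr_deriv ?_
      simp; ring
    refine (h1.comp x h2).neg.congr_deriv ?_
    ring
  have hev : ∀ᶠ r : ℝ in atTop, 2 - 4 * r ^ 2 < 0 := by
    filter_upwards [eventually_gt_atTop 1] with r hr; nlinarith
  have hc : Continuous fun x : ℝ => deriv Real.smoothTransition (2 - 4 * x ^ 2) * (8 * x) := by
    have := (Real.smoothTransition.contDiff (n := 1)).continuous_deriv (by simp)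
    fun_prop
  have hint : IntegrableOn (fun x : ℝ => deriv Real.smoothTransition (2 - 4 * x ^ 2) * (8 * x)) (Ioi 0) := by
    refine Integrable.integrableOn (hc.integrable_of_hasCompactSupport (HasCompactSupport.intro (isCompact_Icc (a := (-1:ℝ)) (b := 1)) ?_))
    intro x hx
    have h3 : 2 - 4 * x ^ 2 < 0 := by
      have : 1 < |x| := by
        by_contra! h; exact hx (abs_le.1 h)
      have := sq_abs x
      nlinarith
    have h2 : Real.smoothTransition =ᶠ[𝓝 (2 - 4 * x ^ 2)] fun _ => 0 := by
      filter_upwards [gt_mem_nhds h3] with y hy using Real.smoothTransition.zero_of_nonpos (le_of_lt hy)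
    rw [h2.deriv_eq]; simp
  have ht : Tendsto (fun r : ℝ => -Real.smoothTransition (2 - 4 * r ^ 2)) atTop (𝓝 0) := by
    refine tendsto_const_nhds.congr' ?_
    filter_upwards [hev] with r hr
    rw [Real.smoothTransition.zero_of_nonpos hr.le]; simp
  have key := integral_Ioi_of_hasDerivAt_of_tendsto' hd hint ht
  have e : (∫ y in Ioi (0:ℝ), y ^ (2 - 1) • ((-(deriv Real.smoothTransition (2 - 4 * y ^ 2)) * (-4) / Real.pi : ℝ) : ℂ)) =
      (((2 * Real.pi)⁻¹ * ∫ y in Ioi (0:ℝ), deriv Real.smoothTransition (2 - 4 * y ^ 2) * (8 * y) : ℝ) : ℂ) := by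
    rw [← integral_const_mul, ← integral_complex_ofReal]
    congr 1
    ext y
    have hpi : (Real.pi : ℂ) ≠ 0 := by exact_mod_cast Real.pi_ne_zero
    simp
    field_simp
    ring
  rw [e, key]
  have h4 : Real.smoothTransition (2 - 4 * 0 ^ 2) = 1 := Real.smoothTransition.one_of_one_le (by norm_num)
  rw [h4]
  simp

end JH

namespace JH
open MeasureTheory
open scoped ContDiff

section TT
variable {E : Type} [NormedAddCommGroup E] [NormedSpace ℝ E] [NormedSpace ℂ E] [IsScalarTower ℝ ℂ E] [CompleteSpace E]

variable (E) in
/-- scalar multiplication -/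
def lsm : ℂ →L[ℝ] E →L[ℝ] E := ContinuousLinearMap.lsmul ℝ ℂ

@[simp] theorem lsm_apply (c : ℂ) (e : E) : lsm E c e = c • e := rfl

variable (E) in
/-- scalar multiplication, derivative version -/
def lsmD : (ℂ →L[ℝ] ℂ) →L[ℝ] E →L[ℝ] (ℂ →L[ℝ] E) := (lsm E).precompL ℂ

@[simp] theorem lsmD_apply (c : ℂ →L[ℝ] ℂ) (e : E) (v : ℂ) : lsmD E c e v = c v • e := rfl

/-- Cauchy transform -/
def TT (ψ : ℂ → E) (z : ℂ) : E := cv (lsm E) KK ψ z + ∑' j, cv (lsm E) (sc 1 j ka) ψ z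

/-- derivative of the Cauchy transform -/
def DD (ψ : ℂ → E) (z : ℂ) : ℂ →L[ℝ] E := cv (lsmD E) (fderiv ℝ KK) ψ z + ∑' j, cv (lsmD E) (sc 2 j (fderiv ℝ ka)) ψ z

theorem cv_bd {A B : Type} [NormedAddCommGroup A] [NormedSpace ℝ A] [NormedAddCommGroup B] [NormedSpace ℝ B] (L : A →L[ℝ] E →L[ℝ] B)
    {H : ℂ → A} {ψ : ℂ → E} {M S r : ℝ} (hr : 0 ≤ r) (hH : Continuous H) (h1 : ∀ x, ‖H x‖ ≤ M) (h2 : ∀ x y, ‖H x - H y‖ ≤ M * ‖x - y‖)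
    (hψ : Continuous ψ) (h0 : ∀ x, r < ‖x‖ → ψ x = 0) (hS : ∀ x, ‖ψ x‖ ≤ S) : Bd (cv L H ψ) (‖L‖ * M * S * (Real.pi * r ^ 2)) := by
  rw [← max_self (‖L‖ * M * S * (Real.pi * r ^ 2))]
  refine bd_of_lip ?_ ?_
  · intro z; exact norm_cv_le' L hr h1 h0 hS
  · intro w z
    rw [cv_diff L (cv_int L hH hψ h0) z w]
    refine (norm_cv_le' L hr (M := M * ‖w - z‖) ?_ h0 hS).trans (le_of_eq (by ring))
    intro x; simpa using h2 (x + (w - z)) x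

theorem Bd.add {f g : ℂ → E} {C D : ℝ} (hf : Bd f C) (hg : Bd g D) : Bd (fun z => f z + g z) (C + D) := by
  refine ⟨fun z => (norm_add_le _ _).trans (add_le_add (hf.1 z) (hg.1 z)), fun z w h => ?_⟩
  calc ‖f z + g z - (f w + g w)‖ = ‖(f z - f w) + (g z - g w)‖ := by congr 1; abel
    _ ≤ _ := norm_add_le _ _
    _ ≤ _ := add_le_add (hf.2 z w h) (hg.2 z w h)
    _ = _ := by ring

theorem Bd.add' {B : Type} [NormedAddCommGroup B] {f g : ℂ → B} {C D : ℝ} (hf : Bd f C) (hg : Bd g D) : Bd (fun z => f z + g z) (C + D) := by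
  refine ⟨fun z => (norm_add_le _ _).trans (add_le_add (hf.1 z) (hg.1 z)), fun z w h => ?_⟩
  calc ‖f z + g z - (f w + g w)‖ = ‖(f z - f w) + (g z - g w)‖ := by congr 1; abel
    _ ≤ _ := norm_add_le _ _
    _ ≤ _ := add_le_add (hf.2 z w h) (hg.2 z w h)
    _ = _ := by ring

theorem KK_nice : ∃ M, (∀ x, ‖KK x‖ ≤ M) ∧ (∀ x, ‖fderiv ℝ KK x‖ ≤ M) ∧ (∀ x y, ‖KK x - KK y‖ ≤ M * ‖x - y‖) ∧
    (∀ x y, ‖fderiv ℝ KK x - fderiv ℝ KK y‖ ≤ M * ‖x - y‖) ∧ ∀ z, 1 ≤ ‖z‖ → ‖KK z‖ ≤ M * ‖z‖⁻¹ := by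
  obtain ⟨M0, h0⟩ := KK_hom.bdd
  obtain ⟨M1, h1⟩ := KK_hom.fderiv.bdd
  obtain ⟨M2, h2⟩ := KK_hom.fderiv.fderiv.bdd
  have a0 : M0 ≤ max M0 (max M1 M2) := le_max_left _ _
  have a1 : M1 ≤ max M0 (max M1 M2) := (le_max_left _ _).trans (le_max_right _ _)
  have a2 : M2 ≤ max M0 (max M1 M2) := (le_max_right _ _).trans (le_max_right _ _)
  refine ⟨max M0 (max M1 M2), fun x => (h0 x).1.trans a0, fun x => (h1 x).1.trans a1, ?_, ?_, ?_⟩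
  · exact lip_of_fderiv KK_hom.1 fun x => (h1 x).1.trans a1
  · exact lip_of_fderiv KK_hom.fderiv.1 fun x => (h2 x).1.trans a2
  · intro z hz
    have := (h0 z).2 hz
    rw [pow_one] at this
    refine this.trans ?_
    gcongr

theorem ka_nice : ∃ M, Nice ka M ∧ Nice (fderiv ℝ ka) M := by
  obtain ⟨⟨M, h⟩, ⟨M', h'⟩, -⟩ := nice_of ka_cd (fun z => ka_zero)
  refine ⟨max M M', ⟨h.cont, h.supp, fun x => (h.bdd x).trans (le_max_left _ _), fun x y => (h.lip x y).trans ?_⟩,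
    ⟨h'.cont, h'.supp, fun x => (h'.bdd x).trans (le_max_right _ _), fun x y => (h'.lip x y).trans ?_⟩⟩
  · gcongr; exact le_max_left _ _
  · gcongr; exact le_max_right _ _

theorem ka_int : ∫ z, fderiv ℝ ka z = 0 := (nice_of ka_cd (fun z => ka_zero)).2.2

/-- constants for kernels -/
def CK : ℝ := Classical.choose KK_nice
theorem CK_spec : (∀ x, ‖KK x‖ ≤ CK) ∧ (∀ x, ‖fderiv ℝ KK x‖ ≤ CK) ∧ (∀ x y, ‖KK x - KK y‖ ≤ CK * ‖x - y‖) ∧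
    (∀ x y, ‖fderiv ℝ KK x - fderiv ℝ KK y‖ ≤ CK * ‖x - y‖) ∧ ∀ z, 1 ≤ ‖z‖ → ‖KK z‖ ≤ CK * ‖z‖⁻¹ := Classical.choose_spec KK_nice
/-- constants for kernels -/
def Ck : ℝ := Classical.choose ka_nice
theorem Ck_spec : Nice ka Ck ∧ Nice (fderiv ℝ ka) Ck := Classical.choose_spec ka_nice
theorem CK_nonneg : 0 ≤ CK := (norm_nonneg _).trans (CK_spec.1 0)
theorem Ck_nonneg : 0 ≤ Ck := Ck_spec.1.nonneg

variable (E) in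
theorem TT_bd {r : ℝ} (hr : 0 ≤ r) : ∃ C, 0 ≤ C ∧ ∀ (ψ : ℂ → E) (S : ℝ), Continuous ψ → (∀ x, r < ‖x‖ → ψ x = 0) → (∀ x, ‖ψ x‖ ≤ S) → Bd (TT ψ) (C * S) := by
  have hCK := CK_nonneg
  have hCk := Ck_nonneg
  refine ⟨‖lsm E‖ * CK * (Real.pi * r ^ 2) + 10 * (40 * ‖lsm E‖ * Ck), by positivity, fun ψ S hψ h0 hS => ?_⟩
  have h1 := cv_bd (lsm E) hr KK_cd.continuous CK_spec.1 CK_spec.2.2.1 hψ h0 hS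
  have h2 := bd_tsum (fun j => (dy2 (lsm E) Ck_spec.1 hψ hS j).1) (fun j => (dy2 (lsm E) Ck_spec.1 hψ hS j).2)
  have e : (‖lsm E‖ * CK * (Real.pi * r ^ 2) + 10 * (40 * ‖lsm E‖ * Ck)) * S = ‖lsm E‖ * CK * S * (Real.pi * r ^ 2) + 10 * (40 * ‖lsm E‖ * Ck * S) := by ring
  rw [e]
  exact h1.add h2

variable (E) in
theorem DD_bd {r : ℝ} (hr : 0 ≤ r) : ∃ C, 0 ≤ C ∧ ∀ (ψ : ℂ → E) (S : ℝ), Continuous ψ → (∀ x, r < ‖x‖ → ψ x = 0) → Bd ψ S → Bd (DD ψ) (C * S) := by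
  have hCK := CK_nonneg
  have hCk := Ck_nonneg
  refine ⟨‖lsmD E‖ * CK * (Real.pi * r ^ 2) + 10 * (40 * ‖lsmD E‖ * Ck), by positivity, fun ψ S hψ h0 hS => ?_⟩
  have h1 := cv_bd (lsmD E) hr (KK_cd.continuous_fderiv (by simp)) CK_spec.2.1 CK_spec.2.2.2.1 hψ h0 hS.1
  have h2 := bd_tsum (fun j => (dy1 (lsmD E) Ck_spec.2 ka_int hψ hS j).1) (fun j => (dy1 (lsmD E) Ck_spec.2 ka_int hψ hS j).2)
  have e : (‖lsmD E‖ * CK * (Real.pi * r ^ 2) + 10 * (40 * ‖lsmD E‖ * Ck)) * S = ‖lsmD E‖ * CK * S * (Real.pi * r ^ 2) + 10 * (40 * ‖lsmD E‖ * Ck * S) := by ring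
  rw [e]
  exact h1.add' h2

theorem sum1 {ψ : ℂ → E} {S : ℝ} (hψ : Continuous ψ) (hS : ∀ x, ‖ψ x‖ ≤ S) (z : ℂ) : Summable fun j => cv (lsm E) (sc 1 j ka) ψ z :=
  Summable.of_norm_bounded (qq_summable.mul_left _) (fun j => (dy2 (lsm E) Ck_spec.1 hψ hS j).1 z)

theorem sum2 {ψ : ℂ → E} {S : ℝ} (hψ : Continuous ψ) (hS : Bd ψ S) (z : ℂ) : Summable fun j => cv (lsmD E) (sc 2 j (fderiv ℝ ka)) ψ z :=
  Summable.of_norm_bounded (qq_summable.mul_left _) (fun j => (dy1 (lsmD E) Ck_spec.2 ka_int hψ hS j).1 z)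

theorem fderiv_sc {V : Type} [NormedAddCommGroup V] [NormedSpace ℝ V] {F : ℂ → V} (hF : ContDiff ℝ ∞ F) (j : ℕ) :
    fderiv ℝ (sc 1 j F) = sc 2 j (fderiv ℝ F) := by
  ext1 z
  unfold sc
  rw [fderiv_fun_const_smul, fderiv_comp_smul, smul_smul]
  · congr 1
  · have : Differentiable ℝ (fun z : ℂ => (2:ℝ) ^ j • z) := differentiable_id.fun_const_smul _
    exact (hF.differentiable (by simp)).comp this z

theorem sc_cd {V : Type} [NormedAddCommGroup V] [NormedSpace ℝ V] {F : ℂ → V} (hF : ContDiff ℝ ∞ F) (k j : ℕ) :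
    ContDiff ℝ ∞ (sc k j F) := by
  unfold sc
  exact (hF.comp (contDiff_id.const_smul _)).const_smul _

theorem TT_deriv {r S : ℝ} {ψ : ℂ → E} (hψ : Continuous ψ) (h0 : ∀ x, r < ‖x‖ → ψ x = 0) (hS : Bd ψ S) (z : ℂ) :
    HasFDerivAt (TT ψ) (DD ψ z) z := by
  have h1 : HasFDerivAt (cv (lsm E) KK ψ) (cv (lsmD E) (fderiv ℝ KK) ψ z) z :=
    cv_fderiv (lsm E) (KK_cd.of_le (by simp)) CK_spec.2.1 hψ h0 z
  have h2 : ∀ j z, HasFDerivAt (cv (lsm E) (sc 1 j ka) ψ) (cv (lsmD E) (sc 2 j (fderiv ℝ ka)) ψ z) z := by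
    intro j z
    rw [← fderiv_sc ka_cd]
    refine cv_fderiv (lsm E) (M := ((2:ℝ) ^ j) ^ 2 * Ck) ((sc_cd ka_cd 1 j).of_le (by simp)) ?_ hψ h0 z
    rw [fderiv_sc ka_cd]
    exact sc_bdd Ck_spec.2 2 j
  exact h1.add (hasFDerivAt_tsum (qq_summable.mul_left _) h2 (fun j => (dy1 (lsmD E) Ck_spec.2 ka_int hψ hS j).1) (sum1 hψ hS.1 0) z)

theorem fderiv_ka (z : ℂ) : fderiv ℝ ka z = (4:ℝ) • fderiv ℝ KK ((2:ℝ) • z) - fderiv ℝ KK z := by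
  have hd : Differentiable ℝ KK := KK_cd.differentiable (by simp)
  have hd2 : Differentiable ℝ (fun z => KK ((2:ℝ) • z)) := by
    have : Differentiable ℝ (fun z : ℂ => (2:ℝ) • z) := differentiable_id.fun_const_smul _
    exact hd.comp this
  have : ka = fun z => (2:ℝ) • KK ((2:ℝ) • z) - KK z := rfl
  rw [this, fderiv_fun_sub (hd2.fun_const_smul _ z) (hd z), fderiv_fun_const_smul (hd2 z), fderiv_comp_smul, smul_smul]
  norm_num

theorem DD_partial {r : ℝ} {ψ : ℂ → E} (hψ : Continuous ψ) (h0 : ∀ x, r < ‖x‖ → ψ x = 0) (z : ℂ) (N : ℕ) :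
    cv (lsmD E) (fderiv ℝ KK) ψ z + ∑ j ∈ Finset.range N, cv (lsmD E) (sc 2 j (fderiv ℝ ka)) ψ z = cv (lsmD E) (sc 2 N (fderiv ℝ KK)) ψ z := by
  have hKd : ContDiff ℝ ∞ (fderiv ℝ KK) := KK_hom.fderiv.1
  induction N with
  | zero => simp [sc, cv]
  | succ n ih =>
    rw [Finset.sum_range_succ, ← add_assoc, ih]
    unfold cv
    rw [← integral_add (cv_int _ (sc_cd hKd 2 n).continuous hψ h0 z) (cv_int _ (sc_cont Ck_spec.2 2 n) hψ h0 z)]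
    congr 1
    ext1 w
    rw [← add_apply, ← map_add]
    congr 2
    unfold sc
    generalize hu : (2:ℝ) ^ n • (z - w) = u
    rw [fderiv_ka, smul_sub, add_sub_cancel, smul_smul, show (2:ℝ) ^ (n + 1) • (z - w) = (2:ℝ) • u by rw [← hu, smul_smul]; congr 1; ring]
    congr 1
    ring

theorem DD_dbar {r S : ℝ} {ψ : ℂ → E} (hψ : Continuous ψ) (h0 : ∀ x, r < ‖x‖ → ψ x = 0) (hS : Bd ψ S) (z : ℂ) :
    DD ψ z 1 + Complex.I • DD ψ z Complex.I = ψ z := by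
  let Λ : (ℂ →L[ℝ] E) → E := fun D => D 1 + Complex.I • D Complex.I
  have hΛ : Continuous Λ := by
    have : Continuous fun D : ℂ →L[ℝ] E => D 1 := (ContinuousLinearMap.apply ℝ E (1:ℂ)).continuous
    have h2 : Continuous fun D : ℂ →L[ℝ] E => D Complex.I := (ContinuousLinearMap.apply ℝ E Complex.I).continuous
    exact this.add (h2.const_smul _)
  have hKd : ContDiff ℝ ∞ (fderiv ℝ KK) := KK_hom.fderiv.1
  have h1 : Tendsto (fun N => Λ (cv (lsmD E) (sc 2 N (fderiv ℝ KK)) ψ z)) atTop (𝓝 (Λ (DD ψ z))) := by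
    refine (hΛ.tendsto _).comp ?_
    have := (tendsto_const_nhds (x := cv (lsmD E) (fderiv ℝ KK) ψ z)).add (sum2 hψ hS z).hasSum.tendsto_sum_nat
    refine this.congr fun N => DD_partial hψ h0 z N
  have h2 : ∀ N, Λ (cv (lsmD E) (sc 2 N (fderiv ℝ KK)) ψ z) = cv (lsm E) (sc 2 N mu) ψ z := by
    intro N
    have hi := cv_int (lsmD E) (sc_cd hKd 2 N).continuous hψ h0 z
    simp only [Λ, cv]
    have i1 := hi.apply_continuousLinearMap 1
    have i2 : Integrable (fun w => Complex.I • (lsmD E (sc 2 N (fderiv ℝ KK) (z - w)) (ψ w)) Complex.I) := (hi.apply_continuousLinearMap Complex.I).smul Complex.I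
    rw [ContinuousLinearMap.integral_apply hi, ContinuousLinearMap.integral_apply hi, ← integral_smul, ← integral_add i1 i2]
    congr 1
    ext1 w
    simp only [lsmD_apply, lsm_apply, sc, mu]
    rw [smul_smul, ← add_smul]
    congr 1
    simp only [smul_apply, smul_add, mul_smul_comm]
  have hmu : ∃ M, Nice mu M := by
    refine ⟨2 * CK, mu_cont, fun x hx => mu_zero hx, fun x => ?_, fun x y => ?_⟩
    · refine (norm_add_le _ _).trans ?_
      have a := (fderiv ℝ KK x).le_of_opNorm_le (CK_spec.2.1 x) 1
      have b := (fderiv ℝ KK x).le_of_opNorm_le (CK_spec.2.1 x) Complex.I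
      rw [norm_mul, Complex.norm_I, one_mul]
      simp at a b
      linarith
    · have e : mu x - mu y = (fderiv ℝ KK x - fderiv ℝ KK y) 1 + Complex.I * (fderiv ℝ KK x - fderiv ℝ KK y) Complex.I := by
        simp [mu]; ring
      rw [e]
      refine (norm_add_le _ _).trans ?_
      have a := (fderiv ℝ KK x - fderiv ℝ KK y).le_of_opNorm_le (CK_spec.2.2.2.1 x y) 1
      have b := (fderiv ℝ KK x - fderiv ℝ KK y).le_of_opNorm_le (CK_spec.2.2.2.1 x y) Complex.I
      rw [norm_mul, Complex.norm_I, one_mul]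
      rw [norm_one, mul_one] at a
      rw [Complex.norm_I, mul_one] at b
      linarith
  obtain ⟨M, hM⟩ := hmu
  have h3 : Tendsto (fun N => cv (lsm E) (sc 2 N mu) ψ z) atTop (𝓝 (ψ z)) := by
    rw [tendsto_iff_norm_sub_tendsto_zero]
    refine squeeze_zero (g := fun N => ‖lsm E‖ * M * (2 * S) * Real.pi * qq ^ N) (fun _ => norm_nonneg _) (fun N => ?_) ?_
    · have e := cv_zero (lsm E) (sc_cont hM 2 N) hψ (sc_supp hM 2 N) z
      rw [int_sc, int_mu, lsm_apply, one_smul] at e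
      rw [e]
      have hSn : 0 ≤ S := (norm_nonneg _).trans (hS.1 0)
      refine (norm_cv_le (lsm E) (r := ((2:ℝ) ^ N)⁻¹) (S := 2 * S * qq ^ N) (by positivity) (sc_bdd hM 2 N) (sc_supp hM 2 N) ?_).trans (le_of_eq ?_)
      · intro w hw
        refine (hS.far w z).trans ?_
        rw [← qq_pow]; gcongr
      · field_simp
    · simpa using (tendsto_pow_atTop_nhds_zero_of_lt_one qq_pos.le (by linarith [qq_lt])).const_mul (‖lsm E‖ * M * (2 * S) * Real.pi)
  exact tendsto_nhds_unique h1 (h3.congr fun N => (h2 N).symm)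

theorem TT_tendsto {r S : ℝ} {ψ : ℂ → E} (hr : 0 ≤ r) (h0 : ∀ x, r < ‖x‖ → ψ x = 0) (hS : ∀ x, ‖ψ x‖ ≤ S) :
    Tendsto (TT ψ) (cocompact ℂ) (𝓝 0) := by
  rw [tendsto_zero_iff_norm_tendsto_zero]
  have ht := tendsto_norm_cocompact_atTop (E := ℂ)
  have hlim : Tendsto (fun z : ℂ => ‖lsm E‖ * (CK * (‖z‖ - r)⁻¹) * S * (Real.pi * r ^ 2)) (cocompact ℂ) (𝓝 0) := by
    have h1 : Tendsto (fun z : ℂ => (‖z‖ - r)⁻¹) (cocompact ℂ) (𝓝 0) :=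
      tendsto_inv_atTop_zero.comp (tendsto_atTop_add_const_right _ _ ht)
    have h2 := h1.const_mul (‖lsm E‖ * CK * S * (Real.pi * r ^ 2))
    rw [mul_zero] at h2
    refine h2.congr fun z => by ring
  refine squeeze_zero' (Eventually.of_forall fun _ => norm_nonneg _) ?_ hlim
  filter_upwards [ht.eventually_gt_atTop (r + 1)] with z hz
  have e : ∀ j, cv (lsm E) (sc 1 j ka) ψ z = 0 := by
    intro j
    unfold cv
    rw [← integral_zero ℂ E]
    congr 1
    ext1 w
    by_cases hw : r < ‖w‖
    · simp [h0 w hw]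
    · rw [sc_supp Ck_spec.1]; · simp
      have := norm_sub_norm_le z w
      have h2 : ((2:ℝ) ^ j)⁻¹ ≤ 1 := inv_le_one_of_one_le₀ (one_le_pow₀ (by norm_num))
      linarith
  unfold TT
  simp only [e, tsum_zero, add_zero]
  refine norm_int_le (z := 0) hr ?_ ?_
  · intro w hw; rw [h0 _ (by simpa using hw)]; simp
  · intro w hw
    rw [sub_zero] at hw
    have h1 := norm_sub_norm_le z w
    refine norm_L_le (lsm E) ?_ (hS w)
    refine (CK_spec.2.2.2.2 (z - w) (by linarith)).trans ?_
    have := CK_nonneg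
    change CK * _ ≤ _
    gcongr
    · linarith
    · linarith

theorem liouville {v : ℂ → E} {D : ℂ → ℂ →L[ℝ] E} (hv : ∀ z, HasFDerivAt v (D z) z) (hD : ∀ z, D z 1 + Complex.I • D z Complex.I = 0)
    (ht : Tendsto v (cocompact ℂ) (𝓝 0)) (z : ℂ) : v z = 0 := by
  have hd : Differentiable ℂ v := by
    intro z
    have hI : D z Complex.I = Complex.I • D z 1 := by
      have := congrArg (fun x => Complex.I • x) (hD z)
      simp only [smul_add, smul_smul, Complex.I_mul_I, neg_smul, one_smul, smul_zero] at this
      rw [← sub_eq_add_neg, sub_eq_zero] at this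
      exact this.symm
    have : HasFDerivAt v (ContinuousLinearMap.toSpanSingleton ℂ (D z 1)) z := by
      rw [hasFDerivAt_iff_isLittleO_nhds_zero]
      have h := hasFDerivAt_iff_isLittleO_nhds_zero.1 (hv z)
      refine h.congr_left fun h => ?_
      congr 1
      simp only [ContinuousLinearMap.toSpanSingleton_apply]
      conv_lhs => rw [← Complex.re_add_im h]
      have e1 : (h.re : ℂ) = h.re • (1:ℂ) := by simp
      have e2 : (h.im : ℂ) * Complex.I = h.im • Complex.I := by simp
      rw [e1, e2, map_add, map_smul, map_smul, hI]
      conv_rhs => rw [← Complex.re_add_im h, add_smul, mul_smul]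
      have e3 : ∀ (r : ℝ) (x : E), (r : ℂ) • x = r • x := fun r x => algebraMap_smul ℂ r x
      rw [e3, e3]
    exact this.differentiableAt
  exact hd.apply_eq_of_tendsto_cocompact z ht

end TT
end JH

namespace JH
open MeasureTheory
open scoped ContDiff

theorem lip_of_cd {V : Type} [NormedAddCommGroup V] [NormedSpace ℝ V] {F : ℂ → V} {r : ℝ} (h : ContDiff ℝ 1 F) (h0 : ∀ z, r < ‖z‖ → F z = 0) :
    ∃ C, (∀ z, ‖F z‖ ≤ C) ∧ ∀ z w, ‖F z - F w‖ ≤ C * ‖z - w‖ := by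
  have hc : HasCompactSupport F := hcs_of h0
  obtain ⟨C, hC⟩ := h.continuous.bounded_above_of_compact_support hc
  obtain ⟨C', hC'⟩ := (h.continuous_fderiv (by simp)).bounded_above_of_compact_support (hc.fderiv (𝕜 := ℝ))
  refine ⟨max C C', fun z => (hC z).trans (le_max_left _ _), fun z w => ?_⟩
  exact convex_univ.norm_image_sub_le_of_norm_fderiv_le (𝕜 := ℝ) (fun x _ => h.differentiable (by simp) x) (fun x _ => (hC' x).trans (le_max_right _ _)) (mem_univ w) (mem_univ z)

theorem bd_of_cd {V : Type} [NormedAddCommGroup V] [NormedSpace ℝ V] {F : ℂ → V} {r : ℝ} (h : ContDiff ℝ 1 F) (h0 : ∀ z, r < ‖z‖ → F z = 0) :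
    ∃ C, Bd F C := by
  obtain ⟨C, h1, h2⟩ := lip_of_cd h h0
  exact ⟨_, bd_of_lip h1 h2⟩

/-- large cutoff -/
def chi (n : ℕ) (z : ℂ) : ℝ := Real.smoothTransition (n + 1 - Complex.normSq z)

theorem chi_cd (n : ℕ) : ContDiff ℝ ∞ (chi n) :=
  Real.smoothTransition.contDiff.comp (contDiff_const.sub normSq_cd)

theorem chi_one {n : ℕ} {z : ℂ} (h : ‖z‖ ^ 2 ≤ n) : chi n z = 1 := by
  refine Real.smoothTransition.one_of_one_le ?_
  rw [Complex.normSq_eq_norm_sq]; linarith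

theorem chi_zero {n : ℕ} {z : ℂ} (h : (n:ℝ) + 1 < ‖z‖) : chi n z = 0 := by
  refine Real.smoothTransition.zero_of_nonpos ?_
  rw [Complex.normSq_eq_norm_sq]
  have : (0:ℝ) ≤ n := Nat.cast_nonneg n
  nlinarith [norm_nonneg z]

theorem chi_le (n : ℕ) (z : ℂ) : |chi n z| ≤ 1 := by
  unfold chi; rw [abs_of_nonneg (Real.smoothTransition.nonneg _)]; exact Real.smoothTransition.le_one _

/-- cutoff as element of `X` -/
def chX (n : ℕ) : X ℝ := X.of (chi n) (bd_of_cd ((chi_cd n).of_le (by simp)) (fun _ h => chi_zero h))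

section U
variable {E : Type} [NormedAddCommGroup E] [NormedSpace ℝ E]

/-- multiply by the cutoff -/
def cut (n : ℕ) : X E →L[ℝ] X E := X.bil (ContinuousLinearMap.lsmul ℝ ℝ) (chX n)

@[simp] theorem cut_apply (n : ℕ) (φ : X E) (z : ℂ) : cut n φ z = chi n z • φ z := rfl

theorem cut_supp (n : ℕ) (φ : X E) (z : ℂ) (h : (n:ℝ) + 1 < ‖z‖) : cut n φ z = 0 := by
  rw [cut_apply, chi_zero h, zero_smul]

theorem cut_le (n : ℕ) (φ : X E) {S : ℝ} (h : ∀ z, ‖φ z‖ ≤ S) (z : ℂ) : ‖cut n φ z‖ ≤ S := by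
  rw [cut_apply, norm_smul, Real.norm_eq_abs]
  have := chi_le n z
  have := h z
  nlinarith [norm_nonneg (φ z), abs_nonneg (chi n z)]

theorem cut_eq (n : ℕ) (φ : X E) (h : ∀ z : ℂ, (n:ℝ) < ‖z‖ ^ 2 → φ z = 0) : cut n φ = φ := by
  ext z
  rw [cut_apply]
  by_cases hz : (n:ℝ) < ‖z‖ ^ 2
  · rw [h z hz, smul_zero]
  · rw [chi_one (not_lt.1 hz), one_smul]

variable [NormedSpace ℂ E] [IsScalarTower ℝ ℂ E] [CompleteSpace E]

theorem TT_add {r : ℝ} {φ ψ : X E} (h1 : ∀ x, r < ‖x‖ → φ x = 0) (h2 : ∀ x, r < ‖x‖ → ψ x = 0) (z : ℂ) : TT (φ + ψ : X E) z = TT φ z + TT ψ z := by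
  have e : ∀ (G : ℂ → ℂ), Continuous G → cv (lsm E) G (φ + ψ : X E) z = cv (lsm E) G φ z + cv (lsm E) G ψ z := by
    intro G hG
    unfold cv
    rw [← integral_add (cv_int _ hG φ.continuous h1 z) (cv_int _ hG ψ.continuous h2 z)]
    simp
  unfold TT
  rw [e _ KK_cd.continuous, tsum_congr (fun j => e _ (sc_cont Ck_spec.1 1 j)), (sum1 φ.continuous φ.norm_apply_le z).tsum_add (sum1 ψ.continuous ψ.norm_apply_le z)]
  abel

theorem DD_add {r : ℝ} {φ ψ : X E} (h1 : ∀ x, r < ‖x‖ → φ x = 0) (h2 : ∀ x, r < ‖x‖ → ψ x = 0) (z : ℂ) : DD (φ + ψ : X E) z = DD φ z + DD ψ z := by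
  have hd := TT_deriv (φ + ψ).continuous (r := r) (fun x hx => by simp [h1 x hx, h2 x hx]) (φ + ψ).bd z
  have h3 := (TT_deriv φ.continuous h1 φ.bd z).add (TT_deriv ψ.continuous h2 ψ.bd z)
  refine hd.unique (h3.congr_of_eventuallyEq (Eventually.of_forall fun y => TT_add h1 h2 y))

theorem TT_smul (c : ℝ) (φ : X E) (z : ℂ) : TT (c • φ : X E) z = c • TT φ z := by
  have e : ∀ (G : ℂ → ℂ), cv (lsm E) G (c • φ : X E) z = c • cv (lsm E) G φ z := by
    intro G
    unfold cv
    rw [← integral_smul]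
    congr 1; ext1 w
    rw [X.smul_apply, map_smul]
  unfold TT
  rw [e, tsum_congr (fun j => e _), (sum1 φ.continuous φ.norm_apply_le z).tsum_const_smul, smul_add]

theorem DD_smul {r : ℝ} (c : ℝ) {φ : X E} (h1 : ∀ x, r < ‖x‖ → φ x = 0) (z : ℂ) : DD (c • φ : X E) z = c • DD φ z := by
  have hd := TT_deriv (c • φ).continuous (r := r) (fun x hx => by simp [h1 x hx]) (c • φ).bd z
  have h3 := (TT_deriv φ.continuous h1 φ.bd z).const_smul c
  refine hd.unique (h3.congr_of_eventuallyEq (Eventually.of_forall fun y => TT_smul c φ y))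

theorem np1 (n : ℕ) : (0:ℝ) ≤ (n:ℝ) + 1 := by positivity

variable (E) in
/-- constant -/
def CT (n : ℕ) : ℝ := Classical.choose (TT_bd E (np1 n))
theorem CT_nonneg (n : ℕ) : 0 ≤ CT E n := (Classical.choose_spec (TT_bd E (np1 n))).1
theorem CT_spec (n : ℕ) (φ : X E) {S : ℝ} (h : ∀ z, ‖φ z‖ ≤ S) : Bd (TT (cut n φ)) (CT E n * S) :=
  (Classical.choose_spec (TT_bd E (np1 n))).2 _ _ (cut n φ).continuous (cut_supp n φ) (cut_le n φ h)

/-- the operator T -/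
def T (n : ℕ) : X E →L[ℝ] X E :=
  X.mkOp (fun φ => TT (cut n φ)) (fun φ ψ z => by rw [map_add, TT_add (cut_supp n φ) (cut_supp n ψ)])
    (fun c φ z => by rw [map_smul, TT_smul]) (CT E n) (fun φ => CT_spec n φ φ.norm_apply_le)

theorem T_def (n : ℕ) (φ : X E) (z : ℂ) : T n φ z = TT (cut n φ) z := rfl

theorem T_bd (n : ℕ) (φ : X E) {S : ℝ} (h : ∀ z, ‖φ z‖ ≤ S) : Bd (T n φ) (CT E n * S) := CT_spec n φ h

/-- the derivative of T -/
def Dop (n : ℕ) : X E →L[ℝ] X (ℂ →L[ℝ] E) :=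
  X.mkOp (fun φ => DD (cut n φ)) (fun φ ψ z => by rw [map_add, DD_add (cut_supp n φ) (cut_supp n ψ)])
    (fun c φ z => by rw [map_smul, DD_smul c (cut_supp n φ)]) (Classical.choose (DD_bd E (np1 n)) * ‖(cut n : X E →L[ℝ] X E)‖) (fun φ => by
      have h := Classical.choose_spec (DD_bd E (np1 n))
      have := h.2 _ _ (cut n φ).continuous (cut_supp n φ) (cut n φ).bd
      have h3 := (cut n : X E →L[ℝ] X E).le_opNorm φ
      have h4 : Classical.choose (DD_bd E (np1 n)) * ‖cut n φ‖ ≤ Classical.choose (DD_bd E (np1 n)) * ‖(cut n : X E →L[ℝ] X E)‖ * ‖φ‖ := by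
        rw [mul_assoc]; exact mul_le_mul_of_nonneg_left h3 h.1
      exact ⟨fun z => (this.1 z).trans h4, fun z w hzw => (this.2 z w hzw).trans (by gcongr)⟩)

/-- y-derivative of T -/
def P (n : ℕ) : X E →L[ℝ] X E := (X.post (ContinuousLinearMap.apply ℝ E Complex.I)) ∘L Dop n

theorem P_apply (n : ℕ) (φ : X E) (z : ℂ) : P n φ z = Dop n φ z Complex.I := rfl

theorem T_deriv (n : ℕ) (φ : X E) (z : ℂ) : HasFDerivAt (T n φ) (Dop n φ z) z :=
  TT_deriv (cut n φ).continuous (cut_supp n φ) (cut n φ).bd z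

theorem Dop_dbar (n : ℕ) (φ : X E) (z : ℂ) : Dop n φ z 1 + Complex.I • Dop n φ z Complex.I = cut n φ z :=
  DD_dbar (cut n φ).continuous (cut_supp n φ) (cut n φ).bd z

theorem T_tendsto (n : ℕ) (φ : X E) : Tendsto (T n φ) (cocompact ℂ) (𝓝 0) :=
  TT_tendsto (np1 n) (cut_supp n φ) (cut n φ).norm_apply_le

theorem T_unique (n : ℕ) (φ : X E) {v : ℂ → E} {D : ℂ → ℂ →L[ℝ] E} (hv : ∀ z, HasFDerivAt v (D z) z)
    (hD : ∀ z, D z 1 + Complex.I • D z Complex.I = cut n φ z) (ht : Tendsto v (cocompact ℂ) (𝓝 0)) (z : ℂ) : T n φ z = v z := by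
  have h := liouville (v := fun z => T n φ z - v z) (fun z => (T_deriv n φ z).sub (hv z)) (fun z => by
    have h1 := Dop_dbar n φ z
    rw [← hD z] at h1
    simp only [sub_apply, smul_sub]
    rw [← sub_eq_zero] at h1
    rw [← h1]; abel) (by simpa using (T_tendsto n φ).sub ht) z
  exact sub_eq_zero.1 h

theorem T_tau (n : ℕ) (φ : X E) (h : ℂ) (h1 : cut n φ = φ) (h2 : cut n (X.tau h φ) = X.tau h φ) : T n (X.tau h φ) = X.tau h (T n φ) := by
  ext z
  refine T_unique n (X.tau h φ) (D := fun z => Dop n φ (z + h)) (fun z => ?_) (fun z => ?_) ?_ z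
  · have := (T_deriv n φ (z + h)).comp z ((hasFDerivAt_id z).add_const h)
    exact this
  · rw [Dop_dbar, h1, h2]; rfl
  · exact (T_tendsto n φ).comp (Homeomorph.addRight h).isClosedEmbedding.tendsto_cocompact

theorem Dop_tau (n : ℕ) (φ : X E) (h : ℂ) (h1 : cut n φ = φ) (h2 : cut n (X.tau h φ) = X.tau h φ) : Dop n (X.tau h φ) = X.tau h (Dop n φ) := by
  ext1 z
  have a := T_deriv n (X.tau h φ) z
  rw [T_tau n φ h h1 h2] at a
  refine a.unique ?_
  have := (T_deriv n φ (z + h)).comp z ((hasFDerivAt_id z).add_const h)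
  exact this

theorem P_tau (n : ℕ) (φ : X E) (h : ℂ) (h1 : cut n φ = φ) (h2 : cut n (X.tau h φ) = X.tau h φ) : P n (X.tau h φ) = X.tau h (P n φ) := by
  ext1 z
  rw [P_apply, Dop_tau n φ h h1 h2]; rfl

variable (E) in
theorem Dop_zero (n : ℕ) : ∃ C, 0 ≤ C ∧ ∀ (φ : X E) (M : ℝ), (∀ z, ‖φ z‖ ≤ M * ‖z‖) → ‖Dop n φ 0‖ ≤ C * M := by
  have hCK := CK_nonneg
  have hCk := Ck_nonneg
  have hn := np1 n
  refine ⟨‖lsmD E‖ * CK * (n + 1) * (Real.pi * (n + 1) ^ 2) + ‖lsmD E‖ * Ck * Real.pi * 2, by positivity, fun φ M h => ?_⟩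
  have hM : 0 ≤ M := by simpa using (norm_nonneg _).trans (h 1)
  have h' : ∀ z, ‖cut n φ z‖ ≤ M * ‖z‖ := fun z => by
    rw [cut_apply, norm_smul, Real.norm_eq_abs]
    refine (mul_le_of_le_one_left (norm_nonneg _) (chi_le n z)).trans (h z)
  have h'' : ∀ z, ‖cut n φ z‖ ≤ M * (n + 1) := fun z => by
    by_cases hz : (n:ℝ) + 1 < ‖z‖
    · rw [cut_supp n φ z hz, norm_zero]; positivity
    · exact (h' z).trans (by gcongr; exact not_lt.1 hz)
  have a := norm_cv_le' (lsmD E) (z := 0) hn CK_spec.2.1 (cut_supp n φ) h''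
  have b : ∀ j, ‖cv (lsmD E) (sc 2 j (fderiv ℝ ka)) (cut n φ) 0‖ ≤ ‖lsmD E‖ * Ck * Real.pi * M * (1 / 2) ^ j := by
    intro j
    refine (norm_cv_le (lsmD E) (r := ((2:ℝ) ^ j)⁻¹) (S := M * ((2:ℝ) ^ j)⁻¹) (by positivity) (sc_bdd Ck_spec.2 2 j) (sc_supp Ck_spec.2 2 j) ?_).trans (le_of_eq ?_)
    · intro w hw
      refine (h' w).trans ?_
      gcongr
      simpa using hw
    · have : ((1:ℝ) / 2) ^ j = ((2:ℝ) ^ j)⁻¹ := by rw [one_div, inv_pow]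
      rw [this]; field_simp
  have c := tsum_of_norm_bounded (hasSum_geometric_two.mul_left _) b
  change ‖cv (lsmD E) (fderiv ℝ KK) (cut n φ) 0 + ∑' j, cv (lsmD E) (sc 2 j (fderiv ℝ ka)) (cut n φ) 0‖ ≤ _
  refine (norm_add_le _ _).trans ((add_le_add a c).trans (le_of_eq ?_))
  ring

end U
end JH

namespace JH
open scoped ContDiff

section comp
variable {G F : Type} [NormedAddCommGroup G] [NormedSpace ℝ G] [NormedAddCommGroup F] [NormedSpace ℝ F]

/-- smooth compactly supported -/
def Cc (q : G → F) : Prop := ContDiff ℝ ∞ q ∧ HasCompactSupport q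

theorem Cc.fderiv {q : G → F} (h : Cc q) : Cc (fderiv ℝ q) := ⟨h.1.fderiv_right (by simp), h.2.fderiv (𝕜 := ℝ)⟩

theorem Cc.diff {q : G → F} (h : Cc q) : Differentiable ℝ q := h.1.differentiable (by simp)

theorem Cc.bdd {q : G → F} (h : Cc q) : ∃ C, 0 ≤ C ∧ ∀ x, ‖q x‖ ≤ C := by
  obtain ⟨C, hC⟩ := h.1.continuous.bounded_above_of_compact_support h.2
  exact ⟨C, (norm_nonneg _).trans (hC 0), hC⟩

theorem lip_of {q : G → F} (h : Differentiable ℝ q) {C : ℝ} (hC : ∀ x, ‖fderiv ℝ q x‖ ≤ C) (x y : G) : ‖q x - q y‖ ≤ C * ‖x - y‖ :=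
  convex_univ.norm_image_sub_le_of_norm_fderiv_le (𝕜 := ℝ) (fun x _ => h x) (fun x _ => hC x) (mem_univ y) (mem_univ x)

theorem Cc.lip {q : G → F} (h : Cc q) : ∃ C, 0 ≤ C ∧ ∀ x y, ‖q x - q y‖ ≤ C * ‖x - y‖ := by
  obtain ⟨C, h0, hC⟩ := h.fderiv.bdd
  exact ⟨C, h0, lip_of h.diff hC⟩

theorem rem1 {q : G → F} (h : Differentiable ℝ q) {C : ℝ} (hC : ∀ x y, ‖fderiv ℝ q x - fderiv ℝ q y‖ ≤ C * ‖x - y‖) (hC0 : 0 ≤ C) (a k : G) :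
    ‖q (a + k) - q a - fderiv ℝ q a k‖ ≤ C * ‖k‖ ^ 2 := by
  have := (convex_closedBall a ‖k‖).norm_image_sub_le_of_norm_fderiv_le' (𝕜 := ℝ) (f := q) (C := C * ‖k‖) (φ := fderiv ℝ q a) (x := a) (y := a + k)
    (fun x _ => h x) (fun x hx => (hC x a).trans (by gcongr; simpa [dist_eq_norm] using hx)) (by simp) (by simp)
  simpa [pow_two, mul_assoc] using this

theorem rem2 {q : G → F} (h : Cc q) : ∃ C, 0 ≤ C ∧ (∀ a k, ‖q (a + k) - q a - fderiv ℝ q a k‖ ≤ C * ‖k‖ ^ 2) ∧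
    ∀ a a' k k' κ, ‖k‖ ≤ κ → ‖k'‖ ≤ κ → ‖(q (a + k) - q a - fderiv ℝ q a k) - (q (a' + k') - q a' - fderiv ℝ q a' k')‖ ≤ C * (κ ^ 2 * ‖a - a'‖ + κ * ‖k - k'‖) := by
  obtain ⟨C1, h1, hC1⟩ := h.fderiv.lip
  obtain ⟨C2, h2, hC2⟩ := h.fderiv.fderiv.lip
  refine ⟨C1 + C2, by positivity, fun a k => (rem1 h.diff hC1 h1 a k).trans (by gcongr; linarith), fun a a' k k' κ hk hk' => ?_⟩
  have hκ : 0 ≤ κ := (norm_nonneg _).trans hk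
  have e1 : ‖(q (a + k) - q a - fderiv ℝ q a k) - (q (a' + k) - q a' - fderiv ℝ q a' k)‖ ≤ C2 * κ ^ 2 * ‖a - a'‖ := by
    refine convex_univ.norm_image_sub_le_of_norm_hasFDerivWithin_le (𝕜 := ℝ) (f := fun a => q (a + k) - q a - fderiv ℝ q a k)
      (f' := fun a => fderiv ℝ q (a + k) - fderiv ℝ q a - (fderiv ℝ (fderiv ℝ q) a).flip k) (fun x _ => ?_) (fun x _ => ?_) (mem_univ a') (mem_univ a)
    · have d1 : HasFDerivAt (fun a => q (a + k)) (fderiv ℝ q (x + k)) x := (h.diff (x + k)).hasFDerivAt.comp x ((hasFDerivAt_id x).add_const k)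
      have d2 := (h.fderiv.diff x).hasFDerivAt.clm_apply (hasFDerivAt_const k x)
      have d3 := ((d1.fun_sub (h.diff x).hasFDerivAt).fun_sub d2).hasFDerivWithinAt (s := univ)
      simpa using d3
    · have := rem1 h.fderiv.diff hC2 h2 x k
      have e : (fderiv ℝ (fderiv ℝ q) x).flip k = fderiv ℝ (fderiv ℝ q) x k := by
        ext v
        have : IsSymmSndFDerivAt ℝ q x := h.1.contDiffAt.isSymmSndFDerivAt (by simp; norm_cast)
        exact this v k
      rw [e]
      exact this.trans (by gcongr)
  have e2 : ‖(q (a' + k) - q a' - fderiv ℝ q a' k) - (q (a' + k') - q a' - fderiv ℝ q a' k')‖ ≤ C1 * κ * ‖k - k'‖ := by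
    refine (convex_closedBall (0:G) κ).norm_image_sub_le_of_norm_hasFDerivWithin_le (𝕜 := ℝ) (f := fun k => q (a' + k) - q a' - fderiv ℝ q a' k)
      (f' := fun k => fderiv ℝ q (a' + k) - fderiv ℝ q a') (fun x _ => ?_) (fun x hx => ?_) (by simpa using hk') (by simpa using hk)
    · have d1 : HasFDerivAt (fun k => q (a' + k)) (fderiv ℝ q (a' + x)) x := (h.diff (a' + x)).hasFDerivAt.comp x ((hasFDerivAt_id x).const_add a')
      exact ((d1.sub_const _).sub (fderiv ℝ q a').hasFDerivAt).hasFDerivWithinAt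
    · refine (hC1 _ _).trans ?_
      gcongr
      simpa using hx
  calc _ = ‖((q (a + k) - q a - fderiv ℝ q a k) - (q (a' + k) - q a' - fderiv ℝ q a' k)) + ((q (a' + k) - q a' - fderiv ℝ q a' k) - (q (a' + k') - q a' - fderiv ℝ q a' k'))‖ := by congr 1; abel
    _ ≤ _ := norm_add_le _ _
    _ ≤ C2 * κ ^ 2 * ‖a - a'‖ + C1 * κ * ‖k - k'‖ := add_le_add e1 e2
    _ ≤ (C1 + C2) * κ ^ 2 * ‖a - a'‖ + (C1 + C2) * κ * ‖k - k'‖ := by gcongr <;> linarith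
    _ = _ := by ring

/-- base map -/
def Base (b : ℂ → G) : Prop := ∀ z w, ‖b z - b w‖ ≤ ‖z - w‖

theorem Base.add {b : ℂ → G} (hb : Base b) (η : X G) {z w : ℂ} (h : ‖z - w‖ ≤ 1) : ‖(b z + η z) - (b w + η w)‖ ≤ (1 + ‖η‖) * √‖z - w‖ := by
  have : ‖z - w‖ ≤ √‖z - w‖ := Real.le_sqrt_of_sq_le (by nlinarith [norm_nonneg (z - w)])
  calc _ = ‖(b z - b w) + (η z - η w)‖ := by congr 1; abel
    _ ≤ _ := norm_add_le _ _
    _ ≤ √‖z - w‖ + ‖η‖ * √‖z - w‖ := add_le_add ((hb z w).trans this) (η.norm_sub_le z w)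
    _ = _ := by ring

theorem comp_bd {q : G → F} (h : Cc q) {b : ℂ → G} (hb : Base b) (η : X G) : ∃ C, Bd (fun z => q (b z + η z)) C := by
  obtain ⟨C0, h0, hC0⟩ := h.bdd
  obtain ⟨C1, h1, hC1⟩ := h.lip
  have := norm_nonneg η
  refine ⟨C0 + C1 * (1 + ‖η‖), fun z => (hC0 _).trans (by nlinarith), fun z w hzw => ?_⟩
  refine (hC1 _ _).trans ?_
  have := hb.add η hzw
  calc C1 * ‖(b z + η z) - (b w + η w)‖ ≤ C1 * ((1 + ‖η‖) * √‖z - w‖) := by gcongr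
    _ ≤ _ := by nlinarith [Real.sqrt_nonneg ‖z - w‖]

/-- composition operator -/
def Cq (q : G → F) (h : Cc q) (b : ℂ → G) (hb : Base b) (η : X G) : X F := X.of (fun z => q (b z + η z)) (comp_bd h hb η)

@[simp] theorem Cq_apply (q : G → F) (h : Cc q) (b : ℂ → G) (hb : Base b) (η : X G) (z : ℂ) : Cq q h b hb η z = q (b z + η z) := rfl

theorem Cq_deriv (q : G → F) (h : Cc q) (b : ℂ → G) (hb : Base b) (η : X G) :
    HasFDerivAt (Cq q h b hb) (X.bil (ContinuousLinearMap.id ℝ (G →L[ℝ] F)) (Cq (fderiv ℝ q) h.fderiv b hb η)) η := by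
  obtain ⟨C, hC0, hC1, hC2⟩ := rem2 h
  rw [hasFDerivAt_iff_isLittleO_nhds_zero]
  refine Asymptotics.IsBigO.trans_isLittleO (g := fun k : X G => ‖k‖ ^ 2) ?_ ?_
  · refine Asymptotics.IsBigO.of_bound (2 * (C * (2 + ‖η‖))) (Eventually.of_forall fun k => ?_)
    have hη := norm_nonneg η
    have hk := norm_nonneg k
    rw [norm_pow, norm_norm]
    have := X.norm_le_of_bd (φ := Cq q h b hb (η + k) - Cq q h b hb η - X.bil (ContinuousLinearMap.id ℝ (G →L[ℝ] F)) (Cq (fderiv ℝ q) h.fderiv b hb η) k)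
      (C := C * (2 + ‖η‖) * ‖k‖ ^ 2) ⟨fun z => ?_, fun z w hzw => ?_⟩
    · linarith
    · have := hC1 (b z + η z) (k z)
      simp only [X.sub_apply, Cq_apply, X.bil_apply, X.add_apply, ← add_assoc]
      refine this.trans ?_
      have := k.norm_apply_le z
      calc C * ‖k z‖ ^ 2 ≤ C * ‖k‖ ^ 2 := by gcongr
        _ ≤ _ := by nlinarith [mul_nonneg hC0 (sq_nonneg ‖k‖), mul_nonneg (mul_nonneg hC0 (sq_nonneg ‖k‖)) hη]
    · have := hC2 (b z + η z) (b w + η w) (k z) (k w) ‖k‖ (k.norm_apply_le z) (k.norm_apply_le w)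
      simp only [X.sub_apply, Cq_apply, X.bil_apply, X.add_apply, ← add_assoc]
      refine this.trans ?_
      have h1 := hb.add η hzw
      have h2 := k.norm_sub_le z w
      calc C * (‖k‖ ^ 2 * ‖(b z + η z) - (b w + η w)‖ + ‖k‖ * ‖k z - k w‖) ≤ C * (‖k‖ ^ 2 * ((1 + ‖η‖) * √‖z - w‖) + ‖k‖ * (‖k‖ * √‖z - w‖)) := by gcongr
        _ = _ := by ring
  · have : (fun k : X G => ‖k‖ ^ 2) =o[𝓝 0] fun k : X G => ‖k‖ ^ 1 := by
      have := Asymptotics.isLittleO_norm_pow_norm_pow (E' := X G) (m := 1) (n := 2) (by norm_num)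
      exact this
    simp only [pow_one] at this
    exact this.of_norm_right

theorem Cq_cd_nat (n : ℕ) : ∀ {F : Type} [NormedAddCommGroup F] [NormedSpace ℝ F] (q : G → F) (h : Cc q) (b : ℂ → G) (hb : Base b), ContDiff ℝ n (Cq q h b hb) := by
  induction n with
  | zero =>
    intro F _ _ q h b hb
    rw [Nat.cast_zero, contDiff_zero, continuous_iff_continuousAt]
    exact fun η => (Cq_deriv q h b hb η).continuousAt
  | succ n ih =>
    intro F _ _ q h b hb
    rw [Nat.cast_succ, contDiff_succ_iff_hasFDerivAt]
    refine ⟨_, ?_, fun η => Cq_deriv q h b hb η⟩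
    exact (X.bil (ContinuousLinearMap.id ℝ (G →L[ℝ] F))).contDiff.comp (ih (fderiv ℝ q) h.fderiv b hb)

theorem Cq_cd (q : G → F) (h : Cc q) (b : ℂ → G) (hb : Base b) : ContDiff ℝ ∞ (Cq q h b hb) :=
  contDiff_infty.2 fun n => Cq_cd_nat n q h b hb

end comp
end JH

namespace JH
open scoped ContDiff

theorem bd_cd {V W : Type} [NormedAddCommGroup V] [NormedSpace ℝ V] [FiniteDimensional ℝ V] [NormedAddCommGroup W] [NormedSpace ℝ W]
    {F : V → W} (hF : ContDiff ℝ 1 F) (φ : X V) : ∃ C, Bd (fun z => F (φ z)) C := by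
  have := FiniteDimensional.proper ℝ V
  obtain ⟨C1, h1⟩ := (isCompact_closedBall (0:V) ‖φ‖).exists_bound_of_continuousOn hF.continuous.continuousOn
  obtain ⟨C2, h2⟩ := (isCompact_closedBall (0:V) ‖φ‖).exists_bound_of_continuousOn (hF.continuous_fderiv (by simp)).continuousOn
  have hm : ∀ z, φ z ∈ closedBall (0:V) ‖φ‖ := fun z => by simpa using φ.norm_apply_le z
  have p1 : 0 ≤ C1 := (norm_nonneg _).trans (h1 _ (hm 0))
  have p2 : 0 ≤ C2 := (norm_nonneg _).trans (h2 _ (hm 0))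
  have := norm_nonneg φ
  refine ⟨C1 + C2 * ‖φ‖, fun z => (h1 _ (hm z)).trans (by nlinarith), fun z w _ => ?_⟩
  have := (convex_closedBall (0:V) ‖φ‖).norm_image_sub_le_of_norm_fderiv_le (𝕜 := ℝ) (fun x _ => hF.differentiable (by simp) x) h2 (hm w) (hm z)
  refine this.trans ?_
  calc C2 * ‖φ z - φ w‖ ≤ C2 * (‖φ‖ * √‖z - w‖) := by gcongr; exact φ.norm_sub_le z w
    _ ≤ _ := by nlinarith [mul_nonneg p1 (Real.sqrt_nonneg ‖z - w‖)]

/-- regularized inverse -/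
def rinv (δ : ℝ) (ζ : ℂ) : ℂ := (Complex.normSq ζ + δ)⁻¹ • (starRingEnd ℂ) ζ

theorem rinv_cd {δ : ℝ} (hδ : 0 < δ) : ContDiff ℝ ∞ (rinv δ) := by
  refine ContDiff.smul (ContDiff.inv (normSq_cd.add contDiff_const) fun x => ?_) Complex.conjCLE.contDiff
  have := Complex.normSq_nonneg x; positivity

theorem rinv_le {δ : ℝ} (hδ : 0 < δ) (ζ : ℂ) : ‖ζ‖ * ‖rinv δ ζ‖ ≤ 1 := by
  have := Complex.normSq_nonneg ζ
  rw [rinv, norm_smul, RCLike.norm_conj, Real.norm_of_nonneg (by positivity), Complex.normSq_eq_norm_sq, mul_left_comm, ← pow_two, inv_mul_le_one₀ (by positivity)]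
  linarith

theorem rinv_rem {δ : ℝ} (hδ : 0 < δ) (ζ : ℂ) : ‖ζ‖ * ‖1 - ζ * rinv δ ζ‖ ≤ √δ := by
  have h := Complex.normSq_nonneg ζ
  have e : 1 - ζ * rinv δ ζ = ((δ / (Complex.normSq ζ + δ) : ℝ) : ℂ) := by
    rw [rinv, mul_smul_comm, Complex.mul_conj, Complex.real_smul, ← Complex.ofReal_mul, ← Complex.ofReal_one, ← Complex.ofReal_sub]
    congr 1
    field_simp; ring
  rw [e, Complex.norm_real, Real.norm_of_nonneg (by positivity), Complex.normSq_eq_norm_sq, ← mul_div_assoc, div_le_iff₀ (by positivity)]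
  have hs := Real.sq_sqrt hδ.le
  have h0 := Real.sqrt_nonneg δ
  nlinarith [mul_nonneg h0 (sq_nonneg (‖ζ‖ - √δ)), mul_nonneg h0 (norm_nonneg ζ), mul_nonneg h0 (sq_nonneg ‖ζ‖), mul_nonneg h0 hδ.le]

/-- multiplication by a field of real-linear maps -/
def mB {V W : Type} [NormedAddCommGroup V] [NormedSpace ℝ V] [NormedAddCommGroup W] [NormedSpace ℝ W] (B : X (V →L[ℝ] W)) : X V →L[ℝ] X W :=
  X.bil (ContinuousLinearMap.id ℝ (V →L[ℝ] W)) B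

@[simp] theorem mB_apply {V W : Type} [NormedAddCommGroup V] [NormedSpace ℝ V] [NormedAddCommGroup W] [NormedSpace ℝ W] (B : X (V →L[ℝ] W)) (φ : X V) (z : ℂ) :
    mB B φ z = B z (φ z) := rfl

theorem apriori (n : ℕ) (B : X (ℂ →L[ℝ] ℂ)) (hB : ∀ z : ℂ, (n:ℝ) < ‖z‖ ^ 2 → B z = 0) {b : ℝ} (hb : ∀ z, ‖B z‖ ≤ b)
    (c : ℂ) (φ ψ : X ℂ) {S : ℝ} (hS : ∀ z, ‖ψ z‖ ≤ S) (he : φ = mB B (X.cst c + T n φ) + ψ) {δ : ℝ} (hδ : 0 < δ) (z : ℂ) :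
    ∃ s : ℂ, ‖s‖ ≤ CT ℂ n * b ∧ ‖(c + T n φ z) * Complex.exp (-s) - c‖ ≤ CT ℂ n * (Real.exp (CT ℂ n * b) * (S + b * √δ)) := by
  have hb0 : 0 ≤ b := (norm_nonneg _).trans (hb 0)
  set ζ : X ℂ := X.cst c + T n φ with hζ
  let σ : X ℂ := X.bil (ContinuousLinearMap.mul ℝ ℂ) (mB B ζ) (X.of (fun z => rinv δ (ζ z)) (bd_cd ((rinv_cd hδ).of_le (by simp)) ζ))
  have hσ : ∀ z, σ z = B z (ζ z) * rinv δ (ζ z) := fun z => rfl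
  have hσn : ∀ z, ‖σ z‖ ≤ b := fun z => by
    rw [hσ, norm_mul]
    have h1 := (B z).le_of_opNorm_le (hb z) (ζ z)
    have h2 := rinv_le hδ (ζ z)
    calc ‖B z (ζ z)‖ * ‖rinv δ (ζ z)‖ ≤ (b * ‖ζ z‖) * ‖rinv δ (ζ z)‖ := by gcongr
      _ = b * (‖ζ z‖ * ‖rinv δ (ζ z)‖) := by ring
      _ ≤ b * 1 := by gcongr
      _ = b := mul_one b
  have hsn := T_bd n σ hσn
  let ex : X ℂ := X.of (fun z => Complex.exp (-(T n σ z))) (bd_cd (F := fun x : ℂ => Complex.exp (-x)) (contDiff_neg.cexp) (T n σ))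
  have hex : ∀ z, ex z = Complex.exp (-(T n σ z)) := fun z => rfl
  have hexn : ∀ z, ‖ex z‖ ≤ Real.exp (CT ℂ n * b) := fun z => by
    rw [hex, Complex.norm_exp]
    refine Real.exp_le_exp.2 ((Complex.re_le_norm _).trans ?_)
    rw [norm_neg]; exact hsn.1 z
  let η : X ℂ := X.bil (ContinuousLinearMap.mul ℝ ℂ) ex (φ - X.bil (ContinuousLinearMap.mul ℝ ℂ) ζ σ)
  have hη : ∀ z, η z = ex z * (φ z - ζ z * σ z) := fun z => rfl
  have hηn : ∀ z, ‖η z‖ ≤ Real.exp (CT ℂ n * b) * (S + b * √δ) := fun z => by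
    rw [hη, norm_mul]
    refine mul_le_mul (hexn z) ?_ (norm_nonneg _) (Real.exp_nonneg _)
    have : φ z - ζ z * σ z = ψ z + B z (ζ z) * (1 - ζ z * rinv δ (ζ z)) := by
      rw [he, hσ]; simp only [X.add_apply, mB_apply]; ring
    rw [this]
    refine (norm_add_le _ _).trans (add_le_add (hS z) ?_)
    rw [norm_mul]
    calc ‖B z (ζ z)‖ * ‖1 - ζ z * rinv δ (ζ z)‖ ≤ (b * ‖ζ z‖) * ‖1 - ζ z * rinv δ (ζ z)‖ := by gcongr; exact (B z).le_of_opNorm_le (hb z) (ζ z)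
      _ = b * (‖ζ z‖ * ‖1 - ζ z * rinv δ (ζ z)‖) := by ring
      _ ≤ b * √δ := by gcongr; exact rinv_rem hδ _
  have hcs : cut n σ = σ := cut_eq n σ fun z hz => by rw [hσ, hB z hz]; simp
  have key : T n η z = ζ z * ex z - c := by
    refine T_unique n η (v := fun z => ζ z * ex z - c)
      (D := fun z => ζ z • (-(ex z) • Dop n σ z) + ex z • Dop n φ z) (fun z => ?_) (fun z => ?_) ?_ z
    · have d1 : HasFDerivAt (fun z => ζ z) (Dop n φ z) z := (T_deriv n φ z).const_add c
      have d2 : HasFDerivAt (fun z => ex z) (-(ex z) • Dop n σ z) z := by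
        have := (T_deriv n σ z).neg.cexp
        have e : (-(ex z) • Dop n σ z) = Complex.exp (-(T n σ z)) • -(Dop n σ z) := by rw [← hex]; ext v; simp
        rw [e]; exact this
      exact (d1.mul d2).sub_const c
    · have a1 := Dop_dbar n φ z
      have a2 := Dop_dbar n σ z
      rw [hcs] at a2
      rw [cut_apply] at a1
      have a3 : chi n z • σ z = σ z := by rw [← cut_apply, hcs]
      rw [cut_apply, hη]
      simp only [add_apply, smul_apply, smul_eq_mul, Complex.real_smul] at a1 a2 a3 ⊢
      linear_combination (ex z) * a1 - ζ z * ex z * a2 + ζ z * ex z * a3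
    · have t1 : Tendsto (fun z => ζ z) (cocompact ℂ) (𝓝 c) := by
        have := (T_tendsto n φ).const_add c; rw [add_zero] at this; exact this
      have t2 : Tendsto (fun z => ex z) (cocompact ℂ) (𝓝 1) := by
        have := (T_tendsto n σ).neg.cexp
        rw [neg_zero, Complex.exp_zero] at this; exact this
      simpa using (t1.mul t2).sub_const c
  refine ⟨T n σ z, hsn.1 z, ?_⟩
  have := (T_bd n η hηn).1 z
  rw [key] at this
  exact this

theorem nonvanish (n : ℕ) (B : X (ℂ →L[ℝ] ℂ)) (hB : ∀ z : ℂ, (n:ℝ) < ‖z‖ ^ 2 → B z = 0)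
    {c : ℂ} (hc : c ≠ 0) (φ : X ℂ) (he : φ = mB B (X.cst c + T n φ)) (z : ℂ) : c + T n φ z ≠ 0 := by
  intro h0
  have hpos : 0 < ‖c‖ := norm_pos_iff.2 hc
  have hCT := CT_nonneg (E := ℂ) n
  set K := CT ℂ n * (Real.exp (CT ℂ n * ‖B‖) * ‖B‖) with hK
  have hK0 : 0 ≤ K := by positivity
  obtain ⟨s, -, h2⟩ := apriori n B hB B.norm_apply_le c φ 0 (S := 0) (by simp) (by simpa using he) (δ := (‖c‖ / (2 * (K + 1))) ^ 2) (by positivity) z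
  rw [h0, zero_mul, zero_sub, norm_neg, Real.sqrt_sq (by positivity), zero_add] at h2
  have : CT ℂ n * (Real.exp (CT ℂ n * ‖B‖) * (‖B‖ * (‖c‖ / (2 * (K + 1))))) = K * ‖c‖ / (2 * (K + 1)) := by rw [hK]; ring
  rw [this, le_div_iff₀ (by positivity)] at h2
  nlinarith

theorem sup_est (n : ℕ) (B : X (ℂ →L[ℝ] ℂ)) (hB : ∀ z : ℂ, (n:ℝ) < ‖z‖ ^ 2 → B z = 0) {b : ℝ} (hb : ∀ z, ‖B z‖ ≤ b)
    (φ ψ : X ℂ) {S : ℝ} (hS : ∀ z, ‖ψ z‖ ≤ S) (he : φ = mB B (T n φ) + ψ) (z : ℂ) :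
    ‖T n φ z‖ ≤ Real.exp (CT ℂ n * b) * (CT ℂ n * (Real.exp (CT ℂ n * b) * S)) := by
  have hb0 : 0 ≤ b := (norm_nonneg _).trans (hb 0)
  have hCT := CT_nonneg (E := ℂ) n
  have key : ∀ δ > 0, ‖T n φ z‖ ≤ Real.exp (CT ℂ n * b) * (CT ℂ n * (Real.exp (CT ℂ n * b) * (S + b * √δ))) := by
    intro δ hδ
    obtain ⟨s, h1, h2⟩ := apriori n B hB hb 0 φ ψ hS (by simpa using he) hδ z
    rw [zero_add, sub_zero, norm_mul] at h2
    have h3 : 1 ≤ Real.exp (CT ℂ n * b) * ‖Complex.exp (-s)‖ := by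
      rw [Complex.norm_exp, ← Real.exp_add]
      refine Real.one_le_exp ?_
      have := Complex.re_le_norm s
      simp; linarith
    calc ‖T n φ z‖ ≤ ‖T n φ z‖ * (Real.exp (CT ℂ n * b) * ‖Complex.exp (-s)‖) := le_mul_of_one_le_right (norm_nonneg _) h3
      _ = Real.exp (CT ℂ n * b) * (‖T n φ z‖ * ‖Complex.exp (-s)‖) := by ring
      _ ≤ _ := by gcongr
  have hlim : Tendsto (fun δ : ℝ => Real.exp (CT ℂ n * b) * (CT ℂ n * (Real.exp (CT ℂ n * b) * (S + b * √δ)))) (𝓝[>] 0)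
      (𝓝 (Real.exp (CT ℂ n * b) * (CT ℂ n * (Real.exp (CT ℂ n * b) * (S + b * √0))))) := by
    refine Tendsto.mono_left (Continuous.tendsto ?_ 0) nhdsWithin_le_nhds
    fun_prop
  have := ge_of_tendsto hlim (eventually_mem_nhdsWithin.mono key)
  simpa using this

theorem scalar_est (n : ℕ) (B : X (ℂ →L[ℝ] ℂ)) (hB : ∀ z : ℂ, (n:ℝ) < ‖z‖ ^ 2 → B z = 0) :
    ∃ K, 0 < K ∧ ∀ u : ℝ, u ∈ Icc (0:ℝ) 1 → ∀ φ, ‖φ‖ ≤ K * ‖φ - u • mB B (T n φ)‖ := by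
  have hCT := CT_nonneg (E := ℂ) n
  set Q := Real.exp (CT ℂ n * ‖B‖) * (CT ℂ n * Real.exp (CT ℂ n * ‖B‖)) with hQ
  have hQ0 : 0 ≤ Q := by positivity
  refine ⟨‖(mB B : X ℂ →L[ℝ] X ℂ)‖ * (2 * (CT ℂ n * (‖B‖ * Q + 1))) + 1, by positivity, fun u hu φ => ?_⟩
  set ψ := φ - u • mB B (T n φ) with hψ
  have hun : ‖u‖ ≤ 1 := by rw [Real.norm_of_nonneg hu.1]; exact hu.2
  have he : φ = mB (u • B) (T n φ) + ψ := by rw [hψ]; ext z; simp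
  have hub : ∀ z, ‖(u • B) z‖ ≤ ‖B‖ := fun z => by
    rw [X.smul_apply, norm_smul]
    exact (mul_le_of_le_one_left (norm_nonneg _) hun).trans (B.norm_apply_le z)
  have h1 := sup_est n (u • B) (fun z hz => by rw [X.smul_apply, hB z hz, smul_zero]) hub φ ψ ψ.norm_apply_le he
  have h2 : ∀ z, ‖φ z‖ ≤ (‖B‖ * Q + 1) * ‖ψ‖ := fun z => by
    have : φ z = (u • B) z (T n φ z) + ψ z := by conv_lhs => rw [he]
                                                 rfl
    rw [this]
    refine (norm_add_le _ _).trans ?_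
    have a := ((u • B) z).le_of_opNorm_le (hub z) (T n φ z)
    have b := ψ.norm_apply_le z
    have c := mul_le_mul_of_nonneg_left (h1 z) (norm_nonneg B)
    calc _ ≤ ‖B‖ * ‖T n φ z‖ + ‖ψ‖ := add_le_add a b
      _ ≤ _ := add_le_add c le_rfl
      _ = _ := by rw [hQ]; ring
  have h3 := X.norm_le_of_bd (T_bd n φ h2)
  have h4 : ‖φ‖ ≤ ‖u • mB B (T n φ)‖ + ‖ψ‖ := by
    have : φ = u • mB B (T n φ) + ψ := by rw [hψ]; abel
    calc ‖φ‖ = ‖u • mB B (T n φ) + ψ‖ := by rw [← this]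
      _ ≤ _ := norm_add_le _ _
  have h5 : ‖u • mB B (T n φ)‖ ≤ ‖(mB B : X ℂ →L[ℝ] X ℂ)‖ * ‖T n φ‖ := by
    rw [norm_smul]
    exact (mul_le_of_le_one_left (norm_nonneg _) hun).trans ((mB B).le_opNorm _)
  calc ‖φ‖ ≤ ‖(mB B : X ℂ →L[ℝ] X ℂ)‖ * ‖T n φ‖ + ‖ψ‖ := h4.trans (add_le_add h5 le_rfl)
    _ ≤ ‖(mB B : X ℂ →L[ℝ] X ℂ)‖ * (2 * (CT ℂ n * ((‖B‖ * Q + 1) * ‖ψ‖))) + ‖ψ‖ := by gcongr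
    _ = _ := by ring

instance : Nontrivial (X ℂ) := ⟨⟨X.cst 1, 0, fun h => by simpa using congrArg (fun φ : X ℂ => φ 0) h⟩⟩

theorem scalar_unit (n : ℕ) (B : X (ℂ →L[ℝ] ℂ)) (hB : ∀ z : ℂ, (n:ℝ) < ‖z‖ ^ 2 → B z = 0) :
    IsUnit (1 - mB B ∘L T n : X ℂ →L[ℝ] X ℂ) := by
  obtain ⟨K, hK, hest⟩ := scalar_est n B hB
  set A : X ℂ →L[ℝ] X ℂ := mB B ∘L T n with hA
  obtain ⟨N, hN⟩ := exists_nat_gt (K * ‖A‖)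
  have hNp : (0:ℝ) < N := lt_of_le_of_lt (by positivity) hN
  have key : ∀ k : ℕ, k ≤ N → IsUnit (1 - ((k:ℝ) / N) • A) := by
    intro k
    induction k with
    | zero => intro _; simp
    | succ k ih =>
      intro hk
      obtain ⟨x, hx⟩ := ih (by omega)
      have hinv : ‖(↑x⁻¹ : X ℂ →L[ℝ] X ℂ)‖ ≤ K := by
        refine ContinuousLinearMap.opNorm_le_bound _ hK.le fun ψ => ?_
        have := hest ((k:ℝ) / N) ⟨by positivity, by rw [div_le_one hNp]; exact_mod_cast (by omega : k ≤ N)⟩ ((↑x⁻¹ : X ℂ →L[ℝ] X ℂ) ψ)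
        have e : (x : X ℂ →L[ℝ] X ℂ) ((↑x⁻¹ : X ℂ →L[ℝ] X ℂ) ψ) = ψ := by
          rw [← ContinuousLinearMap.mul_apply, Units.mul_inv]; rfl
        rw [hx] at e
        refine this.trans (le_of_eq ?_)
        congr 2
      have hpos : 0 < ‖(↑x⁻¹ : X ℂ →L[ℝ] X ℂ)‖ := norm_pos_iff.2 x⁻¹.ne_zero
      refine ⟨x.ofNearby (1 - (((k + 1 : ℕ):ℝ) / N) • A) ?_, rfl⟩
      rw [hx]
      have : (1 - (((k + 1 : ℕ):ℝ) / N) • A) - (1 - ((k:ℝ) / N) • A) = -((N:ℝ)⁻¹ • A) := by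
        rw [sub_sub_sub_cancel_left, ← sub_smul, ← neg_smul]
        congr 1; push_cast; field_simp; ring
      rw [this, norm_neg, norm_smul, Real.norm_of_nonneg (by positivity)]
      have : K⁻¹ ≤ ‖(↑x⁻¹ : X ℂ →L[ℝ] X ℂ)‖⁻¹ := inv_anti₀ hpos hinv
      refine lt_of_lt_of_le ?_ this
      rw [inv_mul_lt_iff₀ hNp, ← div_eq_mul_inv, lt_div_iff₀ hK]
      linarith
  have := key N le_rfl
  rwa [div_self hNp.ne', one_smul] at this

end JH

namespace JH
open scoped ContDiff

theorem ift {A B : Type} [NormedAddCommGroup A] [NormedSpace ℝ A] [CompleteSpace A] [NormedAddCommGroup B] [NormedSpace ℝ B]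
    {H : A → B} {U : Set A} (hU : IsOpen U) (hH : ContDiffOn ℝ ∞ H U) {a : A} (ha : a ∈ U) {e : A ≃L[ℝ] B} (he : HasFDerivAt H (e : A →L[ℝ] B) a) :
    ∃ g : B → A, (∀ᶠ y in 𝓝 (H a), ContDiffAt ℝ ∞ g y ∧ H (g y) = y) ∧ (∀ᶠ x in 𝓝 a, g (H x) = x) ∧ g (H a) = a := by
  have hc : ∀ x ∈ U, ContDiffAt ℝ ∞ H x := fun x hx => hH.contDiffAt (hU.mem_nhds hx)
  let Φ := (hc a ha).toOpenPartialHomeomorph H he (by simp)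
  have ha' : a ∈ Φ.source := (hc a ha).mem_toOpenPartialHomeomorph_source he (by simp)
  have hcoe : (Φ : A → B) = H := (hc a ha).toOpenPartialHomeomorph_coe he (by simp)
  have hHa : H a ∈ Φ.target := by rw [← hcoe]; exact Φ.map_source ha'
  have hs : Φ.symm (H a) = a := by
    have := Φ.left_inv ha'
    rwa [hcoe] at this
  refine ⟨Φ.symm, ?_, ?_, hs⟩
  · have hct : ContinuousAt Φ.symm (H a) := Φ.continuousAt_symm hHa
    have hinv : ∀ᶠ x in 𝓝 a, x ∈ U ∧ ∃ e' : A ≃L[ℝ] B, (e' : A →L[ℝ] B) = fderiv ℝ H x := by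
      have h1 : ContinuousAt (fderiv ℝ H) a := ((hc a ha).fderiv_right (m := 0) (by simp)).continuousAt
      have h2 := h1.eventually (by rw [he.fderiv]; exact ContinuousLinearEquiv.nhds e)
      filter_upwards [h2, hU.mem_nhds ha] with x hx hx'
      exact ⟨hx', hx⟩
    have := hct.eventually (by rw [hs]; exact hinv)
    filter_upwards [this, Φ.open_target.mem_nhds hHa] with y hy hy'
    obtain ⟨hyU, e', he'⟩ := hy
    have hd : HasFDerivAt H (e' : A →L[ℝ] B) (Φ.symm y) := by
      rw [he']; exact ((hc _ hyU).differentiableAt (by simp)).hasFDerivAt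
    refine ⟨Φ.contDiffAt_symm hy' (f₀' := e') (by rw [hcoe]; exact hd) (by rw [hcoe]; exact hc _ hyU), ?_⟩
    have := Φ.right_inv hy'
    rwa [hcoe] at this
  · filter_upwards [Φ.open_source.mem_nhds ha'] with x hx
    have := Φ.left_inv hx
    rwa [hcoe] at this

section post
variable {E F : Type} [NormedAddCommGroup E] [NormedSpace ℝ E] [NormedSpace ℂ E] [IsScalarTower ℝ ℂ E] [CompleteSpace E]
  [NormedAddCommGroup F] [NormedSpace ℝ F] [NormedSpace ℂ F] [IsScalarTower ℝ ℂ F] [CompleteSpace F]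

theorem T_post (n : ℕ) (L : E →L[ℝ] F) (hL : ∀ v, L (Complex.I • v) = Complex.I • L v) (φ : X E) : T n (X.post L φ) = X.post L (T n φ) := by
  ext z
  refine T_unique n _ (D := fun z => L ∘L (Dop n φ z)) (fun z => ?_) (fun z => ?_) ?_ z
  · exact L.hasFDerivAt.comp z (T_deriv n φ z)
  · have := congrArg L (Dop_dbar n φ z)
    simpa [hL] using this
  · have := (L.continuous.tendsto 0).comp (T_tendsto n φ)
    rwa [map_zero] at this
end post

/-- target -/
abbrev V2 := ℂ × ℂ

theorem base0 : Base (fun z : ℂ => ((z, 0) : ℂ × V2)) := fun z w => by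
  simp [Prod.norm_def]

/-- the affine part -/
def eta (n : ℕ) : (ℂ × ℂ) × X V2 →L[ℝ] X (ℂ × V2) :=
  (X.post (ContinuousLinearMap.inl ℝ ℂ V2)) ∘L X.cst ∘L (ContinuousLinearMap.fst ℝ ℂ ℂ) ∘L (ContinuousLinearMap.fst ℝ (ℂ × ℂ) (X V2))
  + (X.post (ContinuousLinearMap.inr ℝ ℂ V2)) ∘L
    (X.cst ∘L (ContinuousLinearMap.inr ℝ ℂ ℂ) ∘L (ContinuousLinearMap.snd ℝ ℂ ℂ) ∘L (ContinuousLinearMap.fst ℝ (ℂ × ℂ) (X V2))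
     + T n ∘L (ContinuousLinearMap.snd ℝ (ℂ × ℂ) (X V2)))

theorem eta_apply (n : ℕ) (h x : ℂ) (φ : X V2) (z : ℂ) : eta n ((h, x), φ) z = (h, (0, x) + T n φ z) := by
  simp [eta]

structure Dat where
  M : ℂ × V2 → (V2 →L[ℝ] V2)
  b : ℂ × V2 → V2
  hM : Cc M
  hb : Cc b
  M0 : ∀ z, M (z, 0) = 0
  b0 : ∀ z, b (z, 0) = 0
  b1 : ∀ z c, fderiv ℝ b (z, 0) (0, (c, 0)) = 0
  r : ℝ
  hr : 0 < r
  Ms : ∀ z ζ, r < ‖z‖ → M (z, ζ) = 0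
  bs : ∀ z ζ, r < ‖z‖ → b (z, ζ) = 0

namespace Dat
variable (d : Dat)

/-- size -/
def n : ℕ := ⌈4 * d.r ^ 2⌉₊

theorem n_le : 4 * d.r ^ 2 ≤ d.n := Nat.le_ceil _

theorem cut_of (φ : X V2) (h : ∀ z : ℂ, 2 * d.r < ‖z‖ → φ z = 0) : cut d.n φ = φ := by
  refine cut_eq _ _ fun z hz => h z ?_
  have := d.n_le
  have hr := d.hr
  by_contra hc
  push Not at hc
  nlinarith [norm_nonneg z]

/-- the nonlinear map -/
def F (p : (ℂ × ℂ) × X V2) : X V2 :=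
  p.2 - mB (Cq d.M d.hM _ base0 (eta d.n p)) (P d.n p.2) - Cq d.b d.hb _ base0 (eta d.n p)

theorem F_apply (h x : ℂ) (φ : X V2) (z : ℂ) :
    d.F ((h, x), φ) z = φ z - d.M (z + h, (0, x) + T d.n φ z) (P d.n φ z) - d.b (z + h, (0, x) + T d.n φ z) := by
  simp [F, eta_apply]

theorem F_cd : ContDiff ℝ ∞ d.F := by
  have h1 := (Cq_cd d.M d.hM _ base0).comp (eta d.n).contDiff
  have h2 := (Cq_cd d.b d.hb _ base0).comp (eta d.n).contDiff
  have h3 : ContDiff ℝ ∞ (fun p : (ℂ × ℂ) × X V2 => P d.n p.2) := (P d.n).contDiff.comp contDiff_snd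
  have h4 : ContDiff ℝ ∞ (fun p : (ℂ × ℂ) × X V2 => mB (Cq d.M d.hM _ base0 (eta d.n p)) (P d.n p.2)) :=
    ((X.bil (ContinuousLinearMap.id ℝ (V2 →L[ℝ] V2))).contDiff.comp h1).clm_apply h3
  exact (contDiff_snd.sub h4).sub h2

/-- derivative coefficient of b along zero section -/
def db (h : ℂ) : X (ℂ × V2 →L[ℝ] V2) := Cq (fderiv ℝ d.b) d.hb.fderiv _ base0 (eta d.n ((h, 0), 0))

theorem db_apply (h z : ℂ) : d.db h z = fderiv ℝ d.b (z + h, 0) := by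
  simp [db, eta_apply]; rfl

theorem F_deriv (h : ℂ) : HasFDerivAt d.F (ContinuousLinearMap.snd ℝ (ℂ × ℂ) (X V2) - mB (d.db h) ∘L eta d.n) ((h, 0), 0) := by
  have h1 : HasFDerivAt (fun p => Cq d.M d.hM _ base0 (eta d.n p)) _ ((h, 0), 0) := (Cq_deriv d.M d.hM _ base0 _).comp _ (eta d.n).hasFDerivAt
  have h2 : HasFDerivAt (fun p => Cq d.b d.hb _ base0 (eta d.n p)) _ ((h, 0), 0) := (Cq_deriv d.b d.hb _ base0 _).comp _ (eta d.n).hasFDerivAt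
  have h3 : HasFDerivAt (fun p : (ℂ × ℂ) × X V2 => P d.n p.2) (P d.n ∘L ContinuousLinearMap.snd ℝ (ℂ × ℂ) (X V2)) ((h, 0), 0) :=
    (P d.n).hasFDerivAt.comp _ hasFDerivAt_snd
  have h4 := ((X.bil (ContinuousLinearMap.id ℝ (V2 →L[ℝ] V2))).hasFDerivAt_of_bilinear h1 h3)
  have h5 := ((hasFDerivAt_snd (𝕜 := ℝ) (p := (((h, 0), 0) : (ℂ × ℂ) × X V2))).sub h4).sub h2
  refine h5.congr_fderiv ?_
  have e : Cq d.M d.hM _ base0 (eta d.n ((h, 0), 0)) = 0 := by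
    ext1 z; simp [eta_apply]; exact d.M0 _
  refine ContinuousLinearMap.ext fun p => X.ext fun z => ?_
  simp [ContinuousLinearMap.precompR_apply, e, eta_apply, db, mB]

/-- component of beta -/
def β (h : ℂ) (L : V2 →L[ℝ] ℂ) : X (ℂ →L[ℝ] ℂ) :=
  X.post (((ContinuousLinearMap.compL ℝ ℂ (ℂ × V2) ℂ).flip ((ContinuousLinearMap.inr ℝ ℂ V2) ∘L (ContinuousLinearMap.inr ℝ ℂ ℂ))) ∘L
    (ContinuousLinearMap.compL ℝ (ℂ × V2) V2 ℂ L)) (d.db h)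

theorem β_apply (h : ℂ) (L : V2 →L[ℝ] ℂ) (z c : ℂ) : d.β h L z c = L (d.db h z (0, (0, c))) := by
  simp [β]

theorem db_supp (h z : ℂ) (hz : d.r < ‖z + h‖) : d.db h z = 0 := by
  rw [db_apply]
  have : d.b =ᶠ[𝓝 (z + h, (0:V2))] fun _ => 0 := by
    have ho : IsOpen {p : ℂ × V2 | d.r < ‖p.1‖} := isOpen_lt continuous_const (by fun_prop)
    filter_upwards [ho.mem_nhds hz] with p hp using d.bs _ _ hp
  rw [this.fderiv_eq]; simp

theorem db_h (h z k : ℂ) : d.db h z (k, 0) = 0 := by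
  rw [db_apply]
  have h1 : HasFDerivAt (fun w : ℂ => d.b (w, 0)) (fderiv ℝ d.b (z + h, 0) ∘L ContinuousLinearMap.inl ℝ ℂ V2) (z + h) :=
    ((d.hb.diff (z + h, 0)).hasFDerivAt).comp (z + h) (hasFDerivAt_prodMk_left (z + h) (0:V2))
  have h2 : (fun w : ℂ => d.b (w, 0)) = fun _ => 0 := funext d.b0
  rw [h2] at h1
  have := h1.unique (hasFDerivAt_const _ _)
  simpa using congrArg (fun L => L k) this

theorem db_eq (h z k : ℂ) (v : V2) : d.db h z (k, v) = d.db h z (0, (0, v.2)) := by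
  have : ((k, v) : ℂ × V2) = (k, 0) + (0, (v.1, 0)) + (0, (0, v.2)) := by simp
  rw [this, map_add, map_add, d.db_h, db_apply, d.b1]; simp

theorem Tsnd (φ : X V2) : T d.n (X.post (ContinuousLinearMap.snd ℝ ℂ ℂ) φ) = X.post (ContinuousLinearMap.snd ℝ ℂ ℂ) (T d.n φ) :=
  T_post _ _ (fun _ => rfl) _

theorem β_supp {h : ℂ} (hh : ‖h‖ ≤ d.r) (L : V2 →L[ℝ] ℂ) (z : ℂ) (hz : (d.n : ℝ) < ‖z‖ ^ 2) : d.β h L z = 0 := by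
  ext1 c
  rw [β_apply, db_supp, ]
  · simp
  · have h1 := d.n_le
    have h2 := d.hr
    have : 2 * d.r < ‖z‖ := by nlinarith [norm_nonneg z]
    have h3 : ‖z‖ ≤ ‖z + h‖ + ‖h‖ := by simpa using norm_sub_le (z + h) h
    linarith

theorem equiv {h : ℂ} (hh : ‖h‖ ≤ d.r) : ∃ e : X V2 ≃L[ℝ] X V2, ∀ φ, e φ = φ - mB (d.db h) (eta d.n ((0, 0), φ)) := by
  let A : X V2 →L[ℝ] X V2 := 1 - mB (d.db h) ∘L eta d.n ∘L ContinuousLinearMap.inr ℝ (ℂ × ℂ) (X V2)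
  have hA : ∀ φ, A φ = φ - mB (d.db h) (eta d.n ((0, 0), φ)) := fun φ => rfl
  have hA' : ∀ φ z, A φ z = φ z - d.db h z (0, (0, T d.n (X.post (ContinuousLinearMap.snd ℝ ℂ ℂ) φ) z)) := fun φ z => by
    rw [hA, Tsnd]; simp only [X.sub_apply, mB_apply, eta_apply]; rw [db_eq]; simp
  let S := ContinuousLinearMap.snd ℝ ℂ ℂ
  have hu := scalar_unit d.n (d.β h S) (d.β_supp hh S)
  obtain ⟨u, hu⟩ := hu
  have huu : ∀ φ z, (u : X ℂ →L[ℝ] X ℂ) φ z = φ z - (d.db h z (0, (0, T d.n φ z))).2 := fun φ z => by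
    rw [hu]
    change φ z - (d.β h S) z (T d.n φ z) = _
    rw [β_apply]; rfl
  have hAs : ∀ φ, X.post S (A φ) = (u : X ℂ →L[ℝ] X ℂ) (X.post S φ) := fun φ => by
    ext z; rw [huu, X.post_apply, hA']; rfl
  have ui : ∀ φ, (↑u⁻¹ : X ℂ →L[ℝ] X ℂ) ((u : X ℂ →L[ℝ] X ℂ) φ) = φ := fun φ => by
    rw [← ContinuousLinearMap.mul_apply, Units.inv_mul]; rfl
  have iu : ∀ φ, (u : X ℂ →L[ℝ] X ℂ) ((↑u⁻¹ : X ℂ →L[ℝ] X ℂ) φ) = φ := fun φ => by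
    rw [← ContinuousLinearMap.mul_apply, Units.mul_inv]; rfl
  have inj : LinearMap.ker (A : X V2 →ₗ[ℝ] X V2) = ⊥ := by
    rw [LinearMap.ker_eq_bot']
    intro φ h0
    change A φ = 0 at h0
    have h1 := hAs φ
    rw [h0, map_zero] at h1
    have h2 : X.post S φ = 0 := by rw [← ui (X.post S φ), ← h1, map_zero]
    ext1 z
    have := hA' φ z
    rw [h0, h2] at this
    have e0 : d.db h z (0, (0, (0 : X ℂ) z)) = 0 := map_zero _
    rw [map_zero, e0, sub_zero] at this
    exact this.symm
  have surj : LinearMap.range (A : X V2 →ₗ[ℝ] X V2) = ⊤ := by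
    rw [LinearMap.range_eq_top]
    intro ψ
    let φ2 := (↑u⁻¹ : X ℂ →L[ℝ] X ℂ) (X.post S ψ)
    let φ := ψ + mB (d.db h) (eta d.n ((0,0), X.post (ContinuousLinearMap.inr ℝ ℂ ℂ) φ2))
    have hφ : ∀ z, φ z = ψ z + d.db h z (0, (0, T d.n φ2 z)) := fun z => by
      change ψ z + d.db h z (eta d.n ((0,0), X.post (ContinuousLinearMap.inr ℝ ℂ ℂ) φ2) z) = _
      rw [eta_apply, db_eq, T_post _ _ (fun v => by simp)]; simp
    have h2 : X.post S φ = φ2 := by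
      ext1 z
      have h3 := huu φ2 z
      rw [iu] at h3
      rw [X.post_apply, hφ]
      change (ψ z).2 + (d.db h z (0, (0, T d.n φ2 z))).2 = _
      have h4 : X.post S ψ z = (ψ z).2 := rfl
      rw [h4] at h3
      rw [h3]; ring
    refine ⟨φ, X.ext fun z => ?_⟩
    change A φ z = _
    rw [hA', h2, hφ]; abel
  exact ⟨ContinuousLinearEquiv.ofBijective A inj surj, fun φ => hA φ⟩

theorem loc {h : ℂ} (hh : ‖h‖ ≤ d.r) : ∃ g : ℂ × ℂ → X V2, (∀ᶠ p in 𝓝 (h, (0:ℂ)), ContDiffAt ℝ ∞ g p ∧ d.F (p, g p) = 0) ∧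
    (∀ᶠ q in 𝓝 ((h, (0:ℂ)), (0 : X V2)), d.F q = 0 → q.2 = g q.1) ∧ g (h, 0) = 0 := by
  obtain ⟨e, he⟩ := d.equiv hh
  let H : (ℂ × ℂ) × X V2 → (ℂ × ℂ) × X V2 := fun q => (q.1, d.F q)
  have hH : ContDiff ℝ ∞ H := contDiff_fst.prodMk d.F_cd
  have hF0 : d.F ((h, 0), 0) = 0 := by
    ext1 z; rw [F_apply]; simp; exact d.b0 _
  have hH0 : H ((h, 0), 0) = ((h, 0), 0) := by simp [H, hF0]
  let L : (ℂ × ℂ) × X V2 →L[ℝ] (ℂ × ℂ) × X V2 := (ContinuousLinearMap.fst ℝ (ℂ × ℂ) (X V2)).prod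
    (ContinuousLinearMap.snd ℝ (ℂ × ℂ) (X V2) - mB (d.db h) ∘L eta d.n)
  have hL : HasFDerivAt H L ((h, 0), 0) := hasFDerivAt_fst.prodMk (d.F_deriv h)
  have hLe : ∀ p φ, L (p, φ) = (p, e φ - mB (d.db h) (eta d.n (p, 0))) := fun p φ => by
    have : eta d.n (p, φ) = eta d.n (0, φ) + eta d.n (p, 0) := by rw [← map_add]; simp
    change (p, φ - mB (d.db h) (eta d.n (p, φ))) = _
    rw [this, map_add, ← sub_sub, he]; rfl
  have inj : LinearMap.ker (L : (ℂ × ℂ) × X V2 →ₗ[ℝ] (ℂ × ℂ) × X V2) = ⊥ := by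
    rw [LinearMap.ker_eq_bot']
    rintro ⟨p, φ⟩ h0
    change L (p, φ) = 0 at h0
    rw [hLe] at h0
    obtain ⟨h1, h2⟩ := Prod.mk.inj h0
    change p = 0 at h1
    subst h1
    have : e φ = 0 := by
      have e0 : eta d.n ((0 : ℂ × ℂ), (0 : X V2)) = 0 := map_zero _
      rw [e0, map_zero, sub_zero] at h2; exact h2
    rw [e.map_eq_zero_iff.1 this]; rfl
  have surj : LinearMap.range (L : (ℂ × ℂ) × X V2 →ₗ[ℝ] (ℂ × ℂ) × X V2) = ⊤ := by
    rw [LinearMap.range_eq_top]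
    rintro ⟨p, ψ⟩
    refine ⟨(p, e.symm (ψ + mB (d.db h) (eta d.n (p, 0)))), ?_⟩
    change L _ = _
    rw [hLe]; simp
  obtain ⟨g, g1, g2, g3⟩ := ift isOpen_univ hH.contDiffOn (mem_univ ((h, (0:ℂ)), (0 : X V2)))
    (e := ContinuousLinearEquiv.ofBijective L inj surj) hL
  rw [hH0] at g1 g3
  have hcp : ContDiff ℝ ∞ (fun p : ℂ × ℂ => (p, (0 : X V2))) := contDiff_id.prodMk contDiff_const
  refine ⟨fun p => (g (p, 0)).2, ?_, ?_, ?_⟩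
  · have := (hcp.continuous.tendsto (h, 0)).eventually g1
    filter_upwards [this] with p hp
    refine ⟨contDiffAt_snd.comp p (hp.1.comp p hcp.contDiffAt), ?_⟩
    have h1 : (g (p, 0)).1 = p := congrArg Prod.fst hp.2
    have h2 : d.F (g (p, 0)) = 0 := congrArg Prod.snd hp.2
    have h3 : (p, (g (p, 0)).2) = g (p, 0) := Prod.ext h1.symm rfl
    change d.F (p, (g (p, 0)).2) = 0
    rw [h3, h2]
  · filter_upwards [g2] with q hq hq0
    have : H q = (q.1, 0) := by simp [H, hq0]
    rw [this] at hq
    rw [hq]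
  · change (g ((h, 0), 0)).2 = 0
    rw [g3]

theorem supp_of {x : ℂ} {φ : X V2} (h : d.F ((0, x), φ) = 0) (z : ℂ) (hz : d.r < ‖z‖) : φ z = 0 := by
  have := congrArg (fun ψ : X V2 => ψ z) h
  simp only [F_apply, d.Ms (z + 0) _ (by simpa using hz), d.bs (z + 0) _ (by simpa using hz)] at this
  simpa using this

theorem cut_tau {x : ℂ} {φ : X V2} (hF : d.F ((0, x), φ) = 0) {h : ℂ} (hh : ‖h‖ ≤ d.r) : cut d.n (X.tau h φ) = X.tau h φ := by
  refine d.cut_of _ fun z hz => d.supp_of hF _ ?_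
  have h3 : ‖z‖ ≤ ‖z + h‖ + ‖h‖ := by simpa using norm_sub_le (z + h) h
  linarith

theorem cut0 {x : ℂ} {φ : X V2} (hF : d.F ((0, x), φ) = 0) : cut d.n φ = φ := by
  refine d.cut_of _ fun z hz => d.supp_of hF _ ?_
  linarith [d.hr]

theorem F_tau {x : ℂ} {φ : X V2} (hF : d.F ((0, x), φ) = 0) {h : ℂ} (hh : ‖h‖ ≤ d.r) : d.F ((h, x), X.tau h φ) = 0 := by
  ext1 z
  have := congrArg (fun ψ : X V2 => ψ (z + h)) hF
  rw [F_apply, T_tau _ _ _ (d.cut0 hF) (d.cut_tau hF hh), P_tau _ _ _ (d.cut0 hF) (d.cut_tau hF hh)]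
  simp only [F_apply, add_zero] at this
  exact this

theorem exist {ρ : ℝ} (hρ : 0 < ρ) : ∃ (δ : ℝ) (Z : ℂ × ℂ → V2), 0 < δ ∧
    (∀ z x, ‖z‖ < d.r → ‖x‖ < δ → ContDiffAt ℝ ∞ Z (z, x) ∧ ‖Z (z, x)‖ < ρ ∧
      ∃ D : ℂ →L[ℝ] V2, HasFDerivAt (fun z => Z (z, x)) D z ∧ D 1 + Complex.I • D Complex.I = d.M (z, Z (z, x)) (D Complex.I) + d.b (z, Z (z, x))) ∧
    (∀ z, Z (z, 0) = 0) ∧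
    (∀ z, ‖z‖ < d.r → ∃ D : ℂ →L[ℝ] V2, HasFDerivAt (fun x => Z (z, x)) D 0 ∧ ∀ v, v ≠ 0 → (D v).2 ≠ 0) := by
  obtain ⟨g, g1, g2, g3⟩ := d.loc (h := 0) (by simpa using d.hr.le)
  let φ : ℂ → X V2 := fun x => g (0, x)
  have hφ0 : φ 0 = 0 := g3
  have hcp : ContDiff ℝ ∞ (fun x : ℂ => ((0:ℂ), x)) := contDiff_const.prodMk contDiff_id
  have e1 : ∀ᶠ x in 𝓝 (0:ℂ), ContDiffAt ℝ ∞ φ x ∧ d.F ((0, x), φ x) = 0 := by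
    filter_upwards [(hcp.continuous.tendsto 0).eventually g1] with x hx
    exact ⟨hx.1.comp x hcp.contDiffAt, hx.2⟩
  have hφd : ContDiffAt ℝ ∞ φ 0 := e1.self_of_nhds.1
  have hφt : Tendsto φ (𝓝 0) (𝓝 0) := by
    have := hφd.continuousAt.tendsto
    rwa [hφ0] at this
  -- joint smoothness
  have key : ∀ h ∈ closedBall (0:ℂ) d.r, ∀ᶠ q in 𝓝 ((0:ℂ), h),
      ‖q.2‖ < d.r → ContDiffAt ℝ ∞ (fun p : ℂ × ℂ => X.tau p.1 (φ p.2)) (q.2, q.1) := by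
    intro h hh
    obtain ⟨g', k1, k2, k3⟩ := d.loc (h := h) (by simpa using hh)
    have t1 : Tendsto (fun p : ℂ × ℂ => (p, X.tau p.1 (φ p.2))) (𝓝 (h, 0)) (𝓝 ((h, 0), 0)) := by
      refine tendsto_id.prodMk_nhds ?_
      rw [tendsto_zero_iff_norm_tendsto_zero]
      simp only [X.norm_tau]
      have : Tendsto (fun p : ℂ × ℂ => φ p.2) (𝓝 (h, 0)) (𝓝 0) := hφt.comp (continuous_snd.tendsto (h, (0:ℂ)))
      exact tendsto_zero_iff_norm_tendsto_zero.1 this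
    have e2 := (t1.eventually k2).and (k1.and ((continuous_snd.tendsto (h, (0:ℂ))).eventually e1))
    have e3 : ∀ᶠ p in 𝓝 (h, (0:ℂ)), ‖p.1‖ < d.r → ContDiffAt ℝ ∞ (fun p : ℂ × ℂ => X.tau p.1 (φ p.2)) p := by
      filter_upwards [e2.eventually_nhds] with p hp hpr
      refine hp.self_of_nhds.2.1.1.congr_of_eventuallyEq ?_
      have ho : IsOpen {p : ℂ × ℂ | ‖p.1‖ < d.r} := isOpen_lt (by fun_prop) continuous_const
      filter_upwards [hp, ho.mem_nhds hpr] with p' hp' hpr'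
      exact hp'.1 (d.F_tau hp'.2.2.2 (le_of_lt hpr'))
    exact (continuous_swap.tendsto ((0:ℂ), h)).eventually e3
  have key2 := (isCompact_closedBall (0:ℂ) d.r).eventually_forall_of_forall_eventually
    (P := fun x h => ‖h‖ < d.r → ContDiffAt ℝ ∞ (fun p : ℂ × ℂ => X.tau p.1 (φ p.2)) (h, x)) key
  let Z : ℂ × ℂ → V2 := fun p => (0, p.2) + T d.n (φ p.2) p.1
  have hsm : ∀ᶠ x in 𝓝 (0:ℂ), ∀ z, ‖Z (z, x)‖ < ρ := by
    have : Tendsto (fun x : ℂ => ‖x‖ + ‖T d.n (φ x)‖) (𝓝 0) (𝓝 0) := by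
      have h1 := ((T d.n).continuous.tendsto (0 : X V2)).comp hφt
      rw [map_zero] at h1
      have := (tendsto_id (α := ℂ) (x := 𝓝 0)).norm.add h1.norm
      simpa using this
    filter_upwards [this.eventually_lt_const hρ] with x hx z
    refine lt_of_le_of_lt ((norm_add_le _ _).trans (add_le_add ?_ ((T d.n (φ x)).norm_apply_le z))) hx
    simp [Prod.norm_def]
  obtain ⟨δ, hδ, hall⟩ := Metric.eventually_nhds_iff_ball.1 (e1.and (key2.and hsm))
  have hZ : ∀ z x, ‖z‖ < d.r → ‖x‖ < δ → ContDiffAt ℝ ∞ Z (z, x) := by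
    intro z x hz hx
    obtain ⟨a1, a2, a3⟩ := hall x (by simpa using hx)
    have b1 := a2 z (by simpa using hz.le) hz
    have b2 : ContDiffAt ℝ ∞ (fun p : ℂ × ℂ => ((0:ℂ), p.2) + (X.ev 0 ∘L T d.n) (X.tau p.1 (φ p.2))) (z, x) :=
      ((contDiffAt_const.prodMk contDiffAt_snd)).add ((X.ev 0 ∘L T d.n).contDiff.contDiffAt.comp _ b1)
    refine b2.congr_of_eventuallyEq ?_
    have ho : IsOpen {p : ℂ × ℂ | ‖p.1‖ < d.r ∧ ‖p.2‖ < δ} := 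
      (isOpen_lt (f := fun p : ℂ × ℂ => ‖p.1‖) (by fun_prop) continuous_const).and (isOpen_lt (f := fun p : ℂ × ℂ => ‖p.2‖) (by fun_prop) continuous_const)
    filter_upwards [ho.mem_nhds ⟨hz, hx⟩] with p hp
    obtain ⟨a1, -⟩ := hall p.2 (by simpa using hp.2)
    have : T d.n (X.tau p.1 (φ p.2)) 0 = T d.n (φ p.2) p.1 := by
      rw [T_tau _ _ _ (d.cut0 a1.2) (d.cut_tau a1.2 hp.1.le)]; simp
    change _ = _ + T d.n (X.tau p.1 (φ p.2)) 0
    rw [this]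
  refine ⟨δ, Z, hδ, fun z x hz hx => ⟨hZ z x hz hx, (hall x (by simpa using hx)).2.2 z, Dop d.n (φ x) z, (T_deriv d.n (φ x) z).const_add ((0:ℂ), x), ?_⟩, ?_, ?_⟩
  · obtain ⟨a1, a2, a3⟩ := hall x (by simpa using hx)
    have := congrArg (fun ψ : X V2 => ψ z) a1.2
    simp only [F_apply, add_zero] at this
    rw [Dop_dbar, d.cut0 a1.2]
    rw [sub_sub] at this
    exact sub_eq_zero.1 this
  · intro z
    change (0, 0) + T d.n (φ 0) z = 0
    rw [hφ0]; simp
  · intro z hz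
    have hd := (hφd.differentiableAt (by simp)).hasFDerivAt
    refine ⟨ContinuousLinearMap.inr ℝ ℂ ℂ + (X.ev z ∘L T d.n) ∘L fderiv ℝ φ 0, ?_, ?_⟩
    · exact (ContinuousLinearMap.inr ℝ ℂ ℂ).hasFDerivAt.add ((X.ev z ∘L T d.n).hasFDerivAt.comp 0 hd)
    · intro v hv
      set φ' := fderiv ℝ φ 0 v with hφ'
      have h0 : HasFDerivAt d.F (ContinuousLinearMap.snd ℝ (ℂ × ℂ) (X V2) - mB (d.db 0) ∘L eta d.n) (((0:ℂ), (0:ℂ)), φ 0) := by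
        rw [hφ0]; exact d.F_deriv 0
      have h1 : HasFDerivAt (fun x : ℂ => d.F ((0, x), φ x)) ((ContinuousLinearMap.snd ℝ (ℂ × ℂ) (X V2) - mB (d.db 0) ∘L eta d.n) ∘L
          ((ContinuousLinearMap.inr ℝ ℂ ℂ).prod (fderiv ℝ φ 0))) 0 :=
        HasFDerivAt.comp (f := fun x : ℂ => (((0:ℂ), x), φ x)) 0 h0 ((ContinuousLinearMap.inr ℝ ℂ ℂ).hasFDerivAt.prodMk hd)
      have h2 : (fun x : ℂ => d.F ((0, x), φ x)) =ᶠ[𝓝 0] fun _ => 0 := e1.mono fun x hx => hx.2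
      have h3 := h1.unique ((hasFDerivAt_const (0 : X V2) (0:ℂ)).congr_of_eventuallyEq h2)
      have h4 : φ' = mB (d.db 0) (eta d.n ((0, v), φ')) := by
        have := congrArg (fun L => L v) h3
        simp only [ContinuousLinearMap.comp_apply, zero_apply] at this
        exact sub_eq_zero.1 this
      have h5 := nonvanish d.n (d.β 0 (ContinuousLinearMap.snd ℝ ℂ ℂ)) (d.β_supp (by simpa using d.hr.le) _) hv (X.post (ContinuousLinearMap.snd ℝ ℂ ℂ) φ') ?_ z
      · rw [Tsnd] at h5
        exact h5
      · ext1 w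
        rw [mB_apply, β_apply, Tsnd]
        have := congrArg (fun ψ : X V2 => (ψ w).2) h4
        simp only [mB_apply, eta_apply] at this
        rw [db_eq] at this
        exact this

end Dat
end JH

namespace JH
open scoped ContDiff
open MeasureTheory

/-- tent -/
def tent (δ : ℝ) (s : ℂ) : ℝ := max (δ - ‖s‖) 0

theorem tent_cont (δ : ℝ) : Continuous (tent δ) := by unfold tent; fun_prop
theorem tent_nonneg (δ : ℝ) (s : ℂ) : 0 ≤ tent δ s := le_max_right _ _
theorem tent_zero {δ : ℝ} {s : ℂ} (h : δ ≤ ‖s‖) : tent δ s = 0 := max_eq_right (by linarith)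
theorem tent_le {δ : ℝ} (hδ : 0 < δ) (s : ℂ) : tent δ s ≤ δ := max_le (by linarith [norm_nonneg s]) hδ.le
theorem tent_lip (δ : ℝ) (a b : ℂ) : |tent δ a - tent δ b| ≤ ‖a - b‖ := by
  refine (abs_max_sub_max_le_abs _ _ _).trans ?_
  rw [show δ - ‖a‖ - (δ - ‖b‖) = -(‖a‖ - ‖b‖) by ring, abs_neg]
  exact abs_norm_sub_norm_le _ _
theorem tent_int (δ : ℝ) : Integrable (tent δ) :=
  (tent_cont δ).integrable_of_hasCompactSupport (hcs_of (r := δ) fun _ h => tent_zero h.le)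

/-- mass -/
def kap (δ : ℝ) : ℝ := ∫ s, tent δ s

theorem kap_ge {δ : ℝ} (hδ : 0 < δ) : Real.pi * δ ^ 3 / 8 ≤ kap δ := by
  have h1 : ∫ s in closedBall (0:ℂ) (δ / 2), (δ / 2 : ℝ) ≤ ∫ s in closedBall (0:ℂ) (δ / 2), tent δ s := by
    refine setIntegral_mono_on (integrableOn_const measure_closedBall_lt_top.ne) (tent_int δ).integrableOn measurableSet_closedBall fun s hs => ?_
    refine le_trans ?_ (le_max_left _ _)
    have : ‖s‖ ≤ δ / 2 := by simpa using hs
    linarith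
  have h2 := setIntegral_le_integral (s := closedBall (0:ℂ) (δ / 2)) (tent_int δ) (Eventually.of_forall (tent_nonneg δ))
  rw [setIntegral_const, vol_cball 0 (by positivity), smul_eq_mul] at h1
  refine le_trans (le_of_eq ?_) (h1.trans h2)
  ring

theorem kap_pos {δ : ℝ} (hδ : 0 < δ) : 0 < kap δ := lt_of_lt_of_le (by positivity) (kap_ge hδ)

/-- mollifier -/
def ro (δ : ℝ) (s : ℂ) : ℝ := (kap δ)⁻¹ * tent δ s

theorem ro_cont (δ : ℝ) : Continuous (ro δ) := continuous_const.mul (tent_cont δ)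
theorem ro_zero {δ : ℝ} {s : ℂ} (h : δ ≤ ‖s‖) : ro δ s = 0 := by rw [ro, tent_zero h, mul_zero]
theorem ro_inv_le {δ : ℝ} (hδ : 0 < δ) : (kap δ)⁻¹ ≤ 8 / (Real.pi * δ ^ 3) := by
  rw [inv_le_comm₀ (kap_pos hδ) (by positivity), inv_div]; exact kap_ge hδ
theorem ro_nonneg {δ : ℝ} (hδ : 0 < δ) (s : ℂ) : 0 ≤ ro δ s := mul_nonneg (inv_nonneg.2 (kap_pos hδ).le) (tent_nonneg _ _)
theorem ro_le {δ : ℝ} (hδ : 0 < δ) (s : ℂ) : ro δ s ≤ 8 / (Real.pi * δ ^ 2) := by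
  calc ro δ s ≤ 8 / (Real.pi * δ ^ 3) * δ := mul_le_mul (ro_inv_le hδ) (tent_le hδ s) (tent_nonneg _ _) (by positivity)
    _ = _ := by field_simp
theorem ro_lip {δ : ℝ} (hδ : 0 < δ) (a b : ℂ) : |ro δ a - ro δ b| ≤ 8 / (Real.pi * δ ^ 3) * ‖a - b‖ := by
  rw [ro, ro, ← mul_sub, abs_mul, abs_of_pos (inv_pos.2 (kap_pos hδ))]
  exact mul_le_mul (ro_inv_le hδ) (tent_lip _ _ _) (abs_nonneg _) (by positivity)
theorem ro_int (δ : ℝ) : Integrable (ro δ) := (tent_int δ).const_mul _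
theorem ro_one {δ : ℝ} (hδ : 0 < δ) : ∫ s, ro δ s = 1 := by
  unfold ro
  rw [integral_const_mul]; exact inv_mul_cancel₀ (kap_pos hδ).ne'

section mol
variable {W G : Type} [NormedAddCommGroup W] [NormedSpace ℝ W] [CompleteSpace W] [NormedAddCommGroup G] [NormedSpace ℝ G]

theorem mol_int {δ : ℝ} (hδ : 0 < δ) {g : ℂ → W} (hm : AEStronglyMeasurable g volume) {L : ℝ} (hL : ∀ z, ‖g z‖ ≤ L) (z : ℂ) :
    Integrable (fun s => ro δ (z - s) • g s) := by
  have h1 : Integrable fun s => ro δ (z - s) := (ro_int δ).comp_sub_left z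
  refine (h1.mul_const L).mono' (h1.aestronglyMeasurable.smul hm) (Eventually.of_forall fun s => ?_)
  rw [norm_smul, Real.norm_of_nonneg (ro_nonneg hδ _)]
  exact mul_le_mul_of_nonneg_left (hL s) (ro_nonneg hδ _)

/-- mollification -/
def mol (δ : ℝ) (g : ℂ → W) (z : ℂ) : W := ∫ s, ro δ (z - s) • g s

theorem mol_near {δ : ℝ} (hδ : 0 < δ) {g : ℂ → W} {L : ℝ} (hL : ∀ z w, ‖g z - g w‖ ≤ L * ‖z - w‖) {C : ℝ} (hC : ∀ z, ‖g z‖ ≤ C) (hm : Continuous g) (z : ℂ) :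
    ‖mol δ g z - g z‖ ≤ 8 * L * δ := by
  have h1 : Integrable fun s => ro δ (z - s) := (ro_int δ).comp_sub_left z
  have h2 : ∫ s, ro δ (z - s) • g z = g z := by
    rw [integral_smul_const, integral_sub_left_eq_self (ro δ), ro_one hδ, one_smul]
  have hL0 : 0 ≤ L := by simpa using (norm_nonneg _).trans (hL 1 0)
  have h3 : mol δ g z - g z = ∫ s, ro δ (z - s) • (g s - g z) := by
    conv_lhs => rw [← h2]
    rw [mol, ← integral_sub (mol_int hδ hm.aestronglyMeasurable hC z) (h1.smul_const _)]
    congr 1; ext s; rw [smul_sub]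
  rw [h3]
  refine (norm_int_le (z := z) (r := δ) (C := 8 / (Real.pi * δ ^ 2) * (L * δ)) hδ.le (fun s hs => ?_) (fun s hs => ?_)).trans (le_of_eq ?_)
  · rw [ro_zero, zero_smul]; rw [norm_sub_rev]; exact hs.le
  · rw [norm_smul, Real.norm_of_nonneg (ro_nonneg hδ _)]
    refine mul_le_mul (ro_le hδ _) ((hL _ _).trans ?_) (norm_nonneg _) (by positivity)
    gcongr
  · field_simp

theorem mol_bdd {δ : ℝ} (hδ : 0 < δ) {g : ℂ → W} {L : ℝ} (hL : ∀ z, ‖g z‖ ≤ L) (z : ℂ) : ‖mol δ g z‖ ≤ 8 * L := by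
  have hL0 : 0 ≤ L := (norm_nonneg _).trans (hL 0)
  refine (norm_int_le (z := z) (r := δ) (C := 8 / (Real.pi * δ ^ 2) * L) hδ.le (fun s hs => ?_) (fun s hs => ?_)).trans (le_of_eq ?_)
  · rw [ro_zero, zero_smul]; rw [norm_sub_rev]; exact hs.le
  · rw [norm_smul, Real.norm_of_nonneg (ro_nonneg hδ _)]
    exact mul_le_mul (ro_le hδ _) (hL _) (norm_nonneg _) (by positivity)
  · field_simp

/-- the basic difference bound -/
theorem diff_bd {δ : ℝ} (hδ : 0 < δ) {g : ℂ → W} {L : ℝ} {z z' : ℂ} (hz : ‖z - z'‖ ≤ δ) (hL : ∀ s, ‖s - z‖ ≤ 2 * δ → ‖g s‖ ≤ L) :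
    ‖∫ s, (ro δ (z - s) - ro δ (z' - s)) • g s‖ ≤ 32 * L / δ * ‖z - z'‖ := by
  have hL0 : 0 ≤ L := (norm_nonneg _).trans (hL z (by simpa using hδ.le))
  refine (norm_int_le (z := z) (r := 2 * δ) (C := 8 / (Real.pi * δ ^ 3) * ‖z - z'‖ * L) (by positivity) (fun s hs => ?_) (fun s hs => ?_)).trans (le_of_eq ?_)
  · rw [ro_zero, ro_zero, sub_self, zero_smul]
    · have : s - z = -(z - z') - (z' - s) := by ring
      have h2 := norm_sub_le (-(z - z')) (z' - s)
      rw [← this, norm_neg] at h2; linarith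
    · rw [norm_sub_rev]; linarith
  · rw [norm_smul]
    refine mul_le_mul ?_ (hL _ hs) (norm_nonneg _) (by positivity)
    have := ro_lip hδ (z - s) (z' - s)
    simpa using this
  · field_simp; ring

theorem mol_lip {δ : ℝ} (hδ : 0 < δ) {g : ℂ → W} (hm : AEStronglyMeasurable g volume) {L : ℝ} (hL : ∀ z, ‖g z‖ ≤ L) (z z' : ℂ) :
    ‖mol δ g z - mol δ g z'‖ ≤ 32 * L / δ * ‖z - z'‖ := by
  have hL0 : 0 ≤ L := (norm_nonneg _).trans (hL 0)
  rcases le_or_gt ‖z - z'‖ δ with h | h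
  · have := diff_bd hδ h (fun s _ => hL s)
    have e : mol δ g z - mol δ g z' = ∫ s, (ro δ (z - s) - ro δ (z' - s)) • g s := by
      rw [mol, mol, ← integral_sub (mol_int hδ hm hL z) (mol_int hδ hm hL z')]
      congr 1; ext s; rw [sub_smul]
    rw [e]; exact this
  · calc _ ≤ ‖mol δ g z‖ + ‖mol δ g z'‖ := norm_sub_le _ _
      _ ≤ 8 * L + 8 * L := add_le_add (mol_bdd hδ hL z) (mol_bdd hδ hL z')
      _ ≤ 32 * L / δ * δ := by field_simp; nlinarith
      _ ≤ _ := by gcongr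

/-- commutator -/
def com (δ : ℝ) (a : ℂ → G →L[ℝ] W) (d : ℂ → G) (z : ℂ) : W := ∫ s, ro δ (z - s) • ((a s - a z) (d s))

theorem com_sup {δ La Ld : ℝ} (hδ : 0 < δ) {a : ℂ → G →L[ℝ] W} {d : ℂ → G} (ha : ∀ z w, ‖a z - a w‖ ≤ La * ‖z - w‖) (hd : ∀ z, ‖d z‖ ≤ Ld)
    (z : ℂ) : ‖com δ a d z‖ ≤ 8 * (La * Ld) * δ := by
  have hLa : 0 ≤ La := by simpa using (norm_nonneg _).trans (ha 1 0)
  have hLd : 0 ≤ Ld := (norm_nonneg _).trans (hd 0)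
  refine (norm_int_le (z := z) (r := δ) (C := 8 / (Real.pi * δ ^ 2) * (La * δ * Ld)) hδ.le (fun s hs => ?_) (fun s hs => ?_)).trans (le_of_eq ?_)
  · rw [ro_zero, zero_smul]; rw [norm_sub_rev]; exact hs.le
  · rw [norm_smul, Real.norm_of_nonneg (ro_nonneg hδ _)]
    refine mul_le_mul (ro_le hδ _) ((ContinuousLinearMap.le_opNorm _ _).trans ?_) (norm_nonneg _) (by positivity)
    refine mul_le_mul ((ha _ _).trans ?_) (hd _) (norm_nonneg _) (by positivity)
    gcongr
  · field_simp

theorem com_lip {δ La Ld : ℝ} (hδ : 0 < δ) {a : ℂ → G →L[ℝ] W} {d : ℂ → G} (ha : ∀ z w, ‖a z - a w‖ ≤ La * ‖z - w‖) (hd : ∀ z, ‖d z‖ ≤ Ld)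
    (hca : Continuous a) (hmd : AEStronglyMeasurable d volume) (z z' : ℂ) : ‖com δ a d z - com δ a d z'‖ ≤ 72 * (La * Ld) * ‖z - z'‖ := by
  have hLa : 0 ≤ La := by simpa using (norm_nonneg _).trans (ha 1 0)
  have hLd : 0 ≤ Ld := (norm_nonneg _).trans (hd 0)
  rcases le_or_gt ‖z - z'‖ δ with h | h
  · have hm : ∀ y, AEStronglyMeasurable (fun s => (a s - a y) (d s)) volume := fun y =>
      (ContinuousLinearMap.apply ℝ W).aestronglyMeasurable_comp₂ hmd (hca.sub continuous_const).aestronglyMeasurable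
    have hI : ∀ x y, Integrable (fun s => ro δ (x - s) • ((a s - a y) (d s))) := fun x y => by
      have h1 : Integrable fun s => ro δ (x - s) := (ro_int δ).comp_sub_left x
      refine (h1.mul_const (La * (δ + ‖x - y‖) * Ld)).mono' (h1.aestronglyMeasurable.smul (hm y)) (Eventually.of_forall fun s => ?_)
      rw [norm_smul, Real.norm_of_nonneg (ro_nonneg hδ _)]
      rcases le_or_gt δ ‖x - s‖ with h' | h'
      · rw [ro_zero h']; simp
      · refine mul_le_mul_of_nonneg_left ((ContinuousLinearMap.le_opNorm _ _).trans ?_) (ro_nonneg hδ _)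
        refine mul_le_mul ((ha _ _).trans ?_) (hd _) (norm_nonneg _) (by positivity)
        gcongr
        have : s - y = (x - y) - (x - s) := by ring
        rw [this]
        linarith [norm_sub_le (x - y) (x - s)]
    have e : com δ a d z - com δ a d z' = (∫ s, (ro δ (z - s) - ro δ (z' - s)) • ((a s - a z) (d s))) + ∫ s, ro δ (z' - s) • ((a z' - a z) (d s)) := by
      have e2 : ∀ s, ro δ (z' - s) • ((a z' - a z) (d s)) = ro δ (z' - s) • ((a s - a z) (d s)) - ro δ (z' - s) • ((a s - a z') (d s)) := fun s => by
        rw [← smul_sub]; congr 1; simp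
      simp only [e2, sub_smul]
      rw [integral_sub (hI _ _) (hI _ _), integral_sub (hI _ _) (hI _ _), com, com]; abel
    rw [e]
    have b1 := diff_bd hδ h (g := fun s => (a s - a z) (d s)) (L := La * (2 * δ) * Ld) fun s hs => by
      refine (ContinuousLinearMap.le_opNorm _ _).trans (mul_le_mul ((ha _ _).trans ?_) (hd _) (norm_nonneg _) (by positivity))
      gcongr
    have b2 := mol_bdd hδ (g := fun s => (a z' - a z) (d s)) (L := La * ‖z - z'‖ * Ld) (fun s => by
      refine (ContinuousLinearMap.le_opNorm _ _).trans (mul_le_mul ?_ (hd _) (norm_nonneg _) (by positivity))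
      rw [norm_sub_rev]; exact ha _ _) z'
    refine (norm_add_le _ _).trans ((add_le_add b1 b2).trans (le_of_eq ?_))
    field_simp; ring
  · calc _ ≤ ‖com δ a d z‖ + ‖com δ a d z'‖ := norm_sub_le _ _
      _ ≤ 8 * (La * Ld) * δ + 8 * (La * Ld) * δ := add_le_add (com_sup hδ ha hd z) (com_sup hδ ha hd z')
      _ ≤ 72 * (La * Ld) * δ := by nlinarith [mul_nonneg (mul_nonneg hLa hLd) hδ.le]
      _ ≤ _ := by gcongr
end mol

/-- derivative of a mollification of a Lipschitz differentiable function -/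
theorem mol_deriv {W : Type} [NormedAddCommGroup W] [NormedSpace ℝ W] [FiniteDimensional ℝ W] {δ : ℝ} (hδ : 0 < δ) {g : ℂ → W} {D : ℂ → ℂ →L[ℝ] W} {L C : ℝ} (hL : ∀ z w, ‖g z - g w‖ ≤ L * ‖z - w‖)
    (hC : ∀ z, ‖g z‖ ≤ C) (hD : ∀ z, HasFDerivAt g (D z) z) (z : ℂ) : HasFDerivAt (mol δ g) (mol δ D z) z := by
  have hL0 : 0 ≤ L := by simpa using (norm_nonneg _).trans (hL 1 0)
  have : CompleteSpace W := FiniteDimensional.complete ℝ W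
  have hc : Continuous g := continuous_iff_continuousAt.2 fun z => (hD z).continuousAt
  have hDf : D = fderiv ℝ g := funext fun z => (hD z).fderiv.symm
  have hDm : Measurable D := by rw [hDf]; borelize W; exact measurable_fderiv ℝ g
  have e1 : ∀ {W' : Type} [NormedAddCommGroup W'] [NormedSpace ℝ W'] (g : ℂ → W') z, mol δ g z = ∫ s, ro δ s • g (z - s) := fun g z => by
    rw [mol, ← integral_sub_left_eq_self (fun s => ro δ (z - s) • g s) volume z]
    simp
  have e2 : mol δ g = fun z => ∫ s, ro δ s • g (z - s) := funext (e1 g)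
  rw [e2, e1 D]
  have hK : LipschitzWith L.toNNReal g := LipschitzWith.of_dist_le_mul fun x y => by
    rw [dist_eq_norm, dist_eq_norm, Real.coe_toNNReal _ hL0]; exact hL x y
  refine (hasFDerivAt_integral_of_dominated_loc_of_lip (bound := fun s => ro δ s * L) (F' := fun s => ro δ s • D (z - s)) (s := ball z 1) (ball_mem_nhds z one_pos)
    (Eventually.of_forall fun x => ?_) ?_ ?_ (Eventually.of_forall fun s => ?_) ((ro_int δ).mul_const L) (Eventually.of_forall fun s => ?_)).2
  · exact ((ro_cont δ).smul (hc.comp (continuous_const.sub continuous_id))).aestronglyMeasurable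
  · refine ((ro_int δ).mul_const C).mono' ((ro_cont δ).smul (hc.comp (continuous_const.sub continuous_id))).aestronglyMeasurable (Eventually.of_forall fun s => ?_)
    rw [norm_smul, Real.norm_of_nonneg (ro_nonneg hδ _)]
    exact mul_le_mul_of_nonneg_left (hC _) (ro_nonneg hδ _)
  · exact (ro_cont δ).aestronglyMeasurable.smul (hDm.comp (measurable_const.sub measurable_id)).stronglyMeasurable.aestronglyMeasurable
  · refine LipschitzOnWith.of_dist_le_mul fun x _ y _ => ?_
    rw [dist_eq_norm, dist_eq_norm, ← smul_sub, norm_smul, Real.norm_of_nonneg (ro_nonneg hδ _), Real.coe_nnabs, abs_of_nonneg (mul_nonneg (ro_nonneg hδ _) hL0), mul_assoc]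
    refine mul_le_mul_of_nonneg_left ?_ (ro_nonneg hδ _)
    simpa using hL (x - s) (y - s)
  · have h1 : HasFDerivAt (fun x => g (x - s)) (D (z - s)) z := by
      exact (hD (z - s)).comp z ((hasFDerivAt_id z).sub_const s)
    exact h1.const_smul _

end JH

namespace JH
open scoped ContDiff
section sm
variable {E F G : Type} [NormedAddCommGroup E] [NormedSpace ℝ E] [NormedAddCommGroup F] [NormedSpace ℝ F]
  [NormedAddCommGroup G] [NormedSpace ℝ G]

def Sm (k : ℕ) (v : X E) : Prop := ContDiff ℝ k (fun h : ℂ => X.tau h v)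

theorem Sm.of_at {k : ℕ} {v : X E} (h : ContDiffAt ℝ k (fun h : ℂ => X.tau h v) 0) : Sm k v := by
  rw [Sm, contDiff_iff_contDiffAt]
  intro h0
  have e : (fun h : ℂ => X.tau h v) = fun h => X.tau h0 (X.tau (h - h0) v) := by
    funext h; rw [X.tau_tau]; congr 2; ring
  rw [e]
  have h1 : ContDiffAt ℝ k (fun h : ℂ => X.tau h v) (h0 - h0) := by simpa using h
  exact (X.tau h0).contDiff.contDiffAt.comp h0 (ContDiffAt.comp (f := fun h => h - h0) (g := fun h : ℂ => X.tau h v) h0 h1 (contDiffAt_id.sub contDiffAt_const))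

theorem Sm.post {k : ℕ} {v : X E} (h : Sm k v) (L : E →L[ℝ] F) : Sm k (X.post L v) := by
  have e : (fun h : ℂ => X.tau h (X.post L v)) = fun h => X.post L (X.tau h v) := by
    funext h; ext z; simp
  rw [Sm, e]
  exact (X.post L).contDiff.comp h

theorem Sm.bil {k : ℕ} {u : X E} {v : X F} (hu : Sm k u) (hv : Sm k v) (L : E →L[ℝ] F →L[ℝ] G) : Sm k (X.bil L u v) := by
  have e : (fun h : ℂ => X.tau h (X.bil L u v)) = fun h => X.bil L (X.tau h u) (X.tau h v) := by
    funext h; ext z; simp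
  rw [Sm, e]
  exact ((X.bil L).contDiff.comp hu).clm_apply hv

theorem Sm.add {k : ℕ} {u v : X E} (hu : Sm k u) (hv : Sm k v) : Sm k (u + v) := by
  have e : (fun h : ℂ => X.tau h (u + v)) = fun h => X.tau h u + X.tau h v := by
    funext h; simp
  rw [Sm, e]
  exact ContDiff.add hu hv

theorem base_zero {G : Type} [NormedAddCommGroup G] : Base (fun _ : ℂ => (0 : G)) := fun z w => by simp

theorem Sm.comp {k : ℕ} {v : X G} (hv : Sm k v) (q : G → F) (h : Cc q) : Sm k (Cq q h (fun _ => 0) base_zero v) := by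
  have e : (fun s : ℂ => X.tau s (Cq q h (fun _ => 0) base_zero v)) = fun s => Cq q h (fun _ => 0) base_zero (X.tau s v) := by
    funext s; ext z; simp [Cq_apply]
  rw [Sm, e]
  exact ((Cq_cd q h _ base_zero).of_le (by exact_mod_cast le_top)).comp hv

theorem Sm.cc {k : ℕ} (q : ℂ → F) (h : Cc q) : Sm k (Cq q h (fun z => z) (fun _ _ => le_rfl) 0) := by
  have e : (fun s : ℂ => X.tau s (Cq q h (fun z => z) (fun _ _ => le_rfl) 0)) = fun s => Cq q h (fun z => z) (fun _ _ => le_rfl) (X.cst s) := by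
    funext s; ext z; refine (X.tau_apply _ _ _).trans ((Cq_apply _ _ _ _ _ _).trans (Eq.trans ?_ (Cq_apply _ _ _ _ _ _).symm)); simp
  rw [Sm, e]
  exact ((Cq_cd q h _ _).of_le (by exact_mod_cast le_top)).comp X.cst.contDiff

theorem Sm.contDiff {k : ℕ} {v : X E} (hv : Sm k v) : ContDiff ℝ k v := by
  have e : (v : ℂ → E) = fun h => X.ev 0 (X.tau h v) := by
    funext h; simp
  rw [e]
  exact (X.ev 0).contDiff.comp hv

def Lam : X (ℂ →L[ℝ] F) →L[ℝ] ℂ →L[ℝ] X F :=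
  ((X.bil (ContinuousLinearMap.apply ℝ F : ℂ →L[ℝ] (ℂ →L[ℝ] F) →L[ℝ] F)) ∘L X.cst).flip

theorem Lam_apply (Φ : X (ℂ →L[ℝ] F)) (ξ z : ℂ) : Lam Φ ξ z = Φ z ξ := by
  simp [Lam]

theorem Sm.succ {k : ℕ} {v : X F} {D : X (ℂ →L[ℝ] F)} (hD : Sm k D) (hv : ∀ z, HasFDerivAt v (D z) z) : Sm (k+1) v := by
  rw [Sm]
  push_cast
  rw [contDiff_succ_iff_hasFDerivAt]
  refine ⟨fun h => Lam (X.tau h D), Lam.contDiff.comp hD, fun h0 => ?_⟩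
  have hc : Continuous (fun h : ℂ => X.tau h D) := ContDiff.continuous hD
  rw [hasFDerivAt_iff_isLittleO, Asymptotics.isLittleO_iff]
  intro ε hε
  obtain ⟨δ, hδ, hb⟩ := Metric.continuous_iff.1 hc h0 ε hε
  filter_upwards [ball_mem_nhds h0 hδ] with h hh
  have key : ∀ z x, x ∈ ball h0 δ → HasFDerivWithinAt (fun h => v (z + h) - D (z + h0) h) (D (z + x) - D (z + h0)) (ball h0 δ) x := by
    intro z x _
    have h1 : HasFDerivAt (fun h => v (z + h)) (D (z + x)) x := by
      have := (hv (z + x)).comp x ((hasFDerivAt_id (𝕜 := ℝ) x).const_add z)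
      have e : D (z + x) ∘L ContinuousLinearMap.id ℝ ℂ = D (z + x) := by ext; simp
      rw [e] at this
      exact this
    exact (h1.sub (D (z + h0)).hasFDerivAt).hasFDerivWithinAt
  have hbd : ∀ x ∈ ball h0 δ, ‖X.tau x D - X.tau h0 D‖ ≤ ε := fun x hx => by
    have := hb x hx
    rw [dist_eq_norm] at this; exact this.le
  have h0m : h0 ∈ ball h0 δ := mem_ball_self hδ
  refine X.norm_le_of _ (fun z => ?_) (fun z w => ?_)
  · have := Convex.norm_image_sub_le_of_norm_hasFDerivWithin_le (C := ε) (key z) (fun x hx => ?_) (convex_ball h0 δ) h0m hh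
    · simp only [X.sub_apply, X.tau_apply, Lam_apply, map_sub] at this ⊢
      convert this using 2
      abel
    · have h2 := (X.norm_apply_le (X.tau x D - X.tau h0 D) z).trans (hbd x hx)
      simpa using h2
  · have := Convex.norm_image_sub_le_of_norm_hasFDerivWithin_le (C := ε * √‖z - w‖) (fun x hx => (key z x hx).sub (key w x hx)) (fun x hx => ?_) (convex_ball h0 δ) h0m hh
    · simp only [X.sub_apply, X.tau_apply, Lam_apply, map_sub, Pi.sub_apply] at this ⊢
      calc _ = _ := by congr 1; abel
        _ ≤ _ := this
        _ = _ := by ring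
    · have h2 := (X.norm_sub_le (X.tau x D - X.tau h0 D) z w).trans (mul_le_mul_of_nonneg_right (hbd x hx) (Real.sqrt_nonneg _))
      simpa using h2

end sm
end JH

namespace JH
open scoped ContDiff
open MeasureTheory
section lr
variable {F : Type} [NormedAddCommGroup F] [NormedSpace ℝ F] [NormedSpace ℂ F] [IsScalarTower ℝ ℂ F] [FiniteDimensional ℝ F] [CompleteSpace F]

/-- data for the linear regularity -/
structure Lr (F : Type) [NormedAddCommGroup F] [NormedSpace ℝ F] [NormedSpace ℂ F] [IsScalarTower ℝ ℂ F] [CompleteSpace F] where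
  m : X (F →L[ℝ] F)
  ψ : X F
  v : ℂ → F
  D : ℂ → ℂ →L[ℝ] F
  L : ℝ
  hmL : ∀ z w, ‖m z - m w‖ ≤ L * ‖z - w‖
  hψL : ∀ z w, ‖ψ z - ψ w‖ ≤ L * ‖z - w‖
  hvL : ∀ z w, ‖v z - v w‖ ≤ L * ‖z - w‖
  hD : ∀ z, HasFDerivAt v (D z) z
  eq : ∀ z, D z 1 + Complex.I • D z Complex.I = m z (D z Complex.I) + ψ z
  hv0 : ∀ z, 1 < ‖z‖ → v z = 0
  hm0 : ∀ z, 1 < ‖z‖ → m z = 0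
  hψ0 : ∀ z, 1 < ‖z‖ → ψ z = 0
  small : ‖mB m‖ * ‖(P 4 : X F →L[ℝ] X F)‖ < 1

namespace Lr
variable (d : Lr F)

theorem L_nonneg : 0 ≤ d.L := by
  have := (norm_nonneg _).trans (d.hmL 1 0)
  simpa using this

theorem D_bdd (z : ℂ) : ‖d.D z‖ ≤ d.L := by
  refine HasFDerivAt.le_of_lip' (d.hD z) d.L_nonneg (Eventually.of_forall fun w => d.hvL w z)

theorem v_bdd (z : ℂ) : ‖d.v z‖ ≤ d.L * 4 := by
  by_cases h : 1 < ‖z‖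
  · rw [d.hv0 z h]; simp; exact d.L_nonneg
  · have := d.hvL z 2
    rw [d.hv0 2 (by simp), sub_zero] at this
    refine this.trans (mul_le_mul_of_nonneg_left ?_ d.L_nonneg)
    refine (norm_sub_le _ _).trans ?_
    have : ‖(2:ℂ)‖ = 2 := by simp
    rw [this]; linarith

theorem D_zero (z : ℂ) (h : 1 < ‖z‖) : d.D z = 0 := by
  have h1 : d.v =ᶠ[𝓝 z] fun _ => 0 := by
    filter_upwards [(isOpen_lt continuous_const continuous_norm).mem_nhds h] with w hw using d.hv0 w hw
  exact (d.hD z).unique ((hasFDerivAt_const (0:F) z).congr_of_eventuallyEq h1)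

theorem D_meas : AEStronglyMeasurable d.D volume := by
  have e : d.D = fderiv ℝ d.v := by funext z; exact (d.hD z).fderiv.symm
  rw [e]
  exact (measurable_fderiv ℝ d.v).aestronglyMeasurable

theorem v_cont : Continuous d.v := continuous_iff_continuousAt.2 fun z => (d.hD z).continuousAt

def t : X F →L[ℝ] X F := mB d.m ∘L P 4

theorem t_norm : ‖d.t‖ < 1 := (ContinuousLinearMap.opNorm_comp_le _ _).trans_lt d.small

def φ : X F := Ring.inverse (1 - d.t) d.ψ

theorem φ_eq : d.φ = d.t d.φ + d.ψ := by
  have h : (1 - d.t) * Ring.inverse (1 - d.t) = 1 := Ring.mul_inverse_cancel _ ⟨Units.oneSub _ d.t_norm, rfl⟩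
  have := congrArg (fun S => S d.ψ) h
  simp only [mul_apply_eq_comp, one_apply_eq_self, sub_apply] at this
  rw [← sub_eq_iff_eq_add']
  exact this

theorem uniq {y e : X F} (h : y = d.t y + (d.ψ + e)) : ‖y - d.φ‖ ≤ (1 - ‖d.t‖)⁻¹ * ‖e‖ := by
  have h1 : y - d.φ = d.t (y - d.φ) + e := by
    rw [map_sub]
    conv_lhs => rw [h, d.φ_eq]
    abel
  have h2 : ‖y - d.φ‖ ≤ ‖d.t‖ * ‖y - d.φ‖ + ‖e‖ := by
    conv_lhs => rw [h1]
    exact (norm_add_le _ _).trans (add_le_add_left (d.t.le_opNorm _) _)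
  have := d.t_norm
  rw [inv_mul_eq_div, le_div_iff₀ (by linarith)]
  linarith

theorem φ_zero (z : ℂ) (h : 1 < ‖z‖) : d.φ z = 0 := by
  rw [d.φ_eq, X.add_apply, d.hψ0 z h, t]
  have := mB_apply d.m (P 4 d.φ) z
  rw [d.hm0 z h] at this
  rw [ContinuousLinearMap.comp_apply, this]; simp

def a (z : ℂ) : (F × ℝ) →L[ℝ] F := (d.m z).coprod (ContinuousLinearMap.toSpanSingleton ℝ (d.ψ z))

theorem a_apply (z : ℂ) (y : F × ℝ) : d.a z y = d.m z y.1 + y.2 • d.ψ z := by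
  simp [a]

theorem a_lip (z w : ℂ) : ‖d.a z - d.a w‖ ≤ (2 * d.L) * ‖z - w‖ := by
  have hL := d.L_nonneg
  refine ContinuousLinearMap.opNorm_le_bound _ (by positivity) fun y => ?_
  have e : (d.a z - d.a w) y = (d.m z - d.m w) y.1 + y.2 • (d.ψ z - d.ψ w) := by
    rw [sub_apply, a_apply, a_apply, smul_sub, sub_apply]; abel
  rw [e]
  have h1 := ((d.m z - d.m w).le_opNorm y.1).trans (mul_le_mul (d.hmL z w) (norm_fst_le y) (norm_nonneg _) (by positivity))
  have h2 : ‖y.2 • (d.ψ z - d.ψ w)‖ ≤ ‖y‖ * (d.L * ‖z - w‖) := by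
    rw [norm_smul]
    exact mul_le_mul (norm_snd_le y) (d.hψL z w) (norm_nonneg _) (norm_nonneg _)
  refine (norm_add_le _ _).trans ?_
  linarith

def dd (z : ℂ) : F × ℝ := (d.D z Complex.I, 1)

theorem dd_bdd (z : ℂ) : ‖d.dd z‖ ≤ d.L + 1 := by
  have h1 := (d.D z).le_of_opNorm_le (d.D_bdd z) Complex.I
  have := d.L_nonneg
  rw [Complex.norm_I, mul_one] at h1
  rw [dd, Prod.norm_def]
  exact max_le (by simp only; linarith) (by simp; linarith)

theorem dd_meas : AEStronglyMeasurable d.dd volume :=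
  ((ContinuousLinearMap.apply ℝ F Complex.I).continuous.comp_aestronglyMeasurable d.D_meas).prodMk aestronglyMeasurable_const

theorem a_cont : Continuous d.a :=
  (LipschitzWith.of_dist_le_mul (K := ⟨2 * d.L, by have := d.L_nonneg; positivity⟩) fun z w => by
    rw [dist_eq_norm, dist_eq_norm]; exact d.a_lip z w).continuous

theorem mol_ap {δ : ℝ} (hδ : 0 < δ) (z ξ : ℂ) : mol δ d.D z ξ = ∫ s, ro δ (z - s) • d.D s ξ := by
  rw [mol, ContinuousLinearMap.integral_apply (mol_int hδ d.D_meas d.D_bdd z)]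
  rfl

theorem mol_zero {δ : ℝ} (hδ' : δ < 1) (z : ℂ) (hz : 2 < ‖z‖) : mol δ d.D z = 0 ∧ mol δ d.v z = 0 := by
  have h : ∀ s, ro δ (z - s) = 0 ∨ 1 < ‖s‖ := fun s => by
    by_cases hs : 1 < ‖s‖
    · exact Or.inr hs
    · refine Or.inl (ro_zero ?_)
      have := norm_sub_norm_le z s
      linarith
  constructor
  · rw [mol]
    refine integral_eq_zero_of_ae (Eventually.of_forall fun s => ?_)
    rcases h s with h | h
    · simp [h]
    · simp [d.D_zero s h]
  · rw [mol]
    refine integral_eq_zero_of_ae (Eventually.of_forall fun s => ?_)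
    rcases h s with h | h
    · simp [h]
    · simp [d.hv0 s h]

theorem intI {δ : ℝ} (hδ : 0 < δ) (z ξ : ℂ) : Integrable fun s => ro δ (z - s) • d.D s ξ := by
  refine mol_int hδ ((ContinuousLinearMap.apply ℝ F ξ).continuous.comp_aestronglyMeasurable d.D_meas) (L := d.L * ‖ξ‖) (fun s => ?_) z
  exact (d.D s).le_of_opNorm_le (d.D_bdd s) ξ

theorem mol_eq {δ : ℝ} (hδ : 0 < δ) (z : ℂ) :
    mol δ d.D z 1 + Complex.I • mol δ d.D z Complex.I = d.m z (mol δ d.D z Complex.I) + (d.ψ z + com δ d.a d.dd z) := by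
  have h1 : Integrable fun s => ro δ (z - s) := (ro_int δ).comp_sub_left z
  have h2 : ∫ s, ro δ (z - s) • d.ψ z = d.ψ z := by
    rw [integral_smul_const, integral_sub_left_eq_self (ro δ), ro_one hδ, one_smul]
  have h3 : d.m z (mol δ d.D z Complex.I) = ∫ s, d.m z (ro δ (z - s) • d.D s Complex.I) := by
    rw [d.mol_ap hδ, ContinuousLinearMap.integral_comp_comm _ (d.intI hδ z _)]
  have h4 : Complex.I • mol δ d.D z Complex.I = ∫ s, Complex.I • (ro δ (z - s) • d.D s Complex.I) := by
    rw [d.mol_ap hδ, integral_smul]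
  have i1 := d.intI hδ z 1
  have i2 : Integrable (fun s => Complex.I • (ro δ (z - s) • d.D s Complex.I)) := (d.intI hδ z Complex.I).smul Complex.I
  have i3 : Integrable (fun s => d.m z (ro δ (z - s) • d.D s Complex.I)) := (d.m z).integrable_comp (d.intI hδ z Complex.I)
  have i4 : Integrable (fun s => ro δ (z - s) • d.ψ z) := h1.smul_const _
  have j1 : Integrable (fun s => ro δ (z - s) • d.D s 1 + Complex.I • (ro δ (z - s) • d.D s Complex.I)) := i1.add i2
  have j2 : Integrable (fun s => d.m z (ro δ (z - s) • d.D s Complex.I) + ro δ (z - s) • d.ψ z) := i3.add i4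
  have h5 : com δ d.a d.dd z = (∫ s, (ro δ (z - s) • d.D s 1 + Complex.I • (ro δ (z - s) • d.D s Complex.I))) -
      ∫ s, (d.m z (ro δ (z - s) • d.D s Complex.I) + ro δ (z - s) • d.ψ z) := by
    rw [← integral_sub j1 j2, com]
    congr 1; funext s
    have e1 : (d.a s - d.a z) (d.dd s) = (d.D s 1 + Complex.I • d.D s Complex.I) - d.m z (d.D s Complex.I) - d.ψ z := by
      rw [sub_apply, a_apply, a_apply, d.eq]
      simp only [dd, one_smul]; abel
    rw [e1, map_smul, smul_comm Complex.I, smul_sub, smul_sub, smul_add]; abel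
  rw [h5, integral_add i1 i2, integral_add i3 i4, ← h3, ← h4, h2,
    ← d.mol_ap hδ]
  abel

theorem step {δ : ℝ} (hδ : 0 < δ) (hδ' : δ < 1) (z : ℂ) :
    ‖T 4 d.φ z - d.v z‖ ≤ ‖(T 4 : X F →L[ℝ] X F)‖ * ((1 - ‖d.t‖)⁻¹ * (2 * (8 * (2 * d.L * (d.L + 1)) * δ + √(2 * (8 * (2 * d.L * (d.L + 1)) * δ) * (72 * (2 * d.L * (d.L + 1))))))) + 8 * d.L * δ := by
  have hL := d.L_nonneg
  have hDb : ∃ C, Bd (mol δ d.D) C := ⟨_, bd_of_lip (mol_bdd hδ d.D_bdd) (mol_lip hδ d.D_meas d.D_bdd)⟩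
  let Dδ : X (ℂ →L[ℝ] F) := X.of _ hDb
  have hDδ : ∀ z, Dδ z = mol δ d.D z := X.of_apply _ hDb
  let Lop : (ℂ →L[ℝ] F) →L[ℝ] F := ContinuousLinearMap.apply ℝ F 1 + ((Complex.I • ContinuousLinearMap.id ℂ F).restrictScalars ℝ) ∘L ContinuousLinearMap.apply ℝ F Complex.I
  let φδ : X F := X.post Lop Dδ
  have hφδ : ∀ z, φδ z = mol δ d.D z 1 + Complex.I • mol δ d.D z Complex.I := fun z => by
    have := X.post_apply Lop Dδ z
    rw [hDδ] at this
    exact this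
  have hcut : cut 4 φδ = φδ := cut_eq _ _ fun z hz => by
    rw [hφδ, (d.mol_zero hδ' z (by push_cast at hz; nlinarith [norm_nonneg z])).1]; simp
  have hT : ∀ z, T 4 φδ z = mol δ d.v z := by
    refine T_unique 4 φδ (D := mol δ d.D) (mol_deriv hδ d.hvL d.v_bdd d.hD) (fun z => ?_) ?_
    · rw [hcut, hφδ]
    · refine tendsto_const_nhds.congr' ?_
      filter_upwards [tendsto_norm_cocompact_atTop.eventually (eventually_gt_atTop (2:ℝ))] with z hz
      exact ((d.mol_zero hδ' z hz).2).symm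
  have hP : ∀ z, P 4 φδ z = mol δ d.D z Complex.I := fun z => by
    rw [P_apply]
    have h1 := T_deriv 4 φδ z
    have h2 : HasFDerivAt (T 4 φδ) (mol δ d.D z) z := by
      have : (T 4 φδ : ℂ → F) = mol δ d.v := funext hT
      rw [this]; exact mol_deriv hδ d.hvL d.v_bdd d.hD z
    rw [h1.unique h2]
  have hcb := bd_interp (com_sup hδ d.a_lip d.dd_bdd) (com_lip hδ d.a_lip d.dd_bdd d.a_cont d.dd_meas)
  let e : X F := X.of _ ⟨_, hcb⟩
  have he : ‖e‖ ≤ _ := X.norm_le_of_bd (φ := e) hcb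
  have heq : φδ = d.t φδ + (d.ψ + e) := by
    ext z
    rw [X.add_apply, X.add_apply]
    have h1 : d.t φδ z = d.m z (P 4 φδ z) := mB_apply d.m (P 4 φδ) z
    have h2 : e z = com δ d.a d.dd z := X.of_apply _ _ z
    rw [h1, h2, hP, hφδ, d.mol_eq hδ]
  have hu := d.uniq heq
  have h3 : ‖T 4 d.φ z - T 4 φδ z‖ ≤ ‖(T 4 : X F →L[ℝ] X F)‖ * ‖φδ - d.φ‖ := by
    rw [norm_sub_rev, ← X.sub_apply, ← map_sub]
    exact (X.norm_apply_le _ _).trans ((T 4).le_opNorm _)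
  have h4 := mol_near hδ d.hvL d.v_bdd d.v_cont z
  rw [← hT] at h4
  have h5 := norm_sub_le_norm_sub_add_norm_sub (T 4 d.φ z) (T 4 φδ z) (d.v z)
  have ht := d.t_norm
  have ht' : 0 ≤ (1 - ‖d.t‖)⁻¹ := inv_nonneg.2 (by linarith)
  refine h5.trans (add_le_add (h3.trans ?_) h4)
  refine mul_le_mul_of_nonneg_left (hu.trans ?_) (norm_nonneg _)
  exact mul_le_mul_of_nonneg_left he ht'

theorem T_eq (z : ℂ) : T 4 d.φ z = d.v z := by
  have h : Tendsto (fun δ : ℝ => ‖(T 4 : X F →L[ℝ] X F)‖ * ((1 - ‖d.t‖)⁻¹ * (2 * (8 * (2 * d.L * (d.L + 1)) * δ + √(2 * (8 * (2 * d.L * (d.L + 1)) * δ) * (72 * (2 * d.L * (d.L + 1))))))) + 8 * d.L * δ) (𝓝[>] 0) (𝓝 0) := by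
    refine Tendsto.mono_left ?_ nhdsWithin_le_nhds
    refine Continuous.tendsto' (by fun_prop) _ _ (by simp)
  have h2 : ‖T 4 d.φ z - d.v z‖ ≤ 0 := by
    refine ge_of_tendsto h ?_
    filter_upwards [self_mem_nhdsWithin, nhdsWithin_le_nhds (Iio_mem_nhds (show (0:ℝ) < 1 by norm_num))] with δ h1 h2
    exact d.step h1 h2 z
  exact sub_eq_zero.1 (norm_le_zero_iff.1 h2)

theorem φcut : cut 4 d.φ = d.φ := cut_eq _ _ fun z hz => by
  refine d.φ_zero _ ?_
  push_cast at hz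
  nlinarith [norm_nonneg z]

theorem tcut (h : ℂ) (hh : ‖h‖ < 1) : cut 4 (X.tau h d.φ) = X.tau h d.φ := cut_eq _ _ fun z hz => by
  rw [X.tau_apply]
  refine d.φ_zero _ ?_
  have := norm_sub_le (z + h) h
  rw [add_sub_cancel_right] at this
  push_cast at hz
  nlinarith [norm_nonneg z]

theorem tau_φ (h : ℂ) (hh : ‖h‖ < 1) : X.tau h d.φ = Ring.inverse (1 - mB (X.tau h d.m) ∘L P 4) (X.tau h d.ψ) := by
  have hc : cut 4 d.φ = d.φ := d.φcut
  have h1 : (1 - mB (X.tau h d.m) ∘L P 4) (X.tau h d.φ) = X.tau h d.ψ := by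
    rw [sub_apply, one_apply_eq_self, ContinuousLinearMap.comp_apply, P_tau 4 d.φ h hc (d.tcut h hh)]
    have e : mB (X.tau h d.m) (X.tau h (P 4 d.φ)) = X.tau h (d.t d.φ) := by
      ext z
      simp [t, mB_apply]
    rw [e, ← map_sub]
    congr 1
    rw [sub_eq_iff_eq_add']; exact d.φ_eq
  have hn : ‖mB (X.tau h d.m) ∘L (P 4 : X F →L[ℝ] X F)‖ < 1 := by
    refine (ContinuousLinearMap.opNorm_comp_le _ _).trans_lt ?_
    refine lt_of_le_of_lt (mul_le_mul_of_nonneg_right ?_ (norm_nonneg _)) d.small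
    refine ContinuousLinearMap.opNorm_le_bound _ (norm_nonneg _) fun y => ?_
    have e : mB (X.tau h d.m) y = X.tau h (mB d.m (X.tau (-h) y)) := by
      ext z
      simp [mB_apply]
    rw [e, X.norm_tau]
    exact ((mB d.m).le_opNorm _).trans (by rw [X.norm_tau])
  have h2 : Ring.inverse (1 - mB (X.tau h d.m) ∘L P 4) * (1 - mB (X.tau h d.m) ∘L (P 4 : X F →L[ℝ] X F)) = 1 :=
    Ring.inverse_mul_cancel _ ⟨Units.oneSub _ hn, rfl⟩
  have := congrArg (fun S => S (X.tau h d.φ)) h2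
  simp only [mul_apply_eq_comp, one_apply_eq_self] at this
  rw [h1] at this
  exact this.symm

theorem sm_φ {k : ℕ} (hm : Sm k d.m) (hψ : Sm k d.ψ) : Sm k d.φ := by
  refine Sm.of_at ?_
  have h1 : (fun h : ℂ => X.tau h d.φ) =ᶠ[𝓝 0] fun h => Ring.inverse (1 - mB (X.tau h d.m) ∘L P 4) (X.tau h d.ψ) := by
    filter_upwards [ball_mem_nhds (0:ℂ) one_pos] with h hh
    exact d.tau_φ h (by simpa using hh)
  refine ContDiffAt.congr_of_eventuallyEq ?_ h1
  refine ContDiffAt.clm_apply ?_ hψ.contDiffAt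
  have e : (fun h => Ring.inverse (1 - mB (X.tau h d.m) ∘L P 4)) = Ring.inverse ∘ fun h : ℂ => ((1 : X F →L[ℝ] X F) - mB (X.tau h d.m) ∘L P 4) := rfl
  rw [e]
  have hu : (1 : X F →L[ℝ] X F) - mB (X.tau 0 d.m) ∘L P 4 = Units.oneSub _ d.t_norm := by
    have : X.tau 0 d.m = d.m := by ext z; simp
    rw [this]; rfl
  refine ContDiffAt.comp _ (by rw [hu]; exact contDiffAt_ringInverse ℝ _) ?_
  refine contDiffAt_const.sub (ContDiffAt.clm_comp ?_ contDiffAt_const)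
  exact ((X.bil (ContinuousLinearMap.id ℝ (F →L[ℝ] F))).contDiff.comp hm).contDiffAt

theorem sm_v {k : ℕ} (hm : Sm k d.m) (hψ : Sm k d.ψ) {w : X F} (hw : ∀ z, w z = d.v z) : Sm (k+1) w := by
  have h1 : w = T 4 d.φ := by ext z; rw [hw, d.T_eq]
  rw [h1]
  refine Sm.succ (D := Dop 4 d.φ) ?_ (T_deriv 4 d.φ)
  have hφ := d.sm_φ hm hψ
  refine Sm.of_at ?_
  have hc : cut 4 d.φ = d.φ := d.φcut
  have h1 : (fun h : ℂ => X.tau h (Dop 4 d.φ)) =ᶠ[𝓝 0] fun h => Dop 4 (X.tau h d.φ) := by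
    filter_upwards [ball_mem_nhds (0:ℂ) one_pos] with h hh
    exact (Dop_tau 4 d.φ h hc (d.tcut h (by simpa using hh))).symm
  refine ContDiffAt.congr_of_eventuallyEq ?_ h1
  exact ((Dop 4).contDiff.comp hφ).contDiffAt

end Lr
end lr
end JH

namespace JH
open scoped ContDiff
section lb
variable {E F G : Type} [NormedAddCommGroup E] [NormedSpace ℝ E] [NormedAddCommGroup F] [NormedSpace ℝ F]
  [NormedAddCommGroup G] [NormedSpace ℝ G]

def LB (f : ℂ → E) : Prop := ∃ C, 0 ≤ C ∧ (∀ z, ‖f z‖ ≤ C) ∧ ∀ z w, ‖f z - f w‖ ≤ C * ‖z - w‖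

theorem LB.bil {u : ℂ → E} {v : ℂ → F} (hu : LB u) (hv : LB v) (L : E →L[ℝ] F →L[ℝ] G) : LB (fun z => L (u z) (v z)) := by
  obtain ⟨A, hA, a1, a2⟩ := hu
  obtain ⟨B, hB, b1, b2⟩ := hv
  refine ⟨2 * ‖L‖ * A * B, by positivity, fun z => ?_, fun z w => ?_⟩
  · refine (L.le_opNorm₂ _ _).trans ?_
    have : ‖L‖ * ‖u z‖ * ‖v z‖ ≤ ‖L‖ * A * B := by gcongr; exacts [a1 z, b1 z]
    have h2 : 0 ≤ ‖L‖ * A * B := by positivity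
    linarith
  · have e : L (u z) (v z) - L (u w) (v w) = L (u z - u w) (v z) + L (u w) (v z - v w) := by
      simp
    rw [e]
    have h1 : ‖L (u z - u w) (v z)‖ ≤ ‖L‖ * (A * ‖z - w‖) * B :=
      (L.le_opNorm₂ _ _).trans (by gcongr; exacts [a2 z w, b1 z])
    have h2 : ‖L (u w) (v z - v w)‖ ≤ ‖L‖ * A * (B * ‖z - w‖) :=
      (L.le_opNorm₂ _ _).trans (by gcongr; exacts [a1 w, b2 z w])
    refine (norm_add_le _ _).trans ((add_le_add h1 h2).trans (le_of_eq (by ring)))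

theorem LB.add {u v : ℂ → E} (hu : LB u) (hv : LB v) : LB (fun z => u z + v z) := by
  obtain ⟨A, hA, a1, a2⟩ := hu
  obtain ⟨B, hB, b1, b2⟩ := hv
  refine ⟨A + B, by positivity, fun z => (norm_add_le _ _).trans (add_le_add (a1 z) (b1 z)), fun z w => ?_⟩
  rw [add_sub_add_comm, add_mul]
  exact (norm_add_le _ _).trans (add_le_add (a2 z w) (b2 z w))

theorem LB.post {u : ℂ → E} (hu : LB u) (L : E →L[ℝ] F) : LB (fun z => L (u z)) := by
  obtain ⟨A, hA, a1, a2⟩ := hu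
  refine ⟨‖L‖ * A, by positivity, fun z => (L.le_opNorm _).trans (by gcongr; exact a1 z), fun z w => ?_⟩
  rw [← map_sub, mul_assoc]
  exact (L.le_opNorm _).trans (by gcongr; exact a2 z w)

theorem LB.comp {u : ℂ → E} (hu : LB u) {q : E → F} (hq : Cc q) : LB (fun z => q (u z)) := by
  obtain ⟨A, hA, a1, a2⟩ := hu
  obtain ⟨C, hC0, hC⟩ := hq.bdd
  obtain ⟨B, hB0, hB⟩ := hq.fderiv.bdd
  refine ⟨C + B * A, by positivity, fun z => (hC _).trans (by have : 0 ≤ B * A := by positivity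
                                                              linarith), fun z w => ?_⟩
  refine (lip_of hq.diff hB (u z) (u w)).trans ?_
  refine (mul_le_mul_of_nonneg_left (a2 z w) hB0).trans ?_
  have : 0 ≤ C * ‖z - w‖ := by positivity
  linarith

theorem LB.ex {u : ℂ → E} (hu : LB u) : ∃ C, Bd u C := by
  obtain ⟨A, hA, a1, a2⟩ := hu
  exact ⟨_, bd_of_lip a1 a2⟩

theorem Sm.zero {v : X E} (hv : LB v) : Sm 0 v := by
  obtain ⟨A, hA, a1, a2⟩ := hv
  refine Sm.of_at ?_
  have hb : ∀ h : ℂ, ‖X.tau h v - v‖ ≤ 2 * (A * ‖h‖ + √(2 * (A * ‖h‖) * (2 * A))) := fun h => by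
    refine X.norm_le_of_bd (bd_interp (fun z => ?_) (fun z w => ?_))
    · have := a2 (z + h) z
      rw [add_sub_cancel_left] at this
      simpa using this
    · have e : (X.tau h v - v) z - (X.tau h v - v) w = (v (z + h) - v (w + h)) - (v z - v w) := by
        simp only [X.sub_apply, X.tau_apply]; abel
      rw [e]
      have h1 := a2 (z + h) (w + h)
      rw [add_sub_add_right_eq_sub] at h1
      refine (_root_.norm_sub_le _ _).trans ((add_le_add h1 (a2 z w)).trans (le_of_eq (by ring)))
  have ht : Tendsto (fun h : ℂ => X.tau h v) (𝓝 0) (𝓝 v) := by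
    rw [tendsto_iff_norm_sub_tendsto_zero]
    refine squeeze_zero (fun _ => norm_nonneg _) hb ?_
    exact Continuous.tendsto' (by fun_prop) _ _ (by simp)
  have hc : Continuous (fun h : ℂ => X.tau h v) := by
    rw [continuous_iff_continuousAt]
    intro h0
    have e : (fun h : ℂ => X.tau h v) = fun h => X.tau h0 (X.tau (h - h0) v) := by
      funext h; rw [X.tau_tau]; congr 2; ring
    rw [e, ContinuousAt]
    have h2 : Tendsto (fun h => X.tau (h - h0) v) (𝓝 h0) (𝓝 v) := ht.comp (Continuous.tendsto' (by fun_prop) _ _ (by simp))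
    have h3 : X.tau (h0 - h0) v = v := by ext z; simp
    rw [h3]
    exact ((X.tau h0).continuous.tendsto v).comp h2
  exact (contDiff_zero.2 hc).contDiffAt

end lb

section amap
variable {E : Type} [NormedAddCommGroup E] [NormedSpace ℝ E] [FiniteDimensional ℝ E]

abbrev FF (E : Type) [NormedAddCommGroup E] [NormedSpace ℝ E] := (E →L[ℝ] ℝ) →L[ℝ] ℂ

def Am (J : E →L[ℝ] E) : E →L[ℝ] FF E :=
  (ContinuousLinearMap.compL ℝ (E →L[ℝ] ℝ) ℝ ℂ Complex.ofRealCLM) ∘L (ContinuousLinearMap.apply ℝ ℝ) -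
  (ContinuousLinearMap.compL ℝ (E →L[ℝ] ℝ) ℝ ℂ (Complex.I • Complex.ofRealCLM)) ∘L (ContinuousLinearMap.apply ℝ ℝ) ∘L J

theorem Am_apply (J : E →L[ℝ] E) (v : E) (l : E →L[ℝ] ℝ) : Am J v l = (l v : ℂ) - Complex.I * (l (J v) : ℂ) := by
  simp [Am]

theorem Am_I {J : E →L[ℝ] E} (hJ : ∀ v, J (J v) = -v) (v : E) : Am J (J v) = Complex.I • Am J v := by
  ext l
  rw [Am_apply, hJ, smul_apply, Am_apply, smul_eq_mul, mul_sub, ← mul_assoc, Complex.I_mul_I]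
  simp; ring

theorem Am_norm (J : E →L[ℝ] E) (v : E) : ‖v‖ ≤ ‖Am J v‖ := by
  obtain ⟨l, hl, hv⟩ := exists_dual_vector'' ℝ v
  have h1 := (Am J v).le_opNorm l
  have h2 : ‖v‖ ≤ ‖Am J v l‖ := by
    have : (Am J v l).re = ‖v‖ := by rw [Am_apply, hv]; simp
    rw [← this]; exact (le_abs_self _).trans (Complex.abs_re_le_norm _)
  calc ‖v‖ ≤ _ := h2
    _ ≤ _ := h1
    _ ≤ ‖Am J v‖ * 1 := by gcongr
    _ = _ := mul_one _

theorem Am_opNorm (J : E →L[ℝ] E) : ‖Am J‖ ≤ 1 + ‖J‖ := by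
  refine ContinuousLinearMap.opNorm_le_bound _ (by positivity) fun v => ?_
  refine ContinuousLinearMap.opNorm_le_bound _ (by positivity) fun l => ?_
  rw [Am_apply]
  refine (norm_sub_le _ _).trans ?_
  rw [norm_mul, Complex.norm_I, Complex.norm_real, Complex.norm_real, one_mul]
  have h1 := l.le_opNorm v
  have h2 := l.le_opNorm (J v)
  have h3 := mul_le_mul_of_nonneg_left (J.le_opNorm v) (norm_nonneg l)
  nlinarith

theorem Am_left (J : E →L[ℝ] E) : ∃ A' : FF E →L[ℝ] E, ∀ v, A' (Am J v) = v := by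
  have hinj : LinearMap.ker (Am J : E →ₗ[ℝ] FF E) = ⊥ := by
    rw [LinearMap.ker_eq_bot']
    intro v hv
    have := Am_norm J v
    have h2 : Am J v = 0 := hv
    rw [h2, norm_zero] at this
    exact norm_le_zero_iff.1 this
  obtain ⟨g, hg⟩ := LinearMap.exists_leftInverse_of_injective _ hinj
  exact ⟨LinearMap.toContinuousLinearMap g, fun v => congrArg (fun h => h v) hg⟩

end amap
end JH

namespace JH
open scoped ContDiff

theorem cc_ext {E F : Type} [NormedAddCommGroup E] [NormedSpace ℝ E] [FiniteDimensional ℝ E] [NormedAddCommGroup F] [NormedSpace ℝ F]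
    {U : Set E} (hU : IsOpen U) {g : E → F} (hg : ContDiffOn ℝ ∞ g U) {x : E} (hx : x ∈ U) :
    ∃ q : E → F, ∃ ρ > 0, Cc q ∧ ∀ y, ‖y - x‖ ≤ ρ → y ∈ U ∧ q y = g y := by
  obtain ⟨ρ, hρ, hb⟩ := Metric.isOpen_iff.1 hU x hx
  let b : ContDiffBump x := ⟨ρ/3, ρ/2, by positivity, by linarith⟩
  refine ⟨fun y => b y • g y, ρ/3, by positivity, ⟨?_, ?_⟩, fun y hy => ?_⟩
  · rw [contDiff_iff_contDiffAt]
    intro y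
    by_cases hy : y ∈ ball x ρ
    · exact (b.contDiff.contDiffAt).smul (hg.contDiffAt (hU.mem_nhds (hb hy)))
    · have hy' : y ∈ (tsupport b)ᶜ := by
        rw [b.tsupport_eq]
        intro h
        apply hy
        have h1 : dist y x ≤ ρ / 2 := h
        rw [mem_ball]; linarith
      have : (fun y => b y • g y) =ᶠ[𝓝 y] fun _ => 0 := by
        filter_upwards [(isClosed_tsupport b).isOpen_compl.mem_nhds hy'] with w hw
        rw [image_eq_zero_of_notMem_tsupport hw, zero_smul]
      exact contDiffAt_const.congr_of_eventuallyEq this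
  · exact b.hasCompactSupport.smul_right
  · have hm : y ∈ closedBall x (ρ/3) := by rw [mem_closedBall, dist_eq_norm]; exact hy
    refine ⟨hb (by rw [mem_ball, dist_eq_norm]; linarith), ?_⟩
    change b y • g y = g y
    rw [b.one_of_mem_closedBall hm, one_smul]

def ts (s : ℝ) (z : ℂ) : ℝ := th (s⁻¹ • z)

theorem th_cc : Cc th := ⟨th_cd, HasCompactSupport.intro (isCompact_closedBall (0:ℂ) 1) fun z hz => th_zero (by
  rw [mem_closedBall, dist_zero_right, not_le] at hz; linarith)⟩

theorem ts_zero {s : ℝ} (hs : 0 < s) {z : ℂ} (h : 3 / 4 * s ≤ ‖z‖) : ts s z = 0 := by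
  refine th_zero ?_
  rw [norm_smul, Real.norm_of_nonneg (by positivity), inv_mul_eq_div, le_div_iff₀ hs]; exact h

theorem ts_one {s : ℝ} (hs : 0 < s) {z : ℂ} (h : ‖z‖ ≤ s / 2) : ts s z = 1 := by
  refine th_one ?_
  rw [norm_smul, Real.norm_of_nonneg (by positivity), inv_mul_eq_div, div_le_iff₀ hs]; linarith

theorem ts_cc {s : ℝ} (hs : 0 < s) : Cc (ts s) :=
  ⟨th_cd.comp (contDiff_const_smul _), HasCompactSupport.intro (isCompact_closedBall (0:ℂ) s) fun z hz => ts_zero hs (by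
    rw [mem_closedBall, dist_zero_right, not_le] at hz; linarith)⟩

theorem ts_fd0 {s : ℝ} (hs : 0 < s) {z : ℂ} (h : 3 / 4 * s < ‖z‖) : fderiv ℝ (ts s) z = 0 := by
  have : ts s =ᶠ[𝓝 z] fun _ => 0 := by
    filter_upwards [(isOpen_lt continuous_const continuous_norm).mem_nhds h] with w hw using ts_zero hs (le_of_lt hw)
  rw [this.fderiv_eq]; simp

theorem ts_bd : ∃ C, 0 ≤ C ∧ ∀ s, 0 < s → ∀ z, ‖ts s z‖ ≤ C ∧ ‖fderiv ℝ (ts s) z‖ ≤ C * s⁻¹ := by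
  obtain ⟨A, hA, a⟩ := th_cc.bdd
  obtain ⟨B, hB, b⟩ := th_cc.fderiv.bdd
  refine ⟨A + B, by positivity, fun s hs z => ⟨(a _).trans (by linarith), ?_⟩⟩
  have h1 : HasFDerivAt (ts s) (fderiv ℝ th (s⁻¹ • z) ∘L (s⁻¹ • ContinuousLinearMap.id ℝ ℂ)) z :=
    ((th_cc.diff _).hasFDerivAt).comp z ((ContinuousLinearMap.id ℝ ℂ).hasFDerivAt.const_smul s⁻¹)
  rw [h1.fderiv]
  refine (ContinuousLinearMap.opNorm_comp_le _ _).trans ?_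
  have h2 : ‖s⁻¹ • ContinuousLinearMap.id ℝ ℂ‖ ≤ s⁻¹ := by
    rw [norm_smul, Real.norm_of_nonneg (by positivity)]
    exact mul_le_of_le_one_right (by positivity) ContinuousLinearMap.norm_id_le
  exact mul_le_mul ((b _).trans (by linarith)) h2 (norm_nonneg _) (by positivity)

structure Cv (E : Type) [NormedAddCommGroup E] [NormedSpace ℝ E] where
  Ω : Set E
  hΩ : IsOpen Ω
  J : E → E →L[ℝ] E
  hJ : ContDiffOn ℝ ∞ J Ω
  hJ2 : ∀ x ∈ Ω, ∀ v, J x (J x v) = -v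
  f : ℂ → E
  D : ℂ → ℂ →L[ℝ] E
  r0 : ℝ
  hr0 : 0 < r0
  L : ℝ
  hL : 0 ≤ L
  hf : ∀ z, ‖z‖ < r0 → f z ∈ Ω
  hD : ∀ z, ‖z‖ < r0 → HasFDerivAt f (D z) z
  heq : ∀ z, ‖z‖ < r0 → D z Complex.I = J (f z) (D z 1)
  hlip : ∀ z w, ‖z‖ < r0 → ‖w‖ < r0 → ‖f z - f w‖ ≤ L * ‖z - w‖

namespace Cv
variable {E : Type} [NormedAddCommGroup E] [NormedSpace ℝ E] [FiniteDimensional ℝ E] (c : Cv E)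

def W (s : ℝ) (z : ℂ) : E := ts s z • (c.f z - c.f 0)
def DW (s : ℝ) (z : ℂ) : ℂ →L[ℝ] E := ts s z • c.D z + (fderiv ℝ (ts s) z).smulRight (c.f z - c.f 0)

theorem f_le {z : ℂ} (hz : ‖z‖ < c.r0) : ‖c.f z - c.f 0‖ ≤ c.L * ‖z‖ := by
  simpa using c.hlip z 0 hz (by simpa using c.hr0)

theorem D_le {z : ℂ} (hz : ‖z‖ < c.r0) : ‖c.D z‖ ≤ c.L := by
  refine HasFDerivAt.le_of_lip' (c.hD z hz) c.hL ?_
  filter_upwards [(isOpen_lt continuous_norm continuous_const).mem_nhds hz] with w hw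
  exact c.hlip w z hw hz

theorem W_deriv {s : ℝ} (hs : 0 < s) (hs' : s ≤ c.r0) (z : ℂ) : HasFDerivAt (c.W s) (c.DW s z) z := by
  by_cases hz : ‖z‖ < c.r0
  · have h1 := ((ts_cc hs).diff z).hasFDerivAt
    exact h1.smul ((c.hD z hz).sub_const (c.f 0))
  · have h : 3 / 4 * s < ‖z‖ := by linarith [not_lt.1 hz]
    have e : c.W s =ᶠ[𝓝 z] fun _ => 0 := by
      filter_upwards [(isOpen_lt continuous_const continuous_norm).mem_nhds h] with w hw
      rw [W, ts_zero hs (le_of_lt hw), zero_smul]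
    have e2 : c.DW s z = 0 := by
      rw [DW, ts_fd0 hs h, ts_zero hs h.le]; ext; simp
    rw [e2]
    exact (hasFDerivAt_const (0:E) z).congr_of_eventuallyEq e

theorem W_bd : ∃ C, 0 ≤ C ∧ ∀ s, 0 < s → s ≤ c.r0 → (∀ z, ‖c.W s z‖ ≤ C * s) ∧ ∀ z w, ‖c.W s z - c.W s w‖ ≤ C * ‖z - w‖ := by
  obtain ⟨C, hC, h⟩ := ts_bd
  have hL := c.hL
  refine ⟨2 * C * c.L, by positivity, fun s hs hs' => ⟨fun z => ?_, ?_⟩⟩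
  · by_cases hz : ‖z‖ < s
    · rw [W, norm_smul]
      have h1 := mul_le_mul (h s hs z).1 (c.f_le (by linarith : ‖z‖ < c.r0)) (norm_nonneg _) hC
      have h2 : C * (c.L * ‖z‖) ≤ C * (c.L * s) := by gcongr
      have h3 : 0 ≤ C * (c.L * s) := by positivity
      linarith
    · rw [W, ts_zero hs (by linarith [not_lt.1 hz]), zero_smul, norm_zero]; positivity
  · have hd : Differentiable ℝ (c.W s) := fun z => (c.W_deriv hs hs' z).differentiableAt
    refine lip_of hd fun z => ?_
    rw [(c.W_deriv hs hs' z).fderiv]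
    by_cases hz : ‖z‖ < s
    · have hz' : ‖z‖ < c.r0 := by linarith
      rw [DW]
      refine (norm_add_le _ _).trans ?_
      rw [norm_smul, ContinuousLinearMap.norm_smulRight_apply]
      have h1 := mul_le_mul (h s hs z).1 (c.D_le hz') (norm_nonneg _) hC
      have h2 := mul_le_mul (h s hs z).2 (c.f_le hz') (norm_nonneg _) (by positivity)
      have h3 : C * s⁻¹ * (c.L * ‖z‖) ≤ C * s⁻¹ * (c.L * s) := by gcongr
      have h4 : C * s⁻¹ * (c.L * s) = C * c.L := by field_simp
      linarith
    · have e2 : c.DW s z = 0 := by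
        have h : 3 / 4 * s < ‖z‖ := by linarith [not_lt.1 hz]
        rw [DW, ts_fd0 hs h, ts_zero hs h.le]; ext; simp
      rw [e2, norm_zero]; positivity

theorem W_LB {s : ℝ} (hs : 0 < s) (hs' : s ≤ c.r0) : LB (c.W s) := by
  obtain ⟨C, hC, h⟩ := c.W_bd
  obtain ⟨h1, h2⟩ := h s hs hs'
  refine ⟨C * s + C, by positivity, fun z => (h1 z).trans (by linarith), fun z w => (h2 z w).trans ?_⟩
  have : 0 ≤ C * s * ‖z - w‖ := by positivity
  linarith

open Classical in
def WX (s : ℝ) : X E := if h : 0 < s ∧ s ≤ c.r0 then X.of (c.W s) (c.W_LB h.1 h.2).ex else 0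

theorem WX_apply {s : ℝ} (hs : 0 < s) (hs' : s ≤ c.r0) (z : ℂ) : c.WX s z = c.W s z := by
  rw [WX, dif_pos ⟨hs, hs'⟩]; exact X.of_apply _ _ z

theorem WX_tendsto : Tendsto c.WX (𝓝[>] 0) (𝓝 0) := by
  obtain ⟨C, hC, h⟩ := c.W_bd
  rw [tendsto_zero_iff_norm_tendsto_zero]
  have h2 : Tendsto (fun s => 2 * (C * s + √(2 * (C * s) * C))) (𝓝[>] 0) (𝓝 0) := by
    refine Tendsto.mono_left ?_ nhdsWithin_le_nhds
    exact Continuous.tendsto' (by fun_prop) _ _ (by simp)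
  refine tendsto_of_tendsto_of_tendsto_of_le_of_le' tendsto_const_nhds h2 (Eventually.of_forall fun _ => norm_nonneg _) ?_
  filter_upwards [self_mem_nhdsWithin, nhdsWithin_le_nhds (Iio_mem_nhds c.hr0)] with s h1 h2
  obtain ⟨h3, h4⟩ := h s h1 (le_of_lt h2)
  have e : (c.WX s : ℂ → E) = c.W s := funext (c.WX_apply h1 (le_of_lt h2))
  refine X.norm_le_of_bd ?_
  rw [e]
  exact bd_interp h3 h4

theorem sm_zero {s : ℝ} (hs : 0 < s) (hs' : s ≤ c.r0) : Sm 0 (c.WX s) := by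
  refine Sm.zero ?_
  have e : (c.WX s : ℂ → E) = c.W s := funext (c.WX_apply hs hs')
  rw [e]; exact c.W_LB hs hs'

end Cv
end JH

namespace JH
open scoped ContDiff

theorem Cc.ap {F : Type} [NormedAddCommGroup F] [NormedSpace ℝ F] {q : ℂ → ℂ →L[ℝ] F} (h : Cc q) (ξ : ℂ) : Cc (fun z => q z ξ) :=
  ⟨h.1.clm_apply contDiff_const, h.2.comp_left (g := fun l : ℂ →L[ℝ] F => l ξ) (by simp)⟩

theorem LB_cc {F : Type} [NormedAddCommGroup F] [NormedSpace ℝ F] {q : ℂ → F} (hq : Cc q) : LB q := by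
  obtain ⟨C, hC0, hC⟩ := hq.bdd
  obtain ⟨B, hB0, hB⟩ := hq.fderiv.bdd
  refine ⟨C + B, by positivity, fun z => (hC _).trans (by linarith), fun z w => (lip_of hq.diff hB z w).trans ?_⟩
  have : 0 ≤ C * ‖z - w‖ := by positivity
  linarith

namespace Cv
variable {E : Type} [NormedAddCommGroup E] [NormedSpace ℝ E] [FiniteDimensional ℝ E] (c : Cv E)

def smF : ℝ →L[ℝ] FF E →L[ℝ] FF E := ContinuousLinearMap.lsmul ℝ ℝ
def iF : FF E →L[ℝ] FF E := ((Complex.I • ContinuousLinearMap.id ℂ (FF E)).restrictScalars ℝ)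

theorem mem0 : c.f 0 ∈ c.Ω := c.hf 0 (by simpa using c.hr0)

theorem data : ∃ A' : FF E →L[ℝ] E, ∃ q : E → (FF E →L[ℝ] FF E), ∃ hq : Cc q, ∃ s0 > 0, s0 ≤ c.r0 ∧ s0 ≤ 1 ∧ (∀ v, A' (Am (c.J (c.f 0)) v) = v) ∧ q 0 = 0 ∧
    ∀ s, 0 < s → s ≤ s0 → (‖mB (Cq q hq (fun _ => 0) base_zero (c.WX s))‖ * ‖(P 4 : X (FF E) →L[ℝ] X (FF E))‖ < 1) ∧
      ∀ z, ‖z‖ < s → q (c.f z - c.f 0) = Am (c.J (c.f 0)) ∘L (c.J (c.f 0) - c.J (c.f z)) ∘L A' := by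
  obtain ⟨A', hA'⟩ := Am_left (c.J (c.f 0))
  let g : E → (FF E →L[ℝ] FF E) := fun y => Am (c.J (c.f 0)) ∘L (c.J (c.f 0) - c.J (c.f 0 + y)) ∘L A'
  have hU : IsOpen ((fun y => c.f 0 + y) ⁻¹' c.Ω) := c.hΩ.preimage (by fun_prop)
  have hg : ContDiffOn ℝ ∞ g ((fun y => c.f 0 + y) ⁻¹' c.Ω) := by
    refine contDiffOn_const.clm_comp (ContDiffOn.clm_comp (contDiffOn_const.sub ?_) contDiffOn_const)
    exact c.hJ.comp (contDiff_const.add contDiff_id).contDiffOn (fun y hy => hy)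
  obtain ⟨q, ρ, hρ, hq, hqg⟩ := cc_ext hU hg (x := 0) (by simpa using c.mem0)
  have hq0 : q 0 = 0 := by
    rw [(hqg 0 (by simpa using hρ.le)).2]; simp [g]
  have h1 : Tendsto (fun s => ‖mB (Cq q hq (fun _ => 0) base_zero (c.WX s))‖ * ‖(P 4 : X (FF E) →L[ℝ] X (FF E))‖) (𝓝[>] 0) (𝓝 0) := by
    have hc : Continuous fun y => ‖mB (Cq q hq (fun _ => 0) base_zero y)‖ * ‖(P 4 : X (FF E) →L[ℝ] X (FF E))‖ := by
      refine Continuous.mul ?_ continuous_const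
      refine continuous_norm.comp ?_
      exact (X.bil (ContinuousLinearMap.id ℝ (FF E →L[ℝ] FF E))).continuous.comp (Cq_cd q hq _ base_zero).continuous
    have h0 : Cq q hq (fun _ => 0) base_zero 0 = 0 := by
      refine X.ext fun z => ?_
      exact (Cq_apply q hq (fun _ => 0) base_zero 0 z).trans (by simp [hq0])
    have h3 := (hc.tendsto 0).comp c.WX_tendsto
    simp only [h0] at h3
    have e0 : mB (0 : X (FF E →L[ℝ] FF E)) = 0 := by simp [mB]
    rw [e0, norm_zero, zero_mul] at h3
    exact h3
  have h2 : Tendsto (fun s : ℝ => c.L * s) (𝓝[>] 0) (𝓝 0) :=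
    Tendsto.mono_left (Continuous.tendsto' (by fun_prop) _ _ (by simp)) nhdsWithin_le_nhds
  have h3 := (h1.eventually (Iio_mem_nhds one_pos)).and (h2.eventually (Iio_mem_nhds hρ))
  obtain ⟨s1, hs1, hs⟩ := mem_nhdsGT_iff_exists_Ioc_subset.1 h3
  have hs1' : 0 < s1 := hs1
  refine ⟨A', q, hq, min s1 (min c.r0 1), lt_min hs1 (lt_min c.hr0 one_pos), (min_le_right _ _).trans (min_le_left _ _),
    (min_le_right _ _).trans (min_le_right _ _), hA', hq0, fun s hs0 hss => ?_⟩
  obtain ⟨h4, h5⟩ := hs ⟨hs0, hss.trans (min_le_left _ _)⟩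
  refine ⟨h4, fun z hz => ?_⟩
  have hz' : ‖z‖ < c.r0 := hz.trans_le (hss.trans ((min_le_right _ _).trans (min_le_left _ _)))
  have h6 : c.L * s < ρ := h5
  have h7 := c.f_le hz'
  have h8 : c.L * ‖z‖ ≤ c.L * s := mul_le_mul_of_nonneg_left hz.le c.hL
  rw [(hqg _ (by rw [sub_zero]; linarith)).2]
  simp [g]

set_option maxHeartbeats 1000000 in
theorem step : ∃ s0 > 0, s0 ≤ c.r0 ∧ ∀ (k : ℕ) s, 0 < s → s ≤ s0 → Sm k (c.WX s) → Sm (k+1) (c.WX (s/2)) := by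
  obtain ⟨A', q, hq, s0, hs0, hsr, hs1, hA', hq0, hh⟩ := c.data
  refine ⟨s0, hs0, hsr, fun k s hs hss hk => ?_⟩
  obtain ⟨hsm, hqe⟩ := hh s hs hss
  let A := Am (c.J (c.f 0))
  have hs2 : 0 < s / 2 := by positivity
  have hsr' : s ≤ c.r0 := hss.trans hsr
  have hsr2 : s / 2 ≤ c.r0 := by linarith
  have hκ := (ts_cc hs2).fderiv
  let m : X (FF E →L[ℝ] FF E) := Cq q hq (fun _ => 0) base_zero (c.WX s)
  let k1 : X ℝ := Cq _ (hκ.ap 1) (fun z => z) (fun _ _ => le_rfl) 0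
  let kI : X ℝ := Cq _ (hκ.ap Complex.I) (fun z => z) (fun _ _ => le_rfl) 0
  let a1 : X (FF E) := X.post A (c.WX s)
  let ψ : X (FF E) := X.bil smF k1 a1 + X.post iF (X.bil smF kI a1) + mB m (X.post (-ContinuousLinearMap.id ℝ _) (X.bil smF kI a1))
  have ha1 : ∀ z, a1 z = A (c.W s z) := fun z => by
    refine (X.post_apply _ _ _).trans ?_
    rw [c.WX_apply hs hsr']
  have hm : ∀ z, m z = q (c.W s z) := fun z => by
    refine (Cq_apply _ _ _ _ _ _).trans ?_
    rw [c.WX_apply hs hsr', zero_add]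
  have hk1 : ∀ z, k1 z = fderiv ℝ (ts (s/2)) z 1 := fun z => by
    refine (Cq_apply _ _ _ _ _ _).trans ?_
    simp
  have hkI : ∀ z, kI z = fderiv ℝ (ts (s/2)) z Complex.I := fun z => by
    refine (Cq_apply _ _ _ _ _ _).trans ?_
    simp
  have hψ : ∀ z, ψ z = k1 z • a1 z + Complex.I • (kI z • a1 z) + m z (-(kI z • a1 z)) := fun z => rfl
  have sa1 : Sm k a1 := hk.post A
  have sm : Sm k m := hk.comp q hq
  have sI : Sm k (X.bil smF kI a1) := (Sm.cc _ _).bil sa1 _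
  have sψ : Sm k ψ := (((Sm.cc _ _).bil sa1 _).add (sI.post _)).add (sm.bil (sI.post _) _)
  have lm : LB m := by
    have : (m : ℂ → _) = fun z => q (c.W s z) := funext hm
    rw [this]; exact (c.W_LB hs hsr').comp hq
  have la : LB a1 := by
    have : (a1 : ℂ → _) = fun z => A (c.W s z) := funext ha1
    rw [this]; exact (c.W_LB hs hsr').post A
  have lI : LB (X.bil smF kI a1) := by
    have h1 : LB kI := by
      have : (kI : ℂ → _) = fun z => fderiv ℝ (ts (s/2)) z Complex.I := funext hkI
      rw [this]; exact LB_cc (hκ.ap _)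
    exact h1.bil la smF
  have l1 : LB (X.bil smF k1 a1) := by
    have h1 : LB k1 := by
      have : (k1 : ℂ → _) = fun z => fderiv ℝ (ts (s/2)) z 1 := funext hk1
      rw [this]; exact LB_cc (hκ.ap _)
    exact h1.bil la smF
  have lψ : LB ψ := (l1.add (lI.post iF)).add (lm.bil (lI.post (-ContinuousLinearMap.id ℝ _)) (ContinuousLinearMap.id ℝ _))
  have lv : LB (fun z => A (c.W (s/2) z)) := (c.W_LB hs2 hsr2).post A
  obtain ⟨C1, hC1, -, d1⟩ := lm
  obtain ⟨C2, hC2, -, d2⟩ := lψ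
  obtain ⟨C3, hC3, -, d3⟩ := lv
  have up : ∀ {x C : ℝ} {z w : ℂ}, x ≤ C * ‖z - w‖ → C ≤ C1 + C2 + C3 → x ≤ (C1 + C2 + C3) * ‖z - w‖ := fun h h' =>
    h.trans (mul_le_mul_of_nonneg_right h' (norm_nonneg _))
  have hz0 : ∀ z, 3/4 * (s/2) < ‖z‖ → k1 z = 0 ∧ kI z = 0 := fun z hz => by
    rw [hk1, hkI, ts_fd0 hs2 hz]; simp
  have hψ0 : ∀ z, 3/4 * (s/2) < ‖z‖ → ψ z = 0 := fun z hz => by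
    rw [hψ, (hz0 z hz).1, (hz0 z hz).2]; simp
  let d : Lr (FF E) :=
    { m := m, ψ := ψ, v := fun z => A (c.W (s/2) z), D := fun z => A ∘L c.DW (s/2) z, L := C1 + C2 + C3
      hmL := fun z w => up (d1 z w) (by linarith)
      hψL := fun z w => up (d2 z w) (by linarith)
      hvL := fun z w => up (d3 z w) (by linarith)
      hD := fun z => A.hasFDerivAt.comp z (c.W_deriv hs2 hsr2 z)
      eq := fun z => by
        rw [hψ, hk1, hkI, ha1, hm]
        simp only [ContinuousLinearMap.comp_apply, DW, add_apply, smul_apply, ContinuousLinearMap.smulRight_apply]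
        by_cases hz : ‖z‖ < s / 2
        · have hz' : ‖z‖ < c.r0 := by linarith
          have e1 : c.W s z = c.f z - c.f 0 := by rw [W, ts_one hs hz.le, one_smul]
          rw [e1, hqe z (by linarith)]
          have e2 : c.D z 1 = - c.J (c.f z) (c.D z Complex.I) := by
            rw [c.heq z hz', c.hJ2 _ (c.hf z hz'), neg_neg]
          have e3 : ∀ v, Complex.I • A v = A (c.J (c.f 0) v) := fun v => (Am_I (c.hJ2 _ c.mem0) v).symm
          have e4 : ∀ v, A' (A v) = v := hA'
          have hA : Am (c.J (c.f 0)) = A := rfl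
          have e5 : ∀ (x : ℝ) (v : E), Complex.I • x • A v = x • A (c.J (c.f 0) v) := fun x v => by rw [smul_comm, e3]
          rw [hA, e3]
          simp only [ContinuousLinearMap.comp_apply, sub_apply, map_add, map_smul, e4, map_neg, e5, e3, map_sub]
          rw [e2]
          simp only [map_neg, smul_neg, smul_sub]
          erw [e5, e5]
          abel
        · have h : 3 / 4 * (s/2) < ‖z‖ := by linarith [not_lt.1 hz]
          rw [ts_fd0 hs2 h, ts_zero hs2 h.le]; simp
      hv0 := fun z hz => by
        rw [W, ts_zero hs2 (by linarith)]; simp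
      hm0 := fun z hz => by
        rw [hm, W, ts_zero hs (by linarith), zero_smul, hq0]
      hψ0 := fun z hz => hψ0 z (by linarith)
      small := hsm }
  have h1 : Sm (k+1) (X.post A (c.WX (s/2))) := d.sm_v sm sψ fun z => by
    refine (X.post_apply _ _ _).trans ?_
    rw [c.WX_apply hs2 hsr2]
  have h2 := h1.post A'
  have e : X.post A' (X.post A (c.WX (s/2))) = c.WX (s/2) := by
    ext z
    refine (X.post_apply _ _ _).trans ?_
    rw [X.post_apply]; exact hA' _
  rwa [e] at h2

theorem reg (k : ℕ) : ContDiffAt ℝ k c.f 0 := by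
  obtain ⟨s0, hs0, hsr, hst⟩ := c.step
  have h : ∀ k : ℕ, ∃ s, 0 < s ∧ s ≤ s0 ∧ Sm k (c.WX s) := by
    intro k
    induction k with
    | zero => exact ⟨s0, hs0, le_rfl, c.sm_zero hs0 hsr⟩
    | succ k ih =>
      obtain ⟨s, h1, h2, h3⟩ := ih
      exact ⟨s/2, by positivity, by linarith, hst k s h1 h2 h3⟩
  obtain ⟨s, h1, h2, h3⟩ := h k
  have h4 : ContDiffAt ℝ k (fun z => c.WX s z + c.f 0) 0 := (h3.contDiff.add contDiff_const).contDiffAt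
  refine h4.congr_of_eventuallyEq ?_
  filter_upwards [ball_mem_nhds (0:ℂ) (show 0 < s/2 by positivity)] with z hz
  have hz' : ‖z‖ < s/2 := by simpa using hz
  change c.f z = c.WX s z + c.f 0
  rw [c.WX_apply h1 (h2.trans hsr), W, ts_one h1 hz'.le, one_smul, sub_add_cancel]

end Cv
end JH

namespace JH
open scoped ContDiff

theorem dbar_core (G : Type) [NormedAddCommGroup G] [NormedSpace ℝ G] [NormedSpace ℂ G] [IsScalarTower ℝ ℂ G] [CompleteSpace G] :
    ∃ C, 0 ≤ C ∧ ∀ (v : ℂ → G) (M : ℝ), Cc v → (∀ z, 1 < ‖z‖ → v z = 0) →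
      (∀ z, ‖fderiv ℝ v z 1 + Complex.I • fderiv ℝ v z Complex.I‖ ≤ M * ‖z‖) → ‖fderiv ℝ v 0‖ ≤ C * M := by
  obtain ⟨C, hC, h⟩ := Dop_zero G 1
  refine ⟨C, hC, fun v M hv hv0 hM => ?_⟩
  have hcd : ContDiff ℝ 1 (fun z => fderiv ℝ v z 1 + Complex.I • fderiv ℝ v z Complex.I) := by
    have h1 : ContDiff ℝ 1 (fderiv ℝ v) := hv.fderiv.1.of_le (by simp)
    refine (h1.clm_apply contDiff_const).add ?_
    exact ((Complex.I • ContinuousLinearMap.id ℂ G).restrictScalars ℝ).contDiff.comp (h1.clm_apply contDiff_const)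
  have hz : ∀ z, 1 < ‖z‖ → fderiv ℝ v z 1 + Complex.I • fderiv ℝ v z Complex.I = 0 := by
    intro z hz
    have : v =ᶠ[𝓝 z] fun _ => 0 := by
      filter_upwards [(isOpen_lt continuous_const continuous_norm).mem_nhds hz] with w hw using hv0 w hw
    rw [this.fderiv_eq]; simp
  let φ : X G := X.of _ (bd_of_cd hcd hz)
  have hφ : ∀ z, φ z = fderiv ℝ v z 1 + Complex.I • fderiv ℝ v z Complex.I := fun z => rfl
  have hc : cut 1 φ = φ := cut_eq 1 φ fun z h1 => by
    refine (hφ z).trans (hz z ?_)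
    push_cast at h1
    by_contra h2
    have := norm_nonneg z
    nlinarith
  have hT : ∀ z, T 1 φ z = v z := T_unique 1 φ (fun z => (hv.diff z).hasFDerivAt) (fun z => by rw [hc]; rfl) (by
    have := hv.2.is_zero_at_infty
    exact this)
  have hd := T_deriv 1 φ 0
  have : (fun z => T 1 φ z) = v := funext hT
  rw [this] at hd
  rw [hd.fderiv]
  exact h φ M fun z => by rw [hφ]; exact hM z

theorem cut_cd {F : Type} [NormedAddCommGroup F] [NormedSpace ℝ F] {u : ℂ → F} (hu : ContDiffOn ℝ ∞ u (ball 0 1)) :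
    Cc (fun w => th w • u w) := by
  refine ⟨?_, th_cc.2.smul_right⟩
  rw [contDiff_iff_contDiffAt]
  intro y
  by_cases hy : ‖y‖ < 1
  · exact th_cd.contDiffAt.smul (hu.contDiffAt (isOpen_ball.mem_nhds (by simpa using hy)))
  · have : (fun w => th w • u w) =ᶠ[𝓝 y] fun _ => 0 := by
      have h : (3:ℝ)/4 < ‖y‖ := by linarith
      filter_upwards [(isOpen_lt continuous_const continuous_norm).mem_nhds h] with w hw
      rw [th_zero (le_of_lt hw), zero_smul]
    exact contDiffAt_const.congr_of_eventuallyEq this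

theorem grad1 (E : Type) [NormedAddCommGroup E] [NormedSpace ℝ E] [FiniteDimensional ℝ E] :
    ∃ C, 0 ≤ C ∧ ∀ (J : E →L[ℝ] E) (g : ℂ → E) (o m : ℝ), (∀ v, J (J v) = -v) → ContDiffOn ℝ ∞ g (ball 0 1) → g 0 = 0 → 0 ≤ m → 0 ≤ o →
      (∀ w, ‖w‖ < 1 → ‖g w‖ ≤ o ∧ ‖fderiv ℝ g w 1 + J (fderiv ℝ g w Complex.I)‖ ≤ m * ‖w‖) →
      ‖fderiv ℝ g 0‖ ≤ C * (1 + ‖J‖) * (m + o) := by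
  obtain ⟨C, hC, h⟩ := dbar_core (FF E)
  obtain ⟨A, hA, a⟩ := th_cc.bdd
  obtain ⟨B, hB, b⟩ := th_cc.fderiv.bdd
  refine ⟨C * (A + 4 * B), by positivity, fun J g o m hJ hg g0 hm ho hb => ?_⟩
  set K := 1 + ‖J‖ with hK
  have hK0 : 0 ≤ K := by positivity
  let u : ℂ → FF E := fun w => Am J (g w)
  have hu : ContDiffOn ℝ ∞ u (ball 0 1) := (Am J).contDiff.comp_contDiffOn hg
  have hd : ∀ w, ‖w‖ < 1 → HasFDerivAt (fun w => th w • u w) (th w • (Am J ∘L fderiv ℝ g w) + (fderiv ℝ th w).smulRight (u w)) w := by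
    intro w hw
    have hgd : HasFDerivAt g (fderiv ℝ g w) w :=
      ((hg.contDiffAt (isOpen_ball.mem_nhds (by simpa using hw))).differentiableAt (by simp)).hasFDerivAt
    exact (th_cc.diff w).hasFDerivAt.smul ((Am J).hasFDerivAt.comp w hgd)
  have hAm : ∀ v, ‖Am J v‖ ≤ K * ‖v‖ := fun v => (Am J).le_of_opNorm_le (Am_opNorm J) v
  have key := h (fun w => th w • u w) ((A + 4 * B) * K * (m + o)) (cut_cd hu) (fun z hz => by
    simp only [th_zero (show 3/4 ≤ ‖z‖ by linarith), zero_smul]) fun w => by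
      have hR : 0 ≤ (A + 4 * B) * K * (m + o) * ‖w‖ := by positivity
      by_cases hw : ‖w‖ < 1
      · rw [(hd w hw).fderiv]
        have e3 : ∀ v, Complex.I • Am J v = Am J (J v) := fun v => (Am_I hJ v).symm
        have e1 : (th w • (Am J ∘L fderiv ℝ g w) + (fderiv ℝ th w).smulRight (u w)) 1
            + Complex.I • (th w • (Am J ∘L fderiv ℝ g w) + (fderiv ℝ th w).smulRight (u w)) Complex.I
            = th w • Am J (fderiv ℝ g w 1 + J (fderiv ℝ g w Complex.I)) + (fderiv ℝ th w 1 • u w + fderiv ℝ th w Complex.I • Complex.I • u w) := by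
          simp only [add_apply, smul_apply, ContinuousLinearMap.comp_apply, ContinuousLinearMap.smulRight_apply, smul_add, map_add]
          rw [smul_comm Complex.I (th w), smul_comm Complex.I (fderiv ℝ th w Complex.I), e3]
          abel
        rw [e1]
        obtain ⟨h1, h2⟩ := hb w hw
        have t1 : ‖th w • Am J (fderiv ℝ g w 1 + J (fderiv ℝ g w Complex.I))‖ ≤ A * (K * (m * ‖w‖)) := by
          rw [norm_smul]
          exact mul_le_mul (a w) ((hAm _).trans (mul_le_mul_of_nonneg_left h2 hK0)) (norm_nonneg _) hA
        have t2 : ‖fderiv ℝ th w 1 • u w + fderiv ℝ th w Complex.I • Complex.I • u w‖ ≤ 4 * B * K * o * ‖w‖ := by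
          by_cases hw2 : ‖w‖ < 1/2
          · have : th =ᶠ[𝓝 w] fun _ => 1 := by
              filter_upwards [(isOpen_lt continuous_norm continuous_const).mem_nhds hw2] with w hw using th_one (le_of_lt hw)
            rw [this.fderiv_eq]
            simp only [fderiv_fun_const, Pi.zero_apply, zero_apply, zero_smul, add_zero, norm_zero]
            positivity
          · have hu : ‖u w‖ ≤ K * o := (hAm _).trans (mul_le_mul_of_nonneg_left h1 hK0)
            have c1 : ∀ ξ : ℂ, ‖ξ‖ = 1 → ‖fderiv ℝ th w ξ‖ ≤ B := fun ξ hξ => by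
              have := (fderiv ℝ th w).le_of_opNorm_le (b w) ξ
              rwa [hξ, mul_one] at this
            have c2 : ‖fderiv ℝ th w 1 • u w‖ ≤ B * (K * o) := by
              rw [norm_smul]; exact mul_le_mul (c1 1 (by simp)) hu (norm_nonneg _) hB
            have c3 : ‖fderiv ℝ th w Complex.I • Complex.I • u w‖ ≤ B * (K * o) := by
              rw [norm_smul, norm_smul, Complex.norm_I, one_mul]
              exact mul_le_mul (c1 _ (by simp)) hu (norm_nonneg _) hB
            have c4 := norm_add_le (fderiv ℝ th w 1 • u w) (fderiv ℝ th w Complex.I • Complex.I • u w)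
            have c5 : 0 ≤ B * K * o := by positivity
            nlinarith
        refine (norm_add_le _ _).trans ((add_le_add t1 t2).trans ?_)
        have p1 : 0 ≤ A * K * o * ‖w‖ := by positivity
        have p2 : 0 ≤ B * K * m * ‖w‖ := by positivity
        nlinarith
      · have : (fun w => th w • u w) =ᶠ[𝓝 w] fun _ => 0 := by
          have h : (3:ℝ)/4 < ‖w‖ := by linarith
          filter_upwards [(isOpen_lt continuous_const continuous_norm).mem_nhds h] with w hw
          rw [th_zero (le_of_lt hw), zero_smul]
        rw [this.fderiv_eq]
        simpa using hR
  rw [(hd 0 (by simp)).fderiv] at key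
  have e0 : u 0 = 0 := by simp [u, g0]
  rw [e0, th_one (by simp), one_smul] at key
  have e1 : (fderiv ℝ th 0).smulRight (0 : FF E) = 0 := by ext; simp
  rw [e1, add_zero] at key
  refine ContinuousLinearMap.opNorm_le_bound _ (by positivity) fun ξ => ?_
  refine (Am_norm J _).trans ?_
  refine ((Am J ∘L fderiv ℝ g 0).le_of_opNorm_le key ξ).trans (le_of_eq (by ring))

end JH

namespace JH
open scoped ContDiff

theorem grad_s (E : Type) [NormedAddCommGroup E] [NormedSpace ℝ E] [FiniteDimensional ℝ E] :
    ∃ C, 0 ≤ C ∧ ∀ (J : E → E →L[ℝ] E) (g : ℂ → E) (z0 : ℂ) (o L B a ρ : ℝ), 0 < ρ → 0 ≤ o → 0 ≤ L → ContDiffOn ℝ ∞ g (ball z0 ρ) →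
      (∀ z ∈ ball z0 ρ, fderiv ℝ g z Complex.I = J (g z) (fderiv ℝ g z 1) ∧ (∀ v, J (g z) (J (g z) v) = -v) ∧ ‖J (g z0) - J (g z)‖ ≤ L * ‖g z0 - g z‖ ∧
        ‖g z - g z0‖ ≤ o ∧ ‖fderiv ℝ g z‖ ≤ 2 * a) → a = ‖fderiv ℝ g z0‖ → ‖J (g z0)‖ ≤ B →
      ρ * a ≤ C * (1 + B) * (4 * L * (ρ * a) ^ 2 + o) := by
  obtain ⟨C, hC, h⟩ := grad1 E
  refine ⟨C, hC, fun J g z0 o L B a ρ hρ ho hL hg hh ha hB => ?_⟩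
  have ha0 : 0 ≤ a := by rw [ha]; positivity
  have hmem : ∀ w : ℂ, ‖w‖ < 1 → z0 + ρ • w ∈ ball z0 ρ := fun w hw => by
    rw [mem_ball, dist_eq_norm, add_sub_cancel_left, norm_smul, Real.norm_of_nonneg hρ.le]
    nlinarith
  have hz0 : z0 ∈ ball z0 ρ := mem_ball_self hρ
  let k : ℂ → E := fun w => g (z0 + ρ • w) - g z0
  have hk : ContDiffOn ℝ ∞ k (ball 0 1) :=
    (hg.comp (s := ball 0 1) (f := fun w : ℂ => z0 + ρ • w) (contDiff_const.add (contDiff_const_smul ρ)).contDiffOn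
      (fun w hw => hmem w (by simpa using hw))).sub contDiffOn_const
  have hd : ∀ w : ℂ, ‖w‖ < 1 → HasFDerivAt k (ρ • fderiv ℝ g (z0 + ρ • w)) w := by
    intro w hw
    have h1 : HasFDerivAt g (fderiv ℝ g (z0 + ρ • w)) (z0 + ρ • w) :=
      ((hg.contDiffAt (isOpen_ball.mem_nhds (hmem w hw))).differentiableAt (by simp)).hasFDerivAt
    have h2 : HasFDerivAt (fun w : ℂ => z0 + ρ • w) (ρ • ContinuousLinearMap.id ℝ ℂ) w :=
      ((hasFDerivAt_id w).const_smul ρ).const_add z0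
    have h3 := (h1.comp w h2).sub_const (g z0)
    rw [ContinuousLinearMap.comp_smul, ContinuousLinearMap.comp_id] at h3
    exact h3
  have hn : ∀ w : ℂ, ‖w‖ < 1 → ‖fderiv ℝ k w‖ ≤ 2 * (ρ * a) := fun w hw => by
    rw [(hd w hw).fderiv, norm_smul, Real.norm_of_nonneg hρ.le]
    have := (hh _ (hmem w hw)).2.2.2.2
    nlinarith
  have k0 : k 0 = 0 := by simp [k]
  have hl : ∀ w : ℂ, ‖w‖ < 1 → ‖k w‖ ≤ 2 * (ρ * a) * ‖w‖ := fun w hw => by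
    have := (convex_ball (0:ℂ) 1).norm_image_sub_le_of_norm_fderiv_le (𝕜 := ℝ) (f := k) (C := 2 * (ρ * a)) (x := 0) (y := w)
      (fun x hx => (hd x (by simpa using hx)).differentiableAt) (fun x hx => hn x (by simpa using hx)) (by simp) (by simpa using hw)
    simpa [k0] using this
  have := h (J (g z0)) k o (4 * L * (ρ * a) ^ 2) (hh z0 hz0).2.1 hk k0 (by positivity) ho fun w hw => by
    obtain ⟨h1, h2, h3, h4, h5⟩ := hh _ (hmem w hw)
    refine ⟨h4, ?_⟩
    have e1 : fderiv ℝ k w 1 = - J (g (z0 + ρ • w)) (fderiv ℝ k w Complex.I) := by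
      rw [(hd w hw).fderiv, smul_apply, smul_apply, h1, map_smul, h2, smul_neg, neg_neg]
    have e2 : fderiv ℝ k w 1 + J (g z0) (fderiv ℝ k w Complex.I) = (J (g z0) - J (g (z0 + ρ • w))) (fderiv ℝ k w Complex.I) := by
      rw [e1, sub_apply]; abel
    rw [e2]
    have h6 : ‖fderiv ℝ k w Complex.I‖ ≤ 2 * (ρ * a) := by
      have := (fderiv ℝ k w).le_of_opNorm_le (hn w hw) Complex.I
      simpa using this
    have h7 : ‖J (g z0) - J (g (z0 + ρ • w))‖ ≤ L * (2 * (ρ * a) * ‖w‖) := h3.trans (by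
      rw [norm_sub_rev]; exact mul_le_mul_of_nonneg_left (hl w hw) hL)
    refine ((ContinuousLinearMap.le_opNorm _ _).trans (mul_le_mul h7 h6 (norm_nonneg _) (by positivity))).trans (le_of_eq (by ring))
  rw [(hd 0 (by simp)).fderiv, norm_smul, Real.norm_of_nonneg hρ.le, smul_zero, add_zero, ← ha] at this
  refine this.trans ?_
  gcongr

theorem grad2 {E : Type} [NormedAddCommGroup E] [NormedSpace ℝ E] [FiniteDimensional ℝ E] {Ω : Set E} (hΩ : IsOpen Ω) {J : E → E →L[ℝ] E}
    (hJ : ContDiffOn ℝ ∞ J Ω) (hJ2 : ∀ x ∈ Ω, ∀ v, J x (J x v) = -v) {p : E} (hp : p ∈ Ω) :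
    ∃ η C, 0 < η ∧ 0 ≤ C ∧ ∀ (g : ℂ → E) (z1 : ℂ) (r o : ℝ), 0 < r → 0 ≤ o → o ≤ η → ContDiffOn ℝ ∞ g (ball z1 r) →
      (∀ z ∈ ball z1 r, fderiv ℝ g z Complex.I = J (g z) (fderiv ℝ g z 1) ∧ ‖g z - p‖ ≤ η) →
      (∀ z ∈ ball z1 r, ∀ w ∈ ball z1 r, ‖g z - g w‖ ≤ o) → ‖fderiv ℝ g z1‖ * r ≤ C * o := by
  obtain ⟨C, hC, hs⟩ := grad_s E
  obtain ⟨q, ρ, hρ, hq, hqJ⟩ := cc_ext hΩ hJ hp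
  obtain ⟨B, hB, b⟩ := hq.bdd
  obtain ⟨L', hL', l'⟩ := hq.lip
  obtain ⟨L, hL, l⟩ : ∃ L, 0 < L ∧ ∀ x y, ‖q x - q y‖ ≤ L * ‖x - y‖ := ⟨L' + 1, by positivity, fun x y => (l' x y).trans (by
    have := norm_nonneg (x - y); nlinarith)⟩
  obtain ⟨K, hK, hCK⟩ : ∃ K, 0 < K ∧ C * (1 + B) ≤ K := ⟨C * (1 + B) + 1, by positivity, by linarith⟩
  refine ⟨min ρ (1 / (32 * K ^ 2 * L)), 4 * K, by positivity, by positivity, fun g z1 r o hr ho hoη hg hh hosc => ?_⟩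
  have main : ∀ r', 0 < r' → r' < r → ‖fderiv ℝ g z1‖ * r' ≤ 4 * K * o := by
    intro r' hr' hrr
    have hsub : closedBall z1 r' ⊆ ball z1 r := closedBall_subset_ball hrr
    have hcont : ContinuousOn (fun z => (r' - ‖z - z1‖) * ‖fderiv ℝ g z‖) (closedBall z1 r') := by
      have h1 : ContinuousOn (fderiv ℝ g) (closedBall z1 r') :=
        (hg.continuousOn_fderiv_of_isOpen isOpen_ball (by simp)).mono hsub
      exact (Continuous.continuousOn (by fun_prop)).mul h1.norm
    obtain ⟨z0, hz0, hmax⟩ := (isCompact_closedBall z1 r').exists_isMaxOn ⟨z1, by simp [hr'.le]⟩ hcont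
    set a := ‖fderiv ℝ g z0‖ with ha
    set d := r' - ‖z0 - z1‖ with hd
    have hmax' : ∀ z, ‖z - z1‖ ≤ r' → (r' - ‖z - z1‖) * ‖fderiv ℝ g z‖ ≤ d * a := fun z hz =>
      hmax (by rw [mem_closedBall, dist_eq_norm]; exact hz)
    have h1 := hmax' z1 (by simp [hr'.le])
    rw [sub_self, norm_zero, sub_zero, mul_comm] at h1
    refine h1.trans ?_
    have hd0 : 0 ≤ d := by
      rw [mem_closedBall, dist_eq_norm] at hz0; linarith
    have ha0 : 0 ≤ a := norm_nonneg _
    by_contra! hcon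
    have hda : 0 < d * a := lt_of_le_of_lt (by positivity) hcon
    have hd1 : 0 < d := pos_of_mul_pos_left hda ha0
    have ha1 : 0 < a := pos_of_mul_pos_right hda hd0
    have key : ∀ t, 0 < t → t ≤ d / 2 → t * a ≤ K * (4 * L * (t * a) ^ 2 + o) := by
      intro t ht htd
      have hsb : ∀ z ∈ ball z0 t, ‖z - z1‖ ≤ r' - d / 2 := fun z hz => by
        rw [mem_ball, dist_eq_norm] at hz
        have := norm_sub_le_norm_sub_add_norm_sub z z0 z1
        linarith
      have hsb2 : ∀ z ∈ ball z0 t, z ∈ ball z1 r := fun z hz => by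
        rw [mem_ball, dist_eq_norm]; linarith [hsb z hz]
      have hJq : ∀ z ∈ ball z1 r, g z ∈ Ω ∧ q (g z) = J (g z) := fun z hz => hqJ _ (((hh z hz).2).trans (min_le_left _ _))
      have hz0r : z0 ∈ ball z1 r := hsub hz0
      refine (hs J g z0 o L B a t ht ho hL.le (hg.mono fun z hz => hsb2 z hz) (fun z hz => ?_) ha ?_).trans ?_
      · have hz' := hsb2 z hz
        refine ⟨(hh z hz').1, hJ2 _ (hJq z hz').1, ?_, hosc _ hz' _ hz0r, ?_⟩
        · rw [← (hJq z hz').2, ← (hJq z0 hz0r).2]; exact l _ _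
        · have h2 := hsb z hz
          have h3 := hmax' z (by linarith)
          have h4 : d / 2 * ‖fderiv ℝ g z‖ ≤ d * a := (mul_le_mul_of_nonneg_right (by linarith) (norm_nonneg _)).trans h3
          by_contra! h5
          nlinarith
      · rw [← (hJq z0 hz0r).2]; exact b _
      · gcongr
    have ho2 : o ≤ 1 / (32 * K ^ 2 * L) := hoη.trans (min_le_right _ _)
    have ho3 : 32 * K ^ 2 * L * o ≤ 1 := by
      rw [le_div_iff₀ (by positivity)] at ho2; linarith
    by_cases hc : d * a / 2 ≤ 1 / (8 * K * L)
    · have h2 := key (d/2) (by positivity) le_rfl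
      rw [le_div_iff₀ (by positivity)] at hc
      have h3 : K * (4 * L * (d / 2 * a) ^ 2) ≤ (d / 2 * a) / 2 := by nlinarith
      nlinarith
    · push Not at hc
      have h2 := key (1 / (8 * K * L) / a) (by positivity) (by
        rw [div_le_iff₀ ha1]; linarith)
      rw [div_mul_cancel₀ _ ha1.ne'] at h2
      have h3 : K * (4 * L * (1 / (8 * K * L)) ^ 2) = 1 / (16 * K * L) := by field_simp; norm_num
      rw [mul_add, h3] at h2
      have h4 : K * o ≤ 1 / (32 * K * L) := by
        rw [le_div_iff₀ (by positivity)]; nlinarith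
      have h5 : (0:ℝ) < 1 / (K * L) := by positivity
      have e1 : 1 / (8 * K * L) = 1 / (K * L) / 8 := by field_simp
      have e2 : 1 / (16 * K * L) = 1 / (K * L) / 16 := by field_simp
      have e3 : 1 / (32 * K * L) = 1 / (K * L) / 32 := by field_simp
      rw [e1, e2] at h2
      rw [e3] at h4
      linarith
  have ht : Tendsto (fun r' => ‖fderiv ℝ g z1‖ * r') (𝓝[<] r) (𝓝 (‖fderiv ℝ g z1‖ * r)) :=
    Tendsto.mono_left (Continuous.tendsto (by fun_prop) _) nhdsWithin_le_nhds
  refine le_of_tendsto ht ?_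
  filter_upwards [Ioo_mem_nhdsLT hr] with r' h' using main r' h'.1 h'.2

end JH

namespace JH
open scoped ContDiff

def LipAt {E : Type} [NormedAddCommGroup E] (f : ℂ → E) (p : ℂ) : Prop :=
  ∃ r > 0, ∃ L, 0 ≤ L ∧ ∀ z ∈ ball p r, ∀ w ∈ ball p r, ‖f z - f w‖ ≤ L * ‖z - w‖

theorem LipAt.open {E : Type} [NormedAddCommGroup E] (f : ℂ → E) : IsOpen {p | LipAt f p} := by
  rw [Metric.isOpen_iff]
  rintro p ⟨r, hr, L, hL, h⟩
  refine ⟨r/2, by positivity, fun q hq => ⟨r/2, by positivity, L, hL, fun z hz w hw => ?_⟩⟩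
  have : ball q (r/2) ⊆ ball p r := ball_subset_ball' (by rw [mem_ball] at hq; linarith)
  exact h z (this hz) w (this hw)

theorem reg_lip {E : Type} [NormedAddCommGroup E] [NormedSpace ℝ E] [FiniteDimensional ℝ E] {Ω : Set E} (hΩ : IsOpen Ω) {J : E → E →L[ℝ] E}
    (hJ : ContDiffOn ℝ ∞ J Ω) (hJ2 : ∀ x ∈ Ω, ∀ v, J x (J x v) = -v) {f : ℂ → E} {U : Set ℂ} (hU : IsOpen U) (hf : ∀ z ∈ U, f z ∈ Ω)
    (hd : ∀ z ∈ U, DifferentiableAt ℝ f z) (heq : ∀ z ∈ U, fderiv ℝ f z Complex.I = J (f z) (fderiv ℝ f z 1)) {p : ℂ} (hp : p ∈ U) (hl : LipAt f p) :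
    ContDiffAt ℝ ∞ f p := by
  obtain ⟨r, hr, L, hL, h⟩ := hl
  obtain ⟨r', hr', hb⟩ := Metric.isOpen_iff.1 hU p hp
  have hm : ∀ z : ℂ, ‖z‖ < min r r' → p + z ∈ U ∧ p + z ∈ ball p r := fun z hz =>
    ⟨hb (by rw [mem_ball, dist_eq_norm, add_sub_cancel_left]; exact hz.trans_le (min_le_right _ _)),
      by rw [mem_ball, dist_eq_norm, add_sub_cancel_left]; exact hz.trans_le (min_le_left _ _)⟩
  let c : Cv E :=
    { Ω := Ω, hΩ := hΩ, J := J, hJ := hJ, hJ2 := hJ2, f := fun z => f (p + z), D := fun z => fderiv ℝ f (p + z), r0 := min r r', hr0 := by positivity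
      L := L, hL := hL, hf := fun z hz => hf _ (hm z hz).1
      hD := fun z hz => (hd _ (hm z hz).1).hasFDerivAt.comp z ((hasFDerivAt_id z).const_add p)
      heq := fun z hz => heq _ (hm z hz).1
      hlip := fun z w hz hw => by
        have := h _ (hm z hz).2 _ (hm w hw).2
        rwa [add_sub_add_left_eq_sub] at this }
  rw [contDiffAt_infty]
  intro k
  have h1 : ContDiffAt ℝ k c.f (p - p) := by rw [sub_self]; exact c.reg k
  have h2 := h1.comp (f := fun z : ℂ => z - p) p (contDiffAt_id.sub contDiffAt_const)
  refine h2.congr_of_eventuallyEq (Eventually.of_forall fun z => ?_)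
  simp [c]

theorem reg_all {E : Type} [NormedAddCommGroup E] [NormedSpace ℝ E] [FiniteDimensional ℝ E] {Ω : Set E} (hΩ : IsOpen Ω) {J : E → E →L[ℝ] E}
    (hJ : ContDiffOn ℝ ∞ J Ω) (hJ2 : ∀ x ∈ Ω, ∀ v, J x (J x v) = -v) {f : ℂ → E} {U : Set ℂ} (hU : IsOpen U) (hf : ∀ z ∈ U, f z ∈ Ω)
    (hd : ∀ z ∈ U, DifferentiableAt ℝ f z) (heq : ∀ z ∈ U, fderiv ℝ f z Complex.I = J (f z) (fderiv ℝ f z 1)) : ContDiffOn ℝ ∞ f U := by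
  suffices H : ∀ z ∈ U, LipAt f z from fun z hz => (reg_lip hΩ hJ hJ2 hU hf hd heq hz (H z hz)).contDiffWithinAt
  by_contra! hne
  obtain ⟨x0, hx0, hx0'⟩ := hne
  let F : Set ℂ := U ∩ {p | LipAt f p}ᶜ
  have hlc : IsLocallyClosed F := hU.isLocallyClosed.inter (LipAt.open f).isClosed_compl.isLocallyClosed
  have := hlc.locallyCompactSpace
  have hFne : Nonempty F := ⟨⟨x0, hx0, hx0'⟩⟩
  let S : ℕ → Set F := fun N => {p | ∀ z ∈ U, ‖z - p‖ < 1 / ((N:ℝ) + 1) → ‖f z - f p‖ ≤ (N:ℝ) * ‖z - p‖}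
  have hfc : Continuous fun p : F => f p := by
    rw [continuous_iff_continuousAt]
    intro p
    exact (hd p p.2.1).continuousAt.comp continuous_subtype_val.continuousAt
  have hSc : ∀ N, IsClosed (S N) := by
    intro N
    have : S N = ⋂ z ∈ U, ({p : F | 1 / ((N:ℝ) + 1) ≤ ‖z - p‖} ∪ {p : F | ‖f z - f p‖ ≤ (N:ℝ) * ‖z - p‖}) := by
      ext p
      simp only [S, mem_ofPred_eq, mem_iInter, mem_union]
      refine forall₂_congr fun z _ => ?_
      rw [← not_lt (a := ‖z - p‖)]; tauto
    rw [this]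
    refine isClosed_biInter fun z _ => IsClosed.union ?_ ?_
    · exact isClosed_le continuous_const (by fun_prop)
    · exact isClosed_le (continuous_const.sub hfc).norm (by fun_prop)
  have hSU : ⋃ N, S N = univ := by
    refine eq_univ_of_forall fun p => ?_
    have hb : (fun z => f z - f p) =O[𝓝 (p:ℂ)] fun z => z - p := (hd p p.2.1).isBigO_sub
    obtain ⟨c, hc⟩ := hb.bound
    obtain ⟨r, hr, hrb⟩ := Metric.mem_nhds_iff.1 hc
    obtain ⟨N1, hN1⟩ := exists_nat_ge c
    obtain ⟨N2, hN2⟩ := exists_nat_one_div_lt hr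
    refine mem_iUnion.2 ⟨max N1 N2, fun z hz hzp => ?_⟩
    have h1 : ‖f z - f p‖ ≤ c * ‖z - p‖ := hrb (by
      rw [mem_ball, dist_eq_norm]
      refine hzp.trans_le (le_trans ?_ hN2.le)
      have : (N2:ℝ) ≤ ((max N1 N2 : ℕ) : ℝ) := by exact_mod_cast le_max_right _ _
      gcongr)
    refine h1.trans (mul_le_mul_of_nonneg_right (hN1.trans ?_) (norm_nonneg _))
    exact_mod_cast le_max_left _ _
  obtain ⟨N, ⟨p, hpF⟩, hpi⟩ := nonempty_interior_of_iUnion_of_closed hSc hSU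
  obtain ⟨δ1, hδ1, hball⟩ := Metric.mem_nhds_iff.1 (mem_interior_iff_mem_nhds.1 hpi)
  obtain ⟨η, C, hη, hC, hgr⟩ := grad2 hΩ hJ hJ2 (hf p hpF.1)
  obtain ⟨δ2, hδ2, hbU⟩ := Metric.isOpen_iff.1 hU p hpF.1
  have hN : (0:ℝ) < (N:ℝ) + 1 := by positivity
  obtain ⟨δ, hδ, h1, h2, h3, h4⟩ : ∃ δ > 0, δ ≤ δ1 ∧ δ ≤ δ2 ∧ δ ≤ 1 / ((N:ℝ) + 1) ∧ δ ≤ η / (6 * ((N:ℝ) + 1)) :=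
    ⟨min (min δ1 δ2) (min (1 / ((N:ℝ) + 1)) (η / (6 * ((N:ℝ) + 1)))), by positivity, (min_le_left _ _).trans (min_le_left _ _),
      (min_le_left _ _).trans (min_le_right _ _), (min_le_right _ _).trans (min_le_left _ _), (min_le_right _ _).trans (min_le_right _ _)⟩
  rw [le_div_iff₀ (by positivity)] at h4
  have hN0 : (0:ℝ) ≤ N := Nat.cast_nonneg N
  have hF : ∀ q ∈ F, ‖q - p‖ < δ → ∀ z, ‖z - p‖ < δ → ‖z - q‖ < δ → ‖f z - f q‖ ≤ (N:ℝ) * ‖z - q‖ := by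
    intro q hq hqp z hzp hz
    have : (⟨q, hq⟩ : F) ∈ S N := hball (by
      rw [mem_ball, Subtype.dist_eq, dist_eq_norm]; exact hqp.trans_le h1)
    exact this z (hbU (by rw [mem_ball, dist_eq_norm]; linarith)) (hz.trans_le h3)
  have hbd : ∀ z, ‖z - p‖ < δ / 4 → ‖fderiv ℝ f z‖ ≤ C * (6 * N) + N := by
    intro z hz
    have hzU : z ∈ U := hbU (by rw [mem_ball, dist_eq_norm]; linarith)
    by_cases hzF : z ∈ F
    · have : ‖fderiv ℝ f z‖ ≤ N := by
        refine (hd z hzU).hasFDerivAt.le_of_lip' hN0 ?_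
        filter_upwards [ball_mem_nhds z (show 0 < δ/4 by positivity)] with w hw
        rw [mem_ball, dist_eq_norm] at hw
        refine hF z hzF (by linarith) w ?_ (by linarith)
        have := norm_sub_le_norm_sub_add_norm_sub w z p
        linarith
      have : 0 ≤ C * (6 * N) := by positivity
      linarith
    · have hzL : LipAt f z := by
        by_contra h; exact hzF ⟨hzU, h⟩
      have hFn : F.Nonempty := ⟨p, hpF⟩
      set t := infDist z F with ht
      have htp : t ≤ ‖z - p‖ := by rw [← dist_eq_norm]; exact infDist_le_dist_of_mem hpF
      have ht0 : 0 < t := by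
        obtain ⟨r, hr, hrL⟩ := Metric.isOpen_iff.1 (LipAt.open f) z hzL
        refine lt_of_lt_of_le hr ((le_infDist hFn).2 fun y hy => ?_)
        by_contra! hlt
        exact hy.2 (hrL (by rw [mem_ball, dist_comm]; exact hlt))
      have hzw : ∀ w ∈ ball z t, ‖w - p‖ < δ / 2 ∧ ‖w - z‖ < t := fun w hw => by
        rw [mem_ball, dist_eq_norm] at hw
        have := norm_sub_le_norm_sub_add_norm_sub w z p
        exact ⟨by linarith, hw⟩
      have hwU : ∀ w ∈ ball z t, w ∈ U := fun w hw => hbU (by rw [mem_ball, dist_eq_norm]; linarith [(hzw w hw).1])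
      obtain ⟨q, hq, hzq⟩ := (infDist_lt_iff hFn).1 (show infDist z F < 2 * t by linarith)
      rw [dist_eq_norm] at hzq
      have hqp : ‖q - p‖ < δ := by
        have := norm_sub_le_norm_sub_add_norm_sub q z p
        rw [norm_sub_rev] at hzq; linarith
      have hwq : ∀ w ∈ ball z t, ‖f w - f q‖ ≤ N * (3 * t) := fun w hw => by
        obtain ⟨a1, a2⟩ := hzw w hw
        have a3 : ‖w - q‖ ≤ 3 * t := by
          have := norm_sub_le_norm_sub_add_norm_sub w z q
          linarith
        exact (hF q hq hqp w (by linarith) (by linarith)).trans (mul_le_mul_of_nonneg_left a3 hN0)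
      have key := hgr f z t (6 * N * t) ht0 (by positivity) (by nlinarith) (fun w hw => by
        refine (reg_lip hΩ hJ hJ2 hU hf hd heq (hwU w hw) ?_).contDiffWithinAt
        by_contra h
        have h5 := infDist_le_dist_of_mem (x := z) (show w ∈ F from ⟨hwU w hw, h⟩)
        rw [mem_ball, dist_comm] at hw
        linarith) (fun w hw => ⟨heq w (hwU w hw), by
          have h6 := (hzw w hw).1
          refine (hF p hpF (by simpa using hδ) w (by linarith) (by linarith)).trans ?_
          nlinarith⟩) (fun w hw w' hw' => by
          have h7 := hwq w hw
          have h8 := hwq w' hw'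
          have := norm_sub_le_norm_sub_add_norm_sub (f w) (f q) (f w')
          rw [norm_sub_rev (f q)] at this
          linarith)
      have : ‖fderiv ℝ f z‖ ≤ C * (6 * N) := by
        have h9 : ‖fderiv ℝ f z‖ * t ≤ C * (6 * N) * t := by linarith
        exact le_of_mul_le_mul_right h9 ht0
      linarith
  refine hpF.2 ⟨δ/4, by positivity, C * (6 * N) + N, by positivity, fun z hz w hw => ?_⟩
  exact (convex_ball (p:ℂ) (δ/4)).norm_image_sub_le_of_norm_fderiv_le (𝕜 := ℝ) (fun x hx => hd x (hbU (by
    rw [mem_ball] at hx ⊢; linarith))) (fun x hx => hbd x (by rwa [mem_ball, dist_eq_norm] at hx)) hw hz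

end JH

namespace JH
open scoped ContDiff

section proj
variable {H : Type} [NormedAddCommGroup H] [InnerProductSpace ℝ H]

def rj (u : H) : H →L[ℝ] H := ContinuousLinearMap.id ℝ H - (inner ℝ u u)⁻¹ • (innerSL ℝ u).smulRight u

theorem rj_apply (u v : H) : rj u v = v - ((inner ℝ u u)⁻¹ * inner ℝ u v) • u := by
  simp [rj, smul_smul]

theorem rj_self {u : H} (hu : u ≠ 0) : rj u u = 0 := by
  rw [rj_apply, inv_mul_cancel₀ (by simpa using hu), one_smul, sub_self]

theorem rj_cd {u : ℂ → H} {s : Set ℂ} (hu : ContDiffOn ℝ ∞ u s) (h0 : ∀ z ∈ s, u z ≠ 0) : ContDiffOn ℝ ∞ (fun z => rj (u z)) s := by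
  have a1 : ContDiffOn ℝ ∞ (fun z => (inner ℝ (u z) (u z))⁻¹) s := (hu.inner ℝ hu).inv fun z hz => by simpa using h0 z hz
  have a2 : ContDiffOn ℝ ∞ (fun z => (innerSL ℝ (u z)).smulRight (u z)) s := ((innerSL ℝ (E := H)).contDiff.comp_contDiffOn hu).smulRight hu
  exact contDiffOn_const.sub (a1.smul a2)

def qj (u w : H) : H →L[ℝ] H := rj (rj u w) ∘L rj u

theorem rj_ne {u w : H} (h : ∀ a b : ℝ, a • u + b • w = 0 → b = 0) : rj u w ≠ 0 := by
  intro h0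
  rw [rj_apply] at h0
  exact one_ne_zero (h (-((inner ℝ u u)⁻¹ * inner ℝ u w)) 1 (by rw [neg_smul, one_smul, neg_add_eq_sub]; exact h0))

theorem qj_left {u w : H} (hu : u ≠ 0) : qj u w u = 0 := by
  simp [qj, rj_self hu]

theorem qj_right {u w : H} (h : ∀ a b : ℝ, a • u + b • w = 0 → b = 0) : qj u w w = 0 := by
  rw [qj, ContinuousLinearMap.comp_apply, rj_self (rj_ne h)]

theorem qj_eq (u w v : H) : ∃ a b : ℝ, qj u w v = v - (a • u + b • w) := by
  rw [qj, ContinuousLinearMap.comp_apply, rj_apply (rj u w)]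
  set c := ((inner ℝ (rj u w) (rj u w))⁻¹ * inner ℝ (rj u w) (rj u v))
  rw [rj_apply u v, rj_apply u w]
  set a := ((inner ℝ u u)⁻¹ * inner ℝ u v)
  set b := ((inner ℝ u u)⁻¹ * inner ℝ u w)
  exact ⟨a - c * b, c, by module⟩

theorem qj_idem {u w : H} (hu : u ≠ 0) (h : ∀ a b : ℝ, a • u + b • w = 0 → b = 0) (v : H) : qj u w (qj u w v) = qj u w v := by
  obtain ⟨a, b, hab⟩ := qj_eq u w v
  conv_lhs => rw [hab]
  rw [map_sub, map_add, map_smul, map_smul, qj_left hu, qj_right h]; simp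

theorem qj_cd {u w : ℂ → H} {s : Set ℂ} (hu : ContDiffOn ℝ ∞ u s) (hw : ContDiffOn ℝ ∞ w s) (h0 : ∀ z ∈ s, u z ≠ 0)
    (h : ∀ z ∈ s, ∀ a b : ℝ, a • u z + b • w z = 0 → b = 0) : ContDiffOn ℝ ∞ (fun z => qj (u z) (w z)) s :=
  (rj_cd ((rj_cd hu h0).clm_apply hw) fun z hz => rj_ne (h z hz)).clm_comp (rj_cd hu h0)

theorem frame_H [FiniteDimensional ℝ H] (hdim : Module.finrank ℝ H = 4) {u w : ℂ → H} {R R1 : ℝ} (hR1 : 0 < R1) (hR : R1 < R) (hu : ContDiffOn ℝ ∞ u (ball 0 R)) (hw : ContDiffOn ℝ ∞ w (ball 0 R))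
    (h : ∀ z ∈ ball (0:ℂ) R, ∀ a b : ℝ, a • u z + b • w z = 0 → a = 0 ∧ b = 0) :
    ∃ e : ℂ → H, ContDiffOn ℝ ∞ e (ball 0 R1) ∧ ∀ z ∈ ball (0:ℂ) R1, ∀ a b : ℝ, e z ≠ a • u z + b • w z := by
  have h0 : ∀ z ∈ ball (0:ℂ) R, u z ≠ 0 := fun z hz hz0 => one_ne_zero (h z hz 1 0 (by simp [hz0])).1
  have h2 : ∀ z ∈ ball (0:ℂ) R, ∀ a b : ℝ, a • u z + b • w z = 0 → b = 0 := fun z hz a b hab => (h z hz a b hab).2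
  let Q : ℂ → H →L[ℝ] H := fun z => qj (u z) (w z)
  have hQ : ContDiffOn ℝ ∞ Q (ball 0 R) := qj_cd hu hw h0 h2
  have hm0 : (0:ℂ) ∈ ball (0:ℂ) R := mem_ball_self (hR1.trans hR)
  have hid : ∀ z ∈ ball (0:ℂ) R, ∀ v, Q z (Q z v) = Q z v := fun z hz v => qj_idem (h0 z hz) (h2 z hz) v
  obtain ⟨e0, he0⟩ : ∃ e0, Q 0 e0 ≠ 0 := by
    by_contra! hc
    classical
    have htop : Submodule.span ℝ ((({u 0, w 0} : Finset H) : Set H)) = ⊤ := by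
      rw [eq_top_iff]
      intro v _
      obtain ⟨a, b, hab⟩ := qj_eq (u 0) (w 0) v
      have h3 : v = a • u 0 + b • w 0 := by
        have := hc v
        simp only [Q] at this
        rw [this] at hab
        exact (sub_eq_zero.1 hab.symm)
      rw [h3]
      refine Submodule.add_mem _ (Submodule.smul_mem _ _ (Submodule.subset_span (by simp))) (Submodule.smul_mem _ _ (Submodule.subset_span (by simp)))
    have h4 := finrank_span_finset_le_card (R := ℝ) ({u 0, w 0} : Finset H)
    rw [Set.finrank, htop, finrank_top, hdim] at h4
    have := Finset.card_le_two (a := u 0) (b := w 0)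
    omega
  have huc : UniformContinuousOn Q (closedBall 0 R1) :=
    (isCompact_closedBall (0:ℂ) R1).uniformContinuousOn_of_continuous (hQ.continuousOn.mono (closedBall_subset_ball hR))
  obtain ⟨δ, hδ, hucδ⟩ := Metric.uniformContinuousOn_iff.1 huc 1 one_pos
  obtain ⟨N, hN⟩ := exists_nat_gt (R1 / δ)
  have hN0 : (0:ℝ) < N := lt_of_le_of_lt (by positivity) hN
  let t : ℕ → ℝ := fun k => (k:ℝ) / N
  let e : ℕ → ℂ → H := fun k => Nat.rec (fun _ => Q 0 e0) (fun k ek z => Q (t (k+1) • z) (ek z)) k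
  have ht : ∀ k ≤ N, 0 ≤ t k ∧ t k ≤ 1 := fun k hk => ⟨by positivity, by
    rw [div_le_one hN0]; exact_mod_cast hk⟩
  have hmem : ∀ k ≤ N, ∀ z ∈ ball (0:ℂ) R1, t k • z ∈ ball (0:ℂ) R1 := fun k hk z hz => by
    rw [mem_ball_zero_iff] at hz ⊢
    rw [norm_smul, Real.norm_of_nonneg (ht k hk).1]
    nlinarith [(ht k hk).2, norm_nonneg z]
  have key : ∀ k ≤ N, ContDiffOn ℝ ∞ (e k) (ball 0 R1) ∧ ∀ z ∈ ball (0:ℂ) R1, e k z ≠ 0 ∧ Q (t k • z) (e k z) = e k z := by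
    intro k
    induction k with
    | zero =>
      intro _
      refine ⟨contDiffOn_const, fun z hz => ⟨he0, ?_⟩⟩
      have : t 0 = 0 := by simp [t]
      rw [this, zero_smul]
      exact hid 0 hm0 e0
    | succ k ih =>
      intro hk
      obtain ⟨i1, i2⟩ := ih (by omega)
      refine ⟨?_, fun z hz => ?_⟩
      · refine ContDiffOn.clm_apply ?_ i1
        exact hQ.comp (contDiff_const_smul (t (k+1))).contDiffOn fun z hz => ball_subset_ball hR.le (hmem _ hk z hz)
      · have m1 := hmem _ hk z hz
        have m0 := hmem k (by omega) z hz
        refine ⟨fun hz0 => ?_, hid _ (ball_subset_ball hR.le m1) _⟩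
        have hlt : ‖Q (t (k+1) • z) - Q (t k • z)‖ < 1 := by
          rw [← dist_eq_norm]
          refine hucδ _ (ball_subset_closedBall m1) _ (ball_subset_closedBall m0) ?_
          rw [dist_eq_norm, ← sub_smul, norm_smul]
          have : t (k+1) - t k = 1 / N := by simp only [t]; push_cast; ring
          rw [this, Real.norm_of_nonneg (by positivity), div_mul_eq_mul_div, one_mul, div_lt_iff₀ hN0]
          rw [mem_ball_zero_iff] at hz
          rw [div_lt_iff₀ hδ] at hN
          linarith
        have h5 : (Q (t (k+1) • z) - Q (t k • z)) (e k z) = - e k z := by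
          rw [sub_apply, (i2 z hz).2]
          change e (k+1) z - e k z = _
          rw [hz0, zero_sub]
        have h6 := (Q (t (k+1) • z) - Q (t k • z)).le_opNorm (e k z)
        rw [h5, norm_neg] at h6
        have h7 := norm_pos_iff.2 (i2 z hz).1
        nlinarith
  obtain ⟨k1, k2⟩ := key N le_rfl
  refine ⟨e N, k1, fun z hz a b hab => ?_⟩
  have hz' := ball_subset_ball hR.le hz
  have ht1 : t N = 1 := div_self hN0.ne'
  obtain ⟨k3, k4⟩ := k2 z hz
  rw [ht1, one_smul] at k4
  apply k3
  rw [← k4, hab, map_add, map_smul, map_smul]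
  simp only [Q]
  rw [qj_left (h0 z hz'), qj_right (h2 z hz')]; simp
end proj

theorem frame_E {E : Type} [NormedAddCommGroup E] [NormedSpace ℝ E] [FiniteDimensional ℝ E] (hdim : Module.finrank ℝ E = 4) {u w : ℂ → E} {R R1 : ℝ}
    (hR1 : 0 < R1) (hR : R1 < R) (hu : ContDiffOn ℝ ∞ u (ball 0 R)) (hw : ContDiffOn ℝ ∞ w (ball 0 R))
    (h : ∀ z ∈ ball (0:ℂ) R, ∀ a b : ℝ, a • u z + b • w z = 0 → a = 0 ∧ b = 0) :
    ∃ e : ℂ → E, ContDiffOn ℝ ∞ e (ball 0 R1) ∧ ∀ z ∈ ball (0:ℂ) R1, ∀ a b : ℝ, e z ≠ a • u z + b • w z := by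
  let τ : E ≃L[ℝ] EuclideanSpace ℝ (Fin 4) := ContinuousLinearEquiv.ofFinrankEq (by simpa using hdim)
  obtain ⟨e, h1, h2⟩ := frame_H (H := EuclideanSpace ℝ (Fin 4)) (by simp) hR1 hR (τ.contDiff.comp_contDiffOn hu) (τ.contDiff.comp_contDiffOn hw)
    (fun z hz a b hab => h z hz a b (τ.injective (by simpa using hab)))
  refine ⟨fun z => τ.symm (e z), τ.symm.contDiff.comp_contDiffOn h1, fun z hz a b hab => h2 z hz a b ?_⟩
  have := congrArg τ hab
  simpa using this

end JH

namespace JH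
open scoped ContDiff

theorem frame_g {E : Type} [NormedAddCommGroup E] [NormedSpace ℝ E] [FiniteDimensional ℝ E] (hdim : Module.finrank ℝ E = 4) {Ω : Set E}
    {J : E → E →L[ℝ] E} (hJ : ContDiffOn ℝ ∞ J Ω) (hJ2 : ∀ x ∈ Ω, ∀ v, J x (J x v) = -v) {f : ℂ → E} {R R1 : ℝ} (hR1 : 0 < R1) (hR : R1 < R)
    (hf : ContDiffOn ℝ ∞ f (ball 0 R)) (hm : MapsTo f (ball 0 R) Ω)
    (heq : ∀ z ∈ ball (0:ℂ) R, ∀ ξ, fderiv ℝ f z (Complex.I * ξ) = J (f z) (fderiv ℝ f z ξ))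
    (hinj : ∀ z ∈ ball (0:ℂ) R, Function.Injective (fderiv ℝ f z)) :
    ∃ (g : ℂ → V2 →L[ℝ] E) (h : ℂ → E →L[ℝ] V2), ContDiffOn ℝ ∞ g (ball 0 R1) ∧ ContDiffOn ℝ ∞ h (ball 0 R1) ∧
      ∀ z ∈ ball (0:ℂ) R1, (∀ c, h z (g z c) = c) ∧ (∀ v, g z (h z v) = v) ∧ (∀ c, g z (Complex.I • c) = J (f z) (g z c)) ∧
        ∀ ξ, g z (ξ, 0) = fderiv ℝ f z ξ := by
  have hdf : ContDiffOn ℝ ∞ (fderiv ℝ f) (ball 0 R) := hf.fderiv_of_isOpen isOpen_ball (by simp)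
  have hsp : ∀ (z ξ : ℂ), fderiv ℝ f z ξ = ξ.re • fderiv ℝ f z 1 + ξ.im • fderiv ℝ f z Complex.I := fun z ξ => by
    rw [← map_smul, ← map_smul, ← map_add]
    congr 1
    apply Complex.ext <;> simp
  obtain ⟨e, he, hne⟩ := frame_E hdim (u := fun z => fderiv ℝ f z 1) (w := fun z => fderiv ℝ f z Complex.I) hR1 hR
    (hdf.clm_apply contDiffOn_const) (hdf.clm_apply contDiffOn_const) (fun z hz a b hab => by
      have h1 : fderiv ℝ f z (⟨a, b⟩ : ℂ) = 0 := by rw [hsp]; exact hab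
      have h2 := hinj z hz (h1.trans (map_zero _).symm)
      exact ⟨congrArg Complex.re h2, congrArg Complex.im h2⟩)
  have hsub : ball (0:ℂ) R1 ⊆ ball 0 R := ball_subset_ball hR.le
  let g : ℂ → V2 →L[ℝ] E := fun z => fderiv ℝ f z ∘L ContinuousLinearMap.fst ℝ ℂ ℂ +
    (Complex.reCLM ∘L ContinuousLinearMap.snd ℝ ℂ ℂ).smulRight (e z) + (Complex.imCLM ∘L ContinuousLinearMap.snd ℝ ℂ ℂ).smulRight (J (f z) (e z))
  have hga : ∀ z c, g z c = fderiv ℝ f z c.1 + c.2.re • e z + c.2.im • J (f z) (e z) := fun z c => rfl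
  have hg : ContDiffOn ℝ ∞ g (ball 0 R1) := by
    refine (((hdf.mono hsub).clm_comp contDiffOn_const).add (contDiffOn_const.smulRight he)).add (contDiffOn_const.smulRight ?_)
    exact (hJ.comp (hf.mono hsub) fun z hz => hm (hsub hz)).clm_apply he
  have hgi : ∀ z ∈ ball (0:ℂ) R1, Function.Injective (g z) := by
    intro z hz
    rw [injective_iff_map_eq_zero]
    intro c hc
    have hz' := hsub hz
    rw [hga] at hc
    set α := c.2.re with hα
    set β := c.2.im with hβ
    have h1 : (α ^ 2 + β ^ 2) • e z = fderiv ℝ f z (-(α • c.1) + β • (Complex.I * c.1)) := by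
      have h2 := congrArg (J (f z)) hc
      rw [map_add, map_add, map_smul, map_smul, hJ2 _ (hm hz'), map_zero, ← heq z hz'] at h2
      rw [map_add, map_neg, map_smul, map_smul]
      linear_combination (norm := module) α • hc - β • h2
    have h3 : α ^ 2 + β ^ 2 = 0 := by
      by_contra h4
      set q := -(α • c.1) + β • (Complex.I * c.1)
      have h5 : e z = fderiv ℝ f z ((α ^ 2 + β ^ 2)⁻¹ • q) := by
        rw [map_smul, ← h1, inv_smul_smul₀ h4]
      rw [hsp] at h5
      exact hne z hz _ _ h5
    have ha : α = 0 := by nlinarith [sq_nonneg α, sq_nonneg β]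
    have hb : β = 0 := by nlinarith [sq_nonneg α, sq_nonneg β]
    rw [ha, hb, zero_smul, zero_smul, add_zero, add_zero] at hc
    have h6 := hinj z hz' (hc.trans (map_zero _).symm)
    exact Prod.ext h6 (Complex.ext ha hb)
  have hfr : Module.finrank ℝ V2 = Module.finrank ℝ E := by rw [hdim]; simp [V2]
  have hgE : ∀ z ∈ ball (0:ℂ) R1, ∃ G : V2 ≃L[ℝ] E, (G : V2 →L[ℝ] E) = g z := fun z hz =>
    ⟨(LinearEquiv.ofInjectiveOfFinrankEq (g z : V2 →ₗ[ℝ] E) (hgi z hz) hfr).toContinuousLinearEquiv, by ext v <;> rfl⟩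
  refine ⟨g, fun z => (g z).inverse, hg, fun z hz => ?_, fun z hz => ?_⟩
  · obtain ⟨G, hG⟩ := hgE z hz
    have h1 : ContDiffAt ℝ ∞ ContinuousLinearMap.inverse (g z) := hG ▸ contDiffAt_map_inverse G
    exact h1.comp_contDiffWithinAt z (hg z hz)
  · obtain ⟨G, hG⟩ := hgE z hz
    refine ⟨fun c => ?_, fun v => ?_, fun c => ?_, fun ξ => ?_⟩
    · beta_reduce; rw [← hG, ContinuousLinearMap.inverse_equiv]; exact G.symm_apply_apply c
    · beta_reduce; rw [← hG, ContinuousLinearMap.inverse_equiv]; exact G.apply_symm_apply v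
    · rw [hga, hga, map_add, map_add, map_smul, map_smul, hJ2 _ (hm (hsub hz)), ← heq z (hsub hz)]
      simp; abel
    · rw [hga]; simp

end JH

namespace JH
open scoped ContDiff

structure Fr (E : Type) [NormedAddCommGroup E] [NormedSpace ℝ E] where
  (Ω : Set E) (J : E → E →L[ℝ] E) (f : ℂ → E) (R : ℝ) (g : ℂ → V2 →L[ℝ] E) (h : ℂ → E →L[ℝ] V2)
  hΩ : IsOpen Ω
  hJ : ContDiffOn ℝ ∞ J Ω
  hJ2 : ∀ x ∈ Ω, ∀ v, J x (J x v) = -v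
  hf : ContDiffOn ℝ ∞ f (ball 0 R)
  hm : MapsTo f (ball 0 R) Ω
  heq : ∀ z ∈ ball (0:ℂ) R, ∀ ξ, fderiv ℝ f z (Complex.I * ξ) = J (f z) (fderiv ℝ f z ξ)
  hg : ContDiffOn ℝ ∞ g (ball 0 R)
  hh : ContDiffOn ℝ ∞ h (ball 0 R)
  hl : ∀ z ∈ ball (0:ℂ) R, ∀ c, h z (g z c) = c
  hr : ∀ z ∈ ball (0:ℂ) R, ∀ v, g z (h z v) = v
  hI : ∀ z ∈ ball (0:ℂ) R, ∀ c, g z (Complex.I • c) = J (f z) (g z c)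
  h1 : ∀ z ∈ ball (0:ℂ) R, ∀ ξ, g z (ξ, 0) = fderiv ℝ f z ξ

namespace Fr
variable {E : Type} [NormedAddCommGroup E] [NormedSpace ℝ E] (F : Fr E)

def N (p : ℂ × V2) : E := F.f p.1 + F.g p.1 p.2

def O : Set (ℂ × V2) := (ball 0 F.R ×ˢ univ) ∩ F.N ⁻¹' F.Ω

theorem N_cd : ContDiffOn ℝ ∞ F.N (ball 0 F.R ×ˢ univ) := by
  have h1 : MapsTo Prod.fst (ball (0:ℂ) F.R ×ˢ (univ : Set V2)) (ball 0 F.R) := fun p hp => hp.1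
  exact (F.hf.comp contDiffOn_fst h1).add ((F.hg.comp contDiffOn_fst h1).clm_apply contDiffOn_snd)

theorem O_open : IsOpen F.O :=
  F.N_cd.continuousOn.isOpen_inter_preimage (isOpen_ball.prod isOpen_univ) F.hΩ

theorem N_at {p : ℂ × V2} (hp : p ∈ F.O) : ContDiffAt ℝ ∞ F.N p :=
  F.N_cd.contDiffAt ((isOpen_ball.prod isOpen_univ).mem_nhds hp.1)

theorem N_zero (z : ℂ) : F.N (z, 0) = F.f z := by simp [N]

theorem O_zero {z : ℂ} (hz : z ∈ ball (0:ℂ) F.R) : (z, (0 : V2)) ∈ F.O :=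
  ⟨⟨hz, trivial⟩, by rw [mem_preimage, N_zero]; exact F.hm hz⟩

def Mm (p : ℂ × V2) : V2 →L[ℝ] V2 := Complex.I • ContinuousLinearMap.id ℝ V2 - F.h p.1 ∘L F.J (F.N p) ∘L F.g p.1

def S (p : ℂ × V2) : E := fderiv ℝ F.N p (1, 0) + F.J (F.N p) (fderiv ℝ F.N p (Complex.I, 0))

def bb (p : ℂ × V2) : V2 := -F.h p.1 (F.S p)

theorem O_fst : MapsTo Prod.fst F.O (ball (0:ℂ) F.R) := fun _ hp => hp.1.1

theorem JN_cd : ContDiffOn ℝ ∞ (fun p => F.J (F.N p)) F.O :=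
  F.hJ.comp (F.N_cd.mono inter_subset_left) fun _ hp => hp.2

theorem Mm_cd : ContDiffOn ℝ ∞ F.Mm F.O :=
  contDiffOn_const.sub ((F.hh.comp contDiffOn_fst F.O_fst).clm_comp (F.JN_cd.clm_comp (F.hg.comp contDiffOn_fst F.O_fst)))

theorem bb_cd : ContDiffOn ℝ ∞ F.bb F.O := by
  have h1 : ContDiffOn ℝ ∞ (fderiv ℝ F.N) F.O := (F.N_cd.mono inter_subset_left).fderiv_of_isOpen F.O_open (by simp)
  exact ((F.hh.comp contDiffOn_fst F.O_fst).clm_apply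
    ((h1.clm_apply contDiffOn_const).add (F.JN_cd.clm_apply (h1.clm_apply contDiffOn_const)))).neg

theorem Mm_zero {z : ℂ} (hz : z ∈ ball (0:ℂ) F.R) : F.Mm (z, 0) = 0 := by
  refine ContinuousLinearMap.ext fun c => ?_
  change Complex.I • c - F.h z (F.J (F.N (z, 0)) (F.g z c)) = 0
  rw [N_zero, ← F.hI z hz, F.hl z hz, sub_self]

theorem df_at {z : ℂ} (hz : z ∈ ball (0:ℂ) F.R) : HasFDerivAt F.f (fderiv ℝ F.f z) z :=
  ((F.hf.contDiffAt (isOpen_ball.mem_nhds hz)).differentiableAt (by simp)).hasFDerivAt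

theorem ddf_at {z : ℂ} (hz : z ∈ ball (0:ℂ) F.R) : HasFDerivAt (fderiv ℝ F.f) (fderiv ℝ (fderiv ℝ F.f) z) z :=
  (((F.hf.fderiv_of_isOpen (m := ∞) isOpen_ball (by simp)).contDiffAt (isOpen_ball.mem_nhds hz)).differentiableAt (by simp)).hasFDerivAt

theorem dN {z : ℂ} (hz : z ∈ ball (0:ℂ) F.R) (c ξ : ℂ) : fderiv ℝ F.N (z, (c, 0)) (ξ, 0) = fderiv ℝ F.f z ξ + fderiv ℝ (fderiv ℝ F.f) z ξ c := by
  have h0 : HasFDerivAt F.N (fderiv ℝ F.N (z, (c, 0))) (z, (c, 0)) :=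
    ((F.N_cd.contDiffAt ((isOpen_ball.prod isOpen_univ).mem_nhds ⟨hz, trivial⟩)).differentiableAt (by simp)).hasFDerivAt
  have h1 : HasFDerivAt (fun w : ℂ => (w, ((c, 0) : V2))) (ContinuousLinearMap.inl ℝ ℂ V2) z := hasFDerivAt_prodMk_left z _
  have h2 := h0.comp z h1
  have h3 := (F.df_at hz).add ((F.ddf_at hz).clm_apply (hasFDerivAt_const c z))
  have h4 : (F.N ∘ fun w : ℂ => (w, ((c, 0) : V2))) =ᶠ[𝓝 z] (F.f + fun w => fderiv ℝ F.f w c) := by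
    filter_upwards [isOpen_ball.mem_nhds hz] with w hw
    simp [N, F.h1 w hw]
  have h5 := congrArg (fun L => L ξ) (h2.unique (h3.congr_of_eventuallyEq h4))
  simpa using h5

theorem S_line {z : ℂ} (hz : z ∈ ball (0:ℂ) F.R) (c : ℂ) : F.S (z, (c, 0)) =
    (fderiv ℝ F.f z 1 + fderiv ℝ (fderiv ℝ F.f) z 1 c) + F.J (F.f z + fderiv ℝ F.f z c) (fderiv ℝ F.f z Complex.I + fderiv ℝ (fderiv ℝ F.f) z Complex.I c) := by
  rw [S, F.dN hz, F.dN hz, N, F.h1 z hz]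

theorem heq0 {z : ℂ} (hz : z ∈ ball (0:ℂ) F.R) : fderiv ℝ F.f z 1 + F.J (F.f z) (fderiv ℝ F.f z Complex.I) = 0 := by
  rw [← F.heq z hz, Complex.I_mul_I, map_neg, add_neg_cancel]

theorem bb_zero {z : ℂ} (hz : z ∈ ball (0:ℂ) F.R) : F.bb (z, 0) = 0 := by
  have := F.S_line hz 0
  rw [map_zero, map_zero, map_zero, add_zero, add_zero, add_zero, F.heq0 hz] at this
  change -F.h z (F.S (z, (0, 0))) = 0
  rw [this, map_zero, neg_zero]

theorem gam {x : E} (hx : x ∈ F.Ω) {P A B : ℝ → E} {p a b : E} (hP : HasDerivAt P p 0) (hA : HasDerivAt A a 0) (hB : HasDerivAt B b 0) (h0 : P 0 = x) :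
    HasDerivAt (fun t => A t + F.J (P t) (B t)) (a + (fderiv ℝ F.J x p (B 0) + F.J x b)) 0 := by
  have h1 : HasFDerivAt F.J (fderiv ℝ F.J x) (P 0) :=
    h0.symm ▸ ((F.hJ.contDiffAt (F.hΩ.mem_nhds hx)).differentiableAt (by simp)).hasFDerivAt
  have h2 := (h1.comp_hasDerivAt (0:ℝ) hP).clm_apply hB
  rw [Function.comp_apply, h0] at h2
  exact hA.add h2

theorem bb_one {z : ℂ} (hz : z ∈ ball (0:ℂ) F.R) (c : ℂ) : fderiv ℝ F.bb (z, 0) (0, (c, 0)) = 0 := by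
  have hb : HasFDerivAt F.bb (fderiv ℝ F.bb (z, 0)) (z, (((0:ℝ) • c, 0) : V2)) := by
    rw [zero_smul]
    exact ((F.bb_cd.contDiffAt (F.O_open.mem_nhds (F.O_zero hz))).differentiableAt (by simp)).hasFDerivAt
  have hl : HasDerivAt (fun t : ℝ => t • c) c 0 := by simpa using (hasDerivAt_id (0:ℝ)).smul_const c
  have hL : HasDerivAt (fun t : ℝ => (z, ((t • c, 0) : V2))) (0, (c, 0)) 0 :=
    (hasDerivAt_const _ _).prodMk (hl.prodMk (hasDerivAt_const _ _))
  have e1 := hb.comp_hasDerivAt (0:ℝ) hL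
  set D2 := fderiv ℝ (fderiv ℝ F.f) z with hD2
  set D := fderiv ℝ F.f z with hD
  have lin : ∀ (v : E) (L : ℂ →L[ℝ] E), HasDerivAt (fun t : ℝ => v + L (t • c)) (L c) 0 := fun v L =>
    (L.hasFDerivAt.comp_hasDerivAt (0:ℝ) hl).const_add v
  have g1 := F.gam (F.hm hz) (lin (F.f z) D) (lin (D 1) (D2 1)) (lin (D Complex.I) (D2 Complex.I)) (by simp)
  have hw : HasDerivAt (fun t : ℝ => z + t • c) c 0 := hl.const_add z
  have ev : ∀ᶠ t : ℝ in 𝓝 0, z + t • c ∈ ball (0:ℂ) F.R :=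
    hw.continuousAt.eventually (isOpen_ball.mem_nhds (by simpa using hz))
  have hz0 : z + (0:ℝ) • c = z := by simp
  have dF : HasDerivAt (fun t : ℝ => F.f (z + t • c)) (D c) 0 := (hz0.symm ▸ F.df_at hz : HasFDerivAt F.f D (z + (0:ℝ) • c)).comp_hasDerivAt (0:ℝ) hw
  have ddF : ∀ ξ : ℂ, HasDerivAt (fun t : ℝ => fderiv ℝ F.f (z + t • c) ξ) (D2 c ξ) 0 := fun ξ => by
    have h1 : HasFDerivAt (fderiv ℝ F.f) D2 (z + (0:ℝ) • c) := hz0.symm ▸ F.ddf_at hz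
    exact (ContinuousLinearMap.apply ℝ E ξ).hasFDerivAt.comp_hasDerivAt (0:ℝ) (h1.comp_hasDerivAt (0:ℝ) hw)
  have g2 := F.gam (F.hm hz) dF (ddF 1) (ddF Complex.I) (by simp)
  have g3 : HasDerivAt (fun _ : ℝ => (0:E)) _ 0 := g2.congr_of_eventuallyEq (by
    filter_upwards [ev] with t ht using (F.heq0 ht).symm)
  have sym : ∀ ξ, D2 ξ c = D2 c ξ := fun ξ =>
    ((F.hf.contDiffAt (isOpen_ball.mem_nhds hz)).isSymmSndFDerivAt (by simp; exact WithTop.coe_le_coe.2 (le_top : (2 : ℕ∞) ≤ ⊤))) ξ c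
  have hval := g3.unique (hasDerivAt_const (0:ℝ) (0:E))
  rw [sym 1, sym Complex.I] at g1
  simp only [zero_smul, map_zero, add_zero] at g1 hval
  rw [hval] at g1
  have g4 : HasDerivAt (fun t : ℝ => F.S (z, (t • c, 0))) 0 0 := g1.congr_of_eventuallyEq (Eventually.of_forall fun t => F.S_line hz _)
  have g5 := ((F.h z).hasFDerivAt.comp_hasDerivAt (0:ℝ) g4).neg
  have := e1.unique g5
  simpa using this

end Fr
end JH

namespace JH
open scoped ContDiff

theorem cut_cc {A B : Type} [NormedAddCommGroup A] [NormedSpace ℝ A] [NormedAddCommGroup B] [NormedSpace ℝ B] {χ : A → ℝ} {G : A → B} {O : Set A}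
    (hχ : ContDiff ℝ ∞ χ) (hc : HasCompactSupport χ) (hO : IsOpen O) (hs : tsupport χ ⊆ O) (hG : ContDiffOn ℝ ∞ G O) : Cc fun p => χ p • G p := by
  refine ⟨contDiff_iff_contDiffAt.2 fun p => ?_, hc.mono (Function.support_smul_subset_left _ _)⟩
  by_cases hp : p ∈ tsupport χ
  · exact hχ.contDiffAt.smul (hG.contDiffAt (hO.mem_nhds (hs hp)))
  · refine contDiffAt_const (c := (0:B)) |>.congr_of_eventuallyEq ?_
    filter_upwards [(isClosed_tsupport χ).isOpen_compl.mem_nhds hp] with q hq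
    simp [image_eq_zero_of_notMem_tsupport hq]

namespace Fr
variable {E : Type} [NormedAddCommGroup E] [NormedSpace ℝ E] (F : Fr E)

theorem J_eq {p : ℂ × V2} (hp : p ∈ F.O) (D : ℂ →L[ℝ] V2)
    (h : D 1 + Complex.I • D Complex.I = F.Mm p (D Complex.I) + F.bb p) (ξ : ℂ) :
    fderiv ℝ F.N p (Complex.I * ξ, D (Complex.I * ξ)) = F.J (F.N p) (fderiv ℝ F.N p (ξ, D ξ)) := by
  obtain ⟨z, ζ⟩ := p
  have hz : z ∈ ball (0:ℂ) F.R := hp.1.1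
  set T := fderiv ℝ F.N (z, ζ) with hT
  have hN : HasFDerivAt F.N T (z, ζ) := ((F.N_at hp).differentiableAt (by simp)).hasFDerivAt
  have hT0 : ∀ c, T (0, c) = F.g z c := by
    intro c
    have h1 : HasFDerivAt (fun w : V2 => (z, w)) (ContinuousLinearMap.inr ℝ ℂ V2) ζ := hasFDerivAt_prodMk_right z ζ
    have h2 := hN.comp ζ h1
    have h3 : HasFDerivAt (F.N ∘ fun w : V2 => (z, w)) (F.g z) ζ := (F.g z).hasFDerivAt.const_add (F.f z)
    exact congrArg (fun L => L c) (h2.unique h3)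
  let L : ℂ →L[ℝ] E := T ∘L (ContinuousLinearMap.id ℝ ℂ).prod D
  have hL : ∀ ξ, T (ξ, D ξ) = L ξ := fun _ => rfl
  have hL2 : ∀ ξ, L ξ = T (ξ, 0) + F.g z (D ξ) := fun ξ => by
    rw [← hT0, ← map_add, ← hL]; simp
  have h1 : L 1 + F.J (F.N (z, ζ)) (L Complex.I) = 0 := by
    have e1 : D 1 = -(F.h z (F.J (F.N (z, ζ)) (F.g z (D Complex.I)))) - F.h z (F.S (z, ζ)) := by
      have : F.Mm (z, ζ) (D Complex.I) = Complex.I • D Complex.I - F.h z (F.J (F.N (z, ζ)) (F.g z (D Complex.I))) := rfl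
      rw [this, bb] at h
      rw [← sub_eq_zero] at h ⊢
      rw [← h]; abel
    rw [hL2, hL2, e1, map_sub, map_neg, F.hr z hz, F.hr z hz, S, map_add, ← hT]
    abel
  have h2 : F.J (F.N (z, ζ)) (L 1) = L Complex.I := by
    rw [eq_neg_of_add_eq_zero_left h1, map_neg, F.hJ2 _ hp.2, neg_neg]
  have h3 : F.J (F.N (z, ζ)) (L Complex.I) = - L 1 := eq_neg_of_add_eq_zero_right h1
  have hsp : ∀ ξ : ℂ, L ξ = ξ.re • L 1 + ξ.im • L Complex.I := fun ξ => by
    rw [← map_smul, ← map_smul, ← map_add]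
    congr 1
    apply Complex.ext <;> simp
  rw [hL, hL, hsp (Complex.I * ξ), hsp ξ, map_add, map_smul, map_smul, h2, h3]
  simp; abel

theorem sol {r0 r1 : ℝ} (h0 : 0 < r0) (h01 : r0 < r1) (h1R : r1 < F.R) : ∃ (δ : ℝ) (Z : ℂ × ℂ → V2), 0 < δ ∧
    (∀ z x, ‖z‖ < r1 → ‖x‖ < δ → ContDiffAt ℝ ∞ Z (z, x) ∧ (z, Z (z, x)) ∈ F.O) ∧
    (∀ z x, ‖z‖ < r0 → ‖x‖ < δ → ∃ D : ℂ →L[ℝ] E, HasFDerivAt (fun z => F.N (z, Z (z, x))) D z ∧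
      ∀ ξ, D (Complex.I * ξ) = F.J (F.N (z, Z (z, x))) (D ξ)) ∧
    (∀ z, Z (z, 0) = 0) ∧
    (∀ z, ‖z‖ < r1 → ∃ D : ℂ →L[ℝ] V2, HasFDerivAt (fun x => Z (z, x)) D 0 ∧ ∀ v ≠ 0, (D v).2 ≠ 0) := by
  obtain ⟨κ, hκ, hsub⟩ : ∃ κ, 0 < κ ∧ closedBall (0:ℂ) r1 ×ˢ closedBall (0:V2) κ ⊆ F.O := by
    have hc : IsCompact (closedBall (0:ℂ) r1 ×ˢ {(0:V2)}) := (isCompact_closedBall _ _).prod isCompact_singleton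
    obtain ⟨κ, hκ, h⟩ := hc.exists_cthickening_subset_open F.O_open (by
      rintro ⟨z, ζ⟩ ⟨hz, rfl⟩
      exact F.O_zero (closedBall_subset_ball h1R hz))
    refine ⟨κ, hκ, fun p hp => h (mem_cthickening_of_dist_le p (p.1, 0) κ _ ⟨hp.1, rfl⟩ ?_)⟩
    rw [Prod.dist_eq, dist_self]
    exact max_le hκ.le hp.2
  let χ1 : ContDiffBump (0:ℂ) := ⟨r0, r1, h0, h01⟩
  let χ2 : ContDiffBump (0:V2) := ⟨κ / 2, κ, by positivity, by linarith⟩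
  let χ : ℂ × V2 → ℝ := fun p => χ1 p.1 * χ2 p.2
  have hχ : ContDiff ℝ ∞ χ := (χ1.contDiff.comp contDiff_fst).mul (χ2.contDiff.comp contDiff_snd)
  have hz1 : ∀ p, r1 ≤ ‖p.1‖ → χ p = 0 := fun p hp => by
    simp only [χ]; rw [χ1.zero_of_le_dist (by rw [dist_zero_right]; exact hp), zero_mul]
  have hz2 : ∀ p, κ ≤ ‖p.2‖ → χ p = 0 := fun p hp => by
    simp only [χ]; rw [χ2.zero_of_le_dist (by rw [dist_zero_right]; exact hp), mul_zero]
  have hone : ∀ z ζ, ‖z‖ < r0 → ‖ζ‖ < κ / 2 → χ (z, ζ) = 1 := fun z ζ hz hζ => by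
    simp only [χ]
    rw [χ1.one_of_mem_closedBall (mem_closedBall_zero_iff.2 hz.le), χ2.one_of_mem_closedBall (mem_closedBall_zero_iff.2 hζ.le), mul_one]
  have hK : IsCompact (closedBall (0:ℂ) r1 ×ˢ closedBall (0:V2) κ) := (isCompact_closedBall _ _).prod (isCompact_closedBall _ _)
  have hsupp : Function.support χ ⊆ closedBall (0:ℂ) r1 ×ˢ closedBall (0:V2) κ := fun p hp => by
    refine ⟨mem_closedBall_zero_iff.2 ?_, mem_closedBall_zero_iff.2 ?_⟩
    · by_contra! h; exact hp (hz1 p h.le)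
    · by_contra! h; exact hp (hz2 p h.le)
  have hts : tsupport χ ⊆ closedBall (0:ℂ) r1 ×ˢ closedBall (0:V2) κ := closure_minimal hsupp hK.isClosed
  have hcs : HasCompactSupport χ := hK.of_isClosed_subset (isClosed_tsupport _) hts
  have hb := cut_cc hχ hcs F.O_open (hts.trans hsub) F.bb_cd
  let d : Dat :=
    { M := fun p => χ p • F.Mm p
      b := fun p => χ p • F.bb p
      hM := cut_cc hχ hcs F.O_open (hts.trans hsub) F.Mm_cd
      hb := hb
      M0 := fun z => by
        by_cases hz : z ∈ ball (0:ℂ) F.R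
        · simp only [F.Mm_zero hz, smul_zero]
        · rw [mem_ball_zero_iff, not_lt] at hz
          simp only [hz1 (z, 0) (h1R.le.trans hz), zero_smul]
      b0 := fun z => by
        by_cases hz : z ∈ ball (0:ℂ) F.R
        · simp only [F.bb_zero hz, smul_zero]
        · rw [mem_ball_zero_iff, not_lt] at hz
          simp only [hz1 (z, 0) (h1R.le.trans hz), zero_smul]
      b1 := fun z c => by
        by_cases hz : z ∈ ball (0:ℂ) F.R
        · have e1 : HasFDerivAt χ (fderiv ℝ χ (z, 0)) (z, 0) := (hχ.differentiable (by simp) _).hasFDerivAt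
          have e2 : HasFDerivAt F.bb (fderiv ℝ F.bb (z, 0)) (z, 0) :=
            ((F.bb_cd.contDiffAt (F.O_open.mem_nhds (F.O_zero hz))).differentiableAt (by simp)).hasFDerivAt
          have e3 : HasFDerivAt (fun p => χ p • F.bb p) _ (z, (0:V2)) := e1.smul e2
          rw [e3.fderiv, add_apply, smul_apply, F.bb_one hz, F.bb_zero hz]
          simp
        · rw [mem_ball_zero_iff, not_lt] at hz
          have : (fun p => χ p • F.bb p) =ᶠ[𝓝 (z, (0:V2))] fun _ => 0 := by
            have : ∀ᶠ p : ℂ × V2 in 𝓝 (z, (0:V2)), r1 < ‖p.1‖ :=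
              (continuous_fst.norm.continuousAt).eventually (lt_mem_nhds (h1R.trans_le hz))
            filter_upwards [this] with p hp
            rw [hz1 p hp.le, zero_smul]
          rw [this.fderiv_eq]; simp
      r := r1
      hr := h0.trans h01
      Ms := fun z ζ hz => by simp only [hz1 (z, ζ) hz.le, zero_smul]
      bs := fun z ζ hz => by simp only [hz1 (z, ζ) hz.le, zero_smul] }
  obtain ⟨δ, Z, hδ, k1, k2, k3⟩ := d.exist (show 0 < κ / 2 by positivity)
  have hO : ∀ z x, ‖z‖ < r1 → ‖x‖ < δ → (z, Z (z, x)) ∈ F.O := fun z x hz hx =>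
    hsub ⟨mem_closedBall_zero_iff.2 hz.le, mem_closedBall_zero_iff.2 (by linarith [(k1 z x hz hx).2.1])⟩
  refine ⟨δ, Z, hδ, fun z x hz hx => ⟨(k1 z x hz hx).1, hO z x hz hx⟩, fun z x hz hx => ?_, k2, k3⟩
  obtain ⟨_, hlt, D, hD, he⟩ := k1 z x (hz.trans h01) hx
  have hp := hO z x (hz.trans h01) hx
  have hN : HasFDerivAt F.N (fderiv ℝ F.N (z, Z (z, x))) (z, Z (z, x)) := ((F.N_at hp).differentiableAt (by simp)).hasFDerivAt
  refine ⟨_, HasFDerivAt.comp (f := fun z => (z, Z (z, x))) z hN ((hasFDerivAt_id z).prodMk hD), fun ξ => ?_⟩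
  refine F.J_eq hp D ?_ ξ
  rw [he]
  simp only [d, hone z _ hz hlt, one_smul]

end Fr
end JH

namespace JH
open scoped ContDiff

theorem fib {X E : Type} [NormedAddCommGroup X] [NormedSpace ℝ X] [CompleteSpace X] [NormedAddCommGroup E] [NormedSpace ℝ E] {H : ℂ × X → E} {U : Set (ℂ × X)}
    {r0 : ℝ} (hU : IsOpen U) (hH : ContDiffOn ℝ ∞ H U) (hK : closedBall (0:ℂ) r0 ×ˢ {(0:X)} ⊆ U) (hinj : InjOn (fun z => H (z, 0)) (closedBall 0 r0))
    (hd : ∀ z ∈ closedBall (0:ℂ) r0, ∃ e : (ℂ × X) ≃L[ℝ] E, HasFDerivAt H (e : (ℂ × X) →L[ℝ] E) (z, 0)) :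
    ∃ δ > 0, ball (0:ℂ) r0 ×ˢ ball (0:X) δ ⊆ U ∧ ∃ Ψ : E → ℂ × X, IsOpen (H '' (ball (0:ℂ) r0 ×ˢ ball (0:X) δ)) ∧
      ContDiffOn ℝ ∞ Ψ (H '' (ball (0:ℂ) r0 ×ˢ ball (0:X) δ)) ∧ InjOn H (ball (0:ℂ) r0 ×ˢ ball (0:X) δ) ∧
      ∀ x ∈ ball (0:ℂ) r0 ×ˢ ball (0:X) δ, Ψ (H x) = x := by
  let K := closedBall (0:ℂ) r0 ×ˢ {(0:X)}
  let P : ℂ × X → Prop := fun x' => ∃ g : E → ℂ × X, (∀ᶠ y in 𝓝 (H x'), ContDiffAt ℝ ∞ g y ∧ H (g y) = y) ∧ ∀ᶠ x in 𝓝 x', g (H x) = x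
  have hKc : IsCompact K := (isCompact_closedBall _ _).prod isCompact_singleton
  have hcont : ∀ x ∈ U, ContinuousAt H x := fun x hx => hH.continuousOn.continuousAt (hU.mem_nhds hx)
  have hift : ∀ a ∈ K, ∃ g : E → ℂ × X, (∀ᶠ y in 𝓝 (H a), ContDiffAt ℝ ∞ g y ∧ H (g y) = y) ∧ ∀ᶠ x in 𝓝 a, g (H x) = x := by
    rintro ⟨z, x⟩ ⟨hz, rfl⟩
    obtain ⟨e, he⟩ := hd z hz
    obtain ⟨g, h1, h2, _⟩ := ift hU hH (hK ⟨hz, rfl⟩) he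
    exact ⟨g, h1, h2⟩
  have hP : {x | P x} ∈ 𝓝ˢ K := by
    rw [mem_nhdsSet_iff_forall]
    intro a ha
    obtain ⟨g, h1, h2⟩ := hift a ha
    have h3 := (hcont a (hK ha)).eventually (eventually_eventually_nhds.2 h1)
    filter_upwards [h3, eventually_eventually_nhds.2 h2] with x k1 k2 using ⟨g, k1, k2⟩
  obtain ⟨t, ht, htinj⟩ : ∃ t ∈ 𝓝ˢ K, InjOn H t := by
    refine InjOn.exists_mem_nhdsSet ?_ hKc (fun a ha => hcont a (hK ha)) fun a ha => ?_
    · rintro ⟨z, x⟩ ⟨hz, rfl⟩ ⟨w, y⟩ ⟨hw, rfl⟩ h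
      exact Prod.ext (hinj hz hw h) rfl
    · obtain ⟨g, -, h2⟩ := hift a ha
      exact ⟨_, h2, fun x hx y hy hxy => by
        have hx' : g (H x) = x := hx
        rw [← hx', hxy]; exact hy⟩
  obtain ⟨U', hU'o, hKU', hU's⟩ := mem_nhdsSet_iff_exists.1 (inter_mem (inter_mem hP ht) (hU.mem_nhdsSet.2 hK))
  obtain ⟨δ, hδ, hth⟩ := hKc.exists_cthickening_subset_open hU'o hKU'
  set B := ball (0:ℂ) r0 ×ˢ ball (0:X) δ with hB
  have hBU : B ⊆ U' := fun p hp => hth (mem_cthickening_of_dist_le p (p.1, 0) δ _ ⟨ball_subset_closedBall hp.1, rfl⟩ (by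
    rw [Prod.dist_eq, dist_self]
    exact max_le hδ.le (mem_ball.1 hp.2).le))
  have hBo : IsOpen B := isOpen_ball.prod isOpen_ball
  have hBi : InjOn H B := htinj.mono fun x hx => (hU's (hBU hx)).1.2
  have key : ∀ x ∈ B, ∃ g : E → ℂ × X, ContDiffAt ℝ ∞ g (H x) ∧ ∀ᶠ y in 𝓝 (H x), g y ∈ B ∧ H (g y) = y := by
    intro x hx
    obtain ⟨g, h1, h2⟩ := (hU's (hBU hx)).1.1
    have h3 := h1.self_of_nhds.1
    have h4 : g (H x) = x := h2.self_of_nhds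
    refine ⟨g, h3, ?_⟩
    filter_upwards [h1, h3.continuousAt.eventually (hBo.mem_nhds (h4.symm ▸ hx))] with y k1 k2 using ⟨k2, k1.2⟩
  refine ⟨δ, hδ, fun x hx => (hU's (hBU hx)).2, Function.invFunOn H B, ?_, ?_, hBi, fun x hx => hBi.leftInvOn_invFunOn hx⟩
  · rw [isOpen_iff_mem_nhds]
    rintro _ ⟨x, hx, rfl⟩
    obtain ⟨g, -, h⟩ := key x hx
    filter_upwards [h] with y hy using ⟨_, hy.1, hy.2⟩
  · rintro _ ⟨x, hx, rfl⟩
    obtain ⟨g, h1, h⟩ := key x hx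
    refine (h1.congr_of_eventuallyEq ?_).contDiffWithinAt
    filter_upwards [h] with y hy
    have := hBi.leftInvOn_invFunOn hy.1
    rwa [hy.2] at this

theorem main {E : Type} [NormedAddCommGroup E] [NormedSpace ℝ E] [FiniteDimensional ℝ E] (hdim : Module.finrank ℝ E = 4) {Ω : Set E} (hΩ : IsOpen Ω)
    {J : E → E →L[ℝ] E} (hJ : ContDiffOn ℝ ∞ J Ω) (hJ2 : ∀ x ∈ Ω, ∀ v, J x (J x v) = -v) {f : ℂ → E} {r0 R : ℝ} (h0 : 0 < r0) (hR : r0 < R)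
    (hm : MapsTo f (ball 0 R) Ω) (hfd : ∀ z ∈ ball (0:ℂ) R, DifferentiableAt ℝ f z)
    (heq : ∀ z ∈ ball (0:ℂ) R, ∀ ξ, fderiv ℝ f z (Complex.I * ξ) = J (f z) (fderiv ℝ f z ξ))
    (hdi : ∀ z ∈ ball (0:ℂ) R, Function.Injective (fderiv ℝ f z)) (hinj : InjOn f (ball 0 R)) :
    ∃ (δ : ℝ) (Φ : ℂ × (ℝ × ℝ) → E) (Ψ : E → ℂ × (ℝ × ℝ)), 0 < δ ∧ ContDiffOn ℝ ∞ Φ (ball (0:ℂ) r0 ×ˢ ball (0 : ℝ × ℝ) δ) ∧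
      IsOpen (Φ '' (ball (0:ℂ) r0 ×ˢ ball (0 : ℝ × ℝ) δ)) ∧ ContDiffOn ℝ ∞ Ψ (Φ '' (ball (0:ℂ) r0 ×ˢ ball (0 : ℝ × ℝ) δ)) ∧
      InjOn Φ (ball (0:ℂ) r0 ×ˢ ball (0 : ℝ × ℝ) δ) ∧ (∀ x ∈ ball (0:ℂ) r0 ×ˢ ball (0 : ℝ × ℝ) δ, Ψ (Φ x) = x) ∧
      (∀ z ∈ ball (0:ℂ) r0, Φ (z, 0) = f z) ∧ ∀ z ∈ ball (0:ℂ) r0, ∀ x ∈ ball (0 : ℝ × ℝ) δ, Φ (z, x) ∈ Ω ∧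
        ∃ D : ℂ →L[ℝ] E, HasFDerivAt (fun z => Φ (z, x)) D z ∧ ∀ ξ, D (Complex.I * ξ) = J (Φ (z, x)) (D ξ) := by
  have hf : ContDiffOn ℝ ∞ f (ball 0 R) := reg_all hΩ hJ hJ2 isOpen_ball (fun z hz => hm hz) hfd fun z hz => by
    simpa using heq z hz 1
  obtain ⟨r2, h02, h2R⟩ := exists_between hR
  obtain ⟨r1, h01, h12⟩ := exists_between h02
  obtain ⟨g, h, hg, hh, hgh⟩ := frame_g hdim hJ hJ2 (h0.trans h02) h2R hf hm heq hdi
  have hs2 : ball (0:ℂ) r2 ⊆ ball 0 R := ball_subset_ball h2R.le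
  let F : Fr E := ⟨Ω, J, f, r2, g, h, hΩ, hJ, hJ2, hf.mono hs2, hm.mono_left hs2, fun z hz => heq z (hs2 hz), hg, hh,
    fun z hz => (hgh z hz).1, fun z hz => (hgh z hz).2.1, fun z hz => (hgh z hz).2.2.1, fun z hz => (hgh z hz).2.2.2⟩
  obtain ⟨δ, Z, hδ, k1, k2, k3, k4⟩ := F.sol h0 h01 h12
  let τ : (ℝ × ℝ) ≃L[ℝ] ℂ := Complex.equivRealProdCLM.symm
  let U : Set (ℂ × (ℝ × ℝ)) := ball 0 r1 ×ˢ (τ ⁻¹' ball 0 δ)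
  let G : ℂ × (ℝ × ℝ) → ℂ × V2 := fun p => (p.1, Z (p.1, τ p.2))
  let H : ℂ × (ℝ × ℝ) → E := fun p => F.N (G p)
  have hUo : IsOpen U := isOpen_ball.prod (isOpen_ball.preimage τ.continuous)
  have hnz : ∀ p ∈ U, ‖p.1‖ < r1 := fun p hp => mem_ball_zero_iff.1 hp.1
  have hnx : ∀ p ∈ U, ‖τ p.2‖ < δ := fun p hp => mem_ball_zero_iff.1 hp.2
  have hZ : ∀ p ∈ U, ContDiffAt ℝ ∞ (fun p : ℂ × (ℝ × ℝ) => Z (p.1, τ p.2)) p := fun p hp =>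
    ContDiffAt.comp (f := fun p : ℂ × (ℝ × ℝ) => (p.1, τ p.2)) p (k1 p.1 (τ p.2) (hnz p hp) (hnx p hp)).1
      (contDiffAt_fst.prodMk (τ.contDiff.contDiffAt.comp p contDiffAt_snd))
  have hGO : ∀ p ∈ U, G p ∈ F.O := fun p hp => (k1 _ _ (hnz p hp) (hnx p hp)).2
  have hHat : ∀ p ∈ U, ContDiffAt ℝ ∞ H p := fun p hp => (F.N_at (hGO p hp)).comp p (contDiffAt_fst.prodMk (hZ p hp))
  have hH : ContDiffOn ℝ ∞ H U := fun p hp => (hHat p hp).contDiffWithinAt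
  have hKU : closedBall (0:ℂ) r0 ×ˢ {(0:ℝ × ℝ)} ⊆ U := by
    rintro ⟨z, x⟩ ⟨hz, rfl⟩
    exact ⟨closedBall_subset_ball h01 hz, by simpa using hδ⟩
  have hHz : ∀ z, H (z, 0) = f z := fun z => by
    simp only [H, G]; rw [map_zero, k3, F.N_zero]
  have hfr : Module.finrank ℝ (ℂ × (ℝ × ℝ)) = Module.finrank ℝ E := by rw [hdim]; simp
  have hderiv : ∀ z ∈ closedBall (0:ℂ) r0, ∃ e : (ℂ × (ℝ × ℝ)) ≃L[ℝ] E, HasFDerivAt H (e : (ℂ × (ℝ × ℝ)) →L[ℝ] E) (z, 0) := by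
    intro z hz
    have hp : (z, (0:ℝ × ℝ)) ∈ U := hKU ⟨hz, rfl⟩
    have hzr : z ∈ ball (0:ℂ) r2 := ball_subset_ball h12.le hp.1
    obtain ⟨D, hD, hDn⟩ := k4 z (hnz _ hp)
    have hL : HasFDerivAt H (fderiv ℝ H (z, 0)) (z, 0) := ((hHat _ hp).differentiableAt (by simp)).hasFDerivAt
    set L := fderiv ℝ H (z, 0) with hLdef
    have e1 : ∀ ξ, L (ξ, 0) = g z (ξ, 0) := by
      intro ξ
      have c1 : HasFDerivAt (fun w : ℂ => (w, (0:ℝ × ℝ))) (ContinuousLinearMap.inl ℝ ℂ (ℝ × ℝ)) z := hasFDerivAt_prodMk_left z _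
      have c2 := hL.comp z c1
      have c3 : (H ∘ fun w : ℂ => (w, (0:ℝ × ℝ))) = f := funext fun w => hHz w
      rw [c3] at c2
      rw [(hgh z hzr).2.2.2, c2.fderiv]; rfl
    have e2 : ∀ v, L (0, v) = g z (D (τ v)) := by
      intro v
      have c1 : HasFDerivAt (fun w : ℝ × ℝ => (z, w)) (ContinuousLinearMap.inr ℝ ℂ (ℝ × ℝ)) 0 := hasFDerivAt_prodMk_right z _
      have c2 := hL.comp 0 c1
      have c3 : HasFDerivAt (fun x : ℝ × ℝ => Z (z, τ x)) (D ∘L (τ : (ℝ × ℝ) →L[ℝ] ℂ)) 0 :=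
        HasFDerivAt.comp (g := fun x => Z (z, x)) 0 (by simpa using hD) τ.hasFDerivAt
      have c4 : HasFDerivAt (fun x : ℝ × ℝ => f z + g z (Z (z, τ x))) (g z ∘L (D ∘L (τ : (ℝ × ℝ) →L[ℝ] ℂ))) 0 :=
        ((g z).hasFDerivAt.comp 0 c3).const_add _
      exact congrArg (fun T => T v) (c2.unique c4)
    have hLi : Function.Injective L := by
      rw [injective_iff_map_eq_zero]
      rintro ⟨ξ, v⟩ hv
      have c1 : L (ξ, v) = g z ((ξ, 0) + D (τ v)) := by
        rw [map_add, ← e1, ← e2, ← map_add]; simp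
      rw [c1] at hv
      have c2 : ((ξ, 0) : V2) + D (τ v) = 0 := by
        rw [← (hgh z hzr).1 ((ξ, 0) + D (τ v)), hv, map_zero]
      have c3 : v = 0 := by
        by_contra hv0
        refine hDn (τ v) (fun h => hv0 (τ.injective (h.trans (map_zero _).symm))) ?_
        simpa using congrArg Prod.snd c2
      subst c3
      simpa using c2
    refine ⟨(LinearEquiv.ofInjectiveOfFinrankEq (L : (ℂ × (ℝ × ℝ)) →ₗ[ℝ] E) hLi hfr).toContinuousLinearEquiv, ?_⟩
    convert hL using 1
    ext v <;> rfl
  obtain ⟨δ', hδ', hBU, Ψ, w1, w2, w3, w4⟩ := fib hUo hH hKU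
    (fun z hz w hw h => hinj (closedBall_subset_ball hR hz) (closedBall_subset_ball hR hw) (by
      have h' : H (z, 0) = H (w, 0) := h
      rwa [hHz, hHz] at h')) hderiv
  refine ⟨δ', H, Ψ, hδ', hH.mono hBU, w1, w2, w3, w4, fun z _ => hHz z, fun z hz x hx => ?_⟩
  have hp : (z, x) ∈ U := hBU ⟨hz, hx⟩
  exact ⟨(hGO _ hp).2, k2 z (τ x) (mem_ball_zero_iff.1 hz) (hnx _ hp)⟩

end JH

set_option maxSynthPendingDepth 1

/-- in complex dimension 2, a neighborhood of (a slightly shrunk) embedded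
`J`-holomorphic disc can be smoothly fibered by `J`-holomorphic discs. -/
theorem jholo_disc_fibration
    (Ω : Set (Cn 2)) (hΩ : IsOpen Ω) (hne : Ω.Nonempty)
    (J : Cn 2 → (Cn 2 →L[ℝ] Cn 2)) (hJ : IsAlmostComplexOn 2 Ω J)
    (R : ℝ) (hR : 0 < R) (f : ℂ → Cn 2) (hf : IsJHolomorphicOn 2 Ω J R f)
    (hinj : InjOn f (ball (0:ℂ) R))
    (hdinj : ∀ z ∈ ball (0:ℂ) R, Function.Injective (fderiv ℝ f z))
    (hemb : Topology.IsEmbedding fun z : ball (0:ℂ) R => f z)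
    (ε : ℝ) (hε : ε ∈ Set.Ioo 0 R) :
    ∃ (W : Set (Cn 2)) (V : Set (ℝ × ℝ)) (Φ : ℂ × (ℝ × ℝ) → Cn 2)
      (Ψ : Cn 2 → ℂ × (ℝ × ℝ)),
      IsOpen W ∧ f '' ball (0:ℂ) (R - ε) ⊆ W ∧ W ⊆ Ω ∧
      IsOpen V ∧ ((0:ℝ), (0:ℝ)) ∈ V ∧
      ContDiffOn ℝ (⊤ : ℕ∞) Φ (ball (0:ℂ) (R - ε) ×ˢ V) ∧
      ContDiffOn ℝ (⊤ : ℕ∞) Ψ W ∧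
      BijOn Φ (ball (0:ℂ) (R - ε) ×ˢ V) W ∧
      (∀ x ∈ ball (0:ℂ) (R - ε) ×ˢ V, Ψ (Φ x) = x) ∧
      (∀ w ∈ W, Φ (Ψ w) = w) ∧
      (∀ z ∈ ball (0:ℂ) (R - ε), Φ (z, ((0:ℝ), (0:ℝ))) = f z) ∧
      (∀ x ∈ V, IsJHolomorphicOn 2 Ω J (R - ε) fun z => Φ (z, x)) := by
  obtain ⟨hε0, hεR⟩ := hε
  have hJ1 : ∀ x ∈ Ω, ∀ v, J x (J x v) = -v := fun x hx v => by
    have h := congrArg (fun L => L v) (hJ.2 x hx)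
    simpa using h
  have hdim : Module.finrank ℝ (Cn 2) = 4 := by
    rw [← Module.finrank_mul_finrank ℝ ℂ (Cn 2), Complex.finrank_real_complex, finrank_euclideanSpace_fin]
  obtain ⟨δ, Φ, Ψ, hδ, h1, h2, h3, h4, h5, h6, h7⟩ := JH.main hdim hΩ hJ.1 hJ1 (r0 := R - ε) (R := R) (by linarith) (by linarith)
    hf.1 (fun z hz => (hf.2 z hz).1) (fun z hz => (hf.2 z hz).2) hdinj hinj
  have m0 : ((0:ℝ), (0:ℝ)) ∈ ball (0 : ℝ × ℝ) δ := mem_ball_self hδ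
  refine ⟨Φ '' (ball (0:ℂ) (R - ε) ×ˢ ball (0 : ℝ × ℝ) δ), ball (0 : ℝ × ℝ) δ, Φ, Ψ, h2, ?_, ?_, isOpen_ball, m0, h1, h3, h4.bijOn_image, h5, ?_,
    fun z hz => h6 z hz, fun x hx => ⟨fun z hz => (h7 z hz x hx).1, fun z hz => ?_⟩⟩
  · rintro _ ⟨z, hz, rfl⟩
    exact ⟨(z, (0, 0)), ⟨hz, m0⟩, h6 z hz⟩
  · rintro _ ⟨⟨z, x⟩, ⟨hz, hx⟩, rfl⟩
    exact (h7 z hz x hx).1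
  · rintro _ ⟨x, hx, rfl⟩
    rw [h5 x hx]
  · obtain ⟨D, hD, hDJ⟩ := (h7 z hz x hx).2
    exact ⟨hD.differentiableAt, fun ξ => by rw [hD.fderiv]; exact hDJ ξ⟩
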